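/- Let n ≥ 3, let k ≥ 1 be an integer, and let a > 0 be such that for all s ∈ (0,1] and all 1 ≤ i ≤ k one has a − ln X_i(a,s) > 0 (so that X_1(a,s), …, X_{k+1}(a,s) are well defined and positive on (0,1]). Assume moreover that P := X_1(a,1) · X_2(a,1) ⋯ X_{k+1}(a,1) > n−2. Then for every u ∈ C_c^∞(B_1), ∫_{B_1} |∇u|² dx ≥ ((n-2)/2)² ∫_{B_1} u²/|x|² dx + (1/4) Σ_{i=1}^{k} ∫_{B_1} (X_1(a,|x|)² ⋯ X_i(a,|x|)²)/|x|² · u² dx + P^{-2(n-1)/n} S_n · ( ∫_{B_1} ( X_1(a,|x|) ⋯ X_{k+1}(a,|x|) )^{2(n-1)/(n-2)} |u|^{2n/(n-2)} dx )^{(n-2)/n}, and the constant P^{-2(n-1)/n} S_n is best possible: for every C > P^{-2(n-1)/n} S_n there is a nonzero u ∈ C_c^∞(B_1) for which the inequality with C in place of P^{-2(n-1)/n} S_n fails. -/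

import Mathlib

open MeasureTheory Real

/-- The best Sobolev constant `S_n = π n (n-2) (Γ(n/2)/Γ(n))^(2/n)`. -/
noncomputable def sobolevConst (n : ℕ) : ℝ :=
  Real.pi * n * ((n : ℝ) - 2) * (Real.Gamma ((n : ℝ) / 2) / Real.Gamma (n : ℝ)) ^ (2 / (n : ℝ))

/-- `X_1(a,s) = (a - ln s)⁻¹`. -/
noncomputable def X1 (a s : ℝ) : ℝ := (a - Real.log s)⁻¹

/-- Iterated logarithm functions: `Xiter a i s` is `X_i(a,s)`, with `X_0(a,s) = s`. -/
noncomputable def Xiter (a : ℝ) : ℕ → ℝ → ℝ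
  | 0, s => s
  | (i + 1), s => X1 a (Xiter a i s)

open Filter Topology in
theorem StrictMono.range_eq_Ioo_of_tendsto {f : ℝ → ℝ} {l M : ℝ} (hf : StrictMono f)
    (hc : Continuous f) (hb : Tendsto f atBot (𝓝 l)) (ht : Tendsto f atTop (𝓝 M)) :
    Set.range f = Set.Ioo l M := by
  ext y
  constructor
  · rintro ⟨x, rfl⟩
    constructor
    · exact (hf.monotone.le_of_tendsto hb (x - 1)).trans_lt (hf (by linarith))
    · exact (hf (by linarith : x < x + 1)).trans_le (hf.monotone.ge_of_tendsto ht (x + 1))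
  · rintro ⟨h1, h2⟩
    obtain ⟨a, ha⟩ := (hb.eventually_lt_const h1).exists
    obtain ⟨b, hb⟩ := (ht.eventually_const_lt h2).exists
    exact mem_range_of_exists_le_of_exists_ge hc ⟨a, ha.le⟩ ⟨b, hb.le⟩

open Filter Topology in
/-- The monotone transport between two positive continuous densities of equal mass. -/
theorem exists_monotone_transport {F G : ℝ → ℝ} (hF : Continuous F) (hG : Continuous G)
    (hF0 : ∀ x, 0 < F x) (hG0 : ∀ x, 0 < G x) (hFi : Integrable F) (hGi : Integrable G)
    (h : ∫ x, F x = ∫ x, G x) :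
    ∃ t : ℝ → ℝ, StrictMono t ∧ Function.Surjective t ∧
      ∀ x, HasDerivAt t (F x / G (t x)) x := by
  have key : ∀ K : ℝ → ℝ, Continuous K → (∀ x, 0 < K x) → Integrable K →
      ∃ Φ : ℝ → ℝ, (∀ x, HasDerivAt Φ (K x) x) ∧ StrictMono Φ ∧ Continuous Φ ∧
        Set.range Φ = Set.Ioo 0 (∫ x, K x) := by
    intro K hK hK0 hKi
    have hd : ∀ x, HasDerivAt (fun x => (∫ y in Set.Iic 0, K y) + ∫ y in (0 : ℝ)..x, K y)
        (K x) x := fun x => by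
      have := intervalIntegral.integral_hasDerivAt_right (hK.intervalIntegrable 0 x)
        hK.aestronglyMeasurable.stronglyMeasurableAtFilter hK.continuousAt
      simpa using this.const_add (∫ y in Set.Iic 0, K y)
    have hm : StrictMono (fun x => (∫ y in Set.Iic 0, K y) + ∫ y in (0 : ℝ)..x, K y) :=
      strictMono_of_hasDerivAt_pos hd hK0
    have hc : Continuous (fun x => (∫ y in Set.Iic 0, K y) + ∫ y in (0 : ℝ)..x, K y) :=
      continuous_iff_continuousAt.2 fun x => (hd x).continuousAt
    refine ⟨_, hd, hm, hc, hm.range_eq_Ioo_of_tendsto hc ?_ ?_⟩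
    · have := (intervalIntegral_tendsto_integral_Iic 0 hKi.integrableOn tendsto_id).neg.const_add
        (∫ y in Set.Iic 0, K y)
      simpa [intervalIntegral.integral_symm (0 : ℝ)] using this
    · have := (intervalIntegral_tendsto_integral_Ioi 0 hKi.integrableOn tendsto_id).const_add
        (∫ y in Set.Iic 0, K y)
      rwa [intervalIntegral.integral_Iic_add_Ioi hKi.integrableOn hKi.integrableOn] at this
  obtain ⟨f, hfd, hfm, hfc, hfr⟩ := key F hF hF0 hFi
  obtain ⟨g, hgd, hgm, hgc, hgr⟩ := key G hG hG0 hGi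
  have hrange : Set.range f = Set.range g := by rw [hfr, hgr, h]
  have hex : ∀ x, ∃ y, g y = f x := fun x => by
    have : f x ∈ Set.range g := hrange ▸ Set.mem_range_self x
    exact this
  choose t ht using hex
  have hmono : StrictMono t := fun x y hxy => hgm.lt_iff_lt.1 (by rw [ht, ht]; exact hfm hxy)
  have hsurj : Function.Surjective t := fun y => by
    have : g y ∈ Set.range f := hrange ▸ Set.mem_range_self y
    obtain ⟨x, hx⟩ := this
    exact ⟨x, hgm.injective (by rw [ht, hx])⟩
  have hcont : Continuous t := hmono.monotone.continuous_of_surjective hsurj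
  refine ⟨t, hmono, hsurj, fun x => ?_⟩
  have hinv : ∃ s : ℝ → ℝ, Function.LeftInverse s g := hgm.injective.hasLeftInverse
  obtain ⟨s, hs⟩ := hinv
  have hev : ∀ᶠ y in 𝓝 (f x), g (s y) = y := by
    have hmem : Set.range g ∈ 𝓝 (f x) := by
      have : IsOpen (Set.range g) := hgr ▸ isOpen_Ioo
      exact this.mem_nhds (hrange ▸ Set.mem_range_self x)
    filter_upwards [hmem] with y hy
    obtain ⟨z, rfl⟩ := hy
    rw [hs]
  have hsc : ContinuousAt s (f x) := by
    have hopen : IsOpen (Set.range g) := hgr ▸ isOpen_Ioo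
    refine StrictMonoOn.continuousAt_of_image_mem_nhds (s := Set.range g) ?_
      (hopen.mem_nhds (hrange ▸ Set.mem_range_self x)) ?_
    · rintro _ ⟨y, rfl⟩ _ ⟨z, rfl⟩ hyz
      rw [hs, hs]
      exact hgm.lt_iff_lt.1 hyz
    · rw [← Set.range_comp, hs.comp_eq_id, Set.range_id]
      exact univ_mem
  have h1 : HasDerivAt s (G (t x))⁻¹ (f x) := by
    refine HasDerivAt.of_local_left_inverse hsc ?_ (hG0 _).ne' hev
    have : s (f x) = t x := by rw [← ht, hs]
    rw [this]
    exact hgd _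
  have h2 := h1.comp x (hfd x)
  have h3 : s ∘ f = t := by
    ext y
    simp only [Function.comp_apply]
    rw [← ht, hs]
  rw [h3] at h2
  rwa [← div_eq_inv_mul] at h2

theorem integrable_deriv_mul_comp_iff {t t' : ℝ → ℝ} (ht : StrictMono t)
    (hs : Function.Surjective t) (hd : ∀ x, HasDerivAt t (t' x) x) (h0 : ∀ x, 0 ≤ t' x)
    (k : ℝ → ℝ) : Integrable (fun x => t' x * k (t x)) ↔ Integrable k := by
  have := integrableOn_image_iff_integrableOn_abs_deriv_smul (s := Set.univ) MeasurableSet.univ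
    (fun x _ => (hd x).hasDerivWithinAt) ht.injective.injOn k
  rw [Set.image_univ, hs.range_eq, integrableOn_univ, integrableOn_univ] at this
  rw [this]
  simp [abs_of_nonneg (h0 _)]

theorem integral_deriv_mul_comp {t t' : ℝ → ℝ} (ht : StrictMono t)
    (hs : Function.Surjective t) (hd : ∀ x, HasDerivAt t (t' x) x) (h0 : ∀ x, 0 ≤ t' x)
    (k : ℝ → ℝ) : ∫ x, t' x * k (t x) = ∫ x, k x := by
  have := integral_image_eq_integral_abs_deriv_smul (s := Set.univ) MeasurableSet.univ
    (fun x _ => (hd x).hasDerivWithinAt) ht.injective.injOn k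
  rw [Set.image_univ, hs.range_eq, setIntegral_univ, setIntegral_univ] at this
  rw [this]
  simp [abs_of_nonneg (h0 _)]

open Filter Topology in
/-- Integration by parts against a monotone function, as an inequality that needs no decay of the
boundary terms. -/
theorem integral_deriv_mul_le_of_monotone {t t' K K' b : ℝ → ℝ} (ht : Monotone t)
    (hd : ∀ x, HasDerivAt t (t' x) x) (ht'c : Continuous t')
    (hK0 : ∀ x, 0 ≤ K x) (hKd : ∀ x, HasDerivAt K (K' x) x) (hKi : Integrable K)
    (hK'i : Integrable K') (hb : ∀ x, |t x * K' x| ≤ b x) (hbi : Integrable b) :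
    Integrable (fun x => t' x * K x) ∧ ∫ x, t' x * K x ≤ ∫ x, b x := by
  have h0 : ∀ x, 0 ≤ t' x := fun x => by
    have := (hd x).deriv ▸ ht.deriv_nonneg (x := x)
    exact this
  have hKc : Continuous K := continuous_iff_continuousAt.2 fun x => (hKd x).continuousAt
  have hcont : Continuous (fun x => t' x * K x) := ht'c.mul hKc
  have hb0 : ∀ x, 0 ≤ b x := fun x => (abs_nonneg _).trans (hb x)
  have hbound : ∀ (s : Set ℝ) (c : ℝ), MeasurableSet s → (∀ x ∈ s, |c * K' x| ≤ |t x * K' x|) →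
      |∫ x in s, c * K' x| ≤ ∫ x in s, b x := fun s c hs h =>
    (norm_integral_le_of_norm_le (f := fun x => c * K' x) (g := b) hbi.integrableOn
      ((ae_restrict_iff' hs).2 (Eventually.of_forall fun x hx => (h x hx).trans (hb x))))
  have hR : ∀ R : ℝ, t R * K R ≤ ∫ x in Set.Ioi R, b x := by
    intro R
    rcases le_total (t R) 0 with h | h
    · exact (mul_nonpos_of_nonpos_of_nonneg h (hK0 R)).trans (integral_nonneg hb0)
    · have h1 := integral_Ioi_of_hasDerivAt_of_tendsto' (a := R) (fun x _ => hKd x)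
        hK'i.integrableOn
        (tendsto_zero_of_hasDerivAt_of_integrableOn_Ioi (a := R) (fun x _ => hKd x)
          hK'i.integrableOn hKi.integrableOn)
      have h2 := hbound (Set.Ioi R) (t R) measurableSet_Ioi fun x hx => by
        rw [abs_mul, abs_mul]
        refine mul_le_mul_of_nonneg_right ?_ (abs_nonneg _)
        rw [abs_of_nonneg h]
        exact (ht (le_of_lt hx)).trans (le_abs_self _)
      rw [integral_const_mul, h1] at h2
      have := neg_le_of_abs_le h2
      linarith
  have hL : ∀ R : ℝ, -(t R * K R) ≤ ∫ x in Set.Iic R, b x := by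
    intro R
    rcases le_total 0 (t R) with h | h
    · exact (neg_nonpos.2 (mul_nonneg h (hK0 R))).trans (integral_nonneg hb0)
    · have h1 := integral_Iic_of_hasDerivAt_of_tendsto' (a := R) (fun x _ => hKd x)
        hK'i.integrableOn
        (tendsto_zero_of_hasDerivAt_of_integrableOn_Iic (a := R) (fun x _ => hKd x)
          hK'i.integrableOn hKi.integrableOn)
      have h2 := hbound (Set.Iic R) (t R) measurableSet_Iic fun x hx => by
        rw [abs_mul, abs_mul]
        refine mul_le_mul_of_nonneg_right ?_ (abs_nonneg _)
        rw [abs_of_nonpos h, abs_of_nonpos ((ht hx).trans h)]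
        exact neg_le_neg (ht hx)
      rw [integral_const_mul, h1] at h2
      have := neg_le_of_abs_le h2
      linarith
  have hI : ∀ R : ℝ, 0 ≤ R → ∫ x in (-R)..R, t' x * K x ≤ ∫ x, b x := by
    intro R hR0
    have h1 := intervalIntegral.integral_deriv_mul_eq_sub (a := -R) (b := R)
      (fun x _ => hd x) (fun x _ => hKd x) (ht'c.intervalIntegrable _ _)
      hK'i.intervalIntegrable
    have htc : Continuous t := continuous_iff_continuousAt.2 fun x => (hd x).continuousAt
    have hi2 : IntervalIntegrable (fun x => t x * K' x) volume (-R) R :=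
      hK'i.intervalIntegrable.continuousOn_mul htc.continuousOn
    rw [intervalIntegral.integral_add (hcont.intervalIntegrable _ _) hi2] at h1
    have h2 : -(∫ x in (-R)..R, b x) ≤ ∫ x in (-R)..R, t x * K' x := by
      rw [← intervalIntegral.integral_neg]
      exact intervalIntegral.integral_mono_on (by linarith) hbi.neg.intervalIntegrable hi2
        fun x _ => neg_le_of_abs_le (hb x)
    have h3 := hR R
    have h4 := hL (-R)
    have h5 : (∫ x in Set.Iic (-R), b x) + (∫ x in (-R)..R, b x) + ∫ x in Set.Ioi R, b x
        = ∫ x, b x := by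
      rw [← intervalIntegral.integral_Iic_add_Ioi (b := R) hbi.integrableOn hbi.integrableOn,
        ← intervalIntegral.integral_Iic_sub_Iic hbi.integrableOn hbi.integrableOn]
      ring
    linarith
  have h_integrable : Integrable (fun x => t' x * K x) := by
    refine integrable_of_intervalIntegral_norm_bounded (l := atTop) (a := fun R : ℝ => -R)
      (b := fun R => R) (∫ x, b x) (fun R => ?_) tendsto_neg_atTop_atBot tendsto_id ?_
    · exact (hcont.integrableOn_Icc).mono_set Set.Ioc_subset_Icc_self
    · filter_upwards [eventually_ge_atTop 0] with R hR0
      simpa [abs_of_nonneg (h0 _), abs_of_nonneg (hK0 _)] using hI R hR0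
  refine ⟨h_integrable, le_of_tendsto (intervalIntegral_tendsto_integral (l := atTop) h_integrable
    tendsto_neg_atTop_atBot tendsto_id) ?_⟩
  filter_upwards [eventually_ge_atTop 0] with R hR0 using hI R hR0

theorem integrable_vecCons {m : ℕ} {h : (Fin (m + 1) → ℝ) → ℝ} (hh : Integrable h) :
    Integrable fun s : ℝ => ∫ y : Fin m → ℝ, h (Matrix.vecCons s y) := by
  have e := (volume_preserving_piFinSuccAbove (fun _ : Fin (m + 1) => ℝ) 0).symm
  have h1 := (e.integrable_comp_emb (MeasurableEquiv.measurableEmbedding _)).2 hh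
  have h2 := h1.integral_prod_left
  simpa [MeasurableEquiv.piFinSuccAbove, Function.comp_def, Fin.insertNthEquiv,
    Matrix.vecCons] using h2

theorem integral_vecCons {m : ℕ} {h : (Fin (m + 1) → ℝ) → ℝ} (hh : Integrable h) :
    ∫ s : ℝ, ∫ y : Fin m → ℝ, h (Matrix.vecCons s y) = ∫ x, h x := by
  have e := (volume_preserving_piFinSuccAbove (fun _ : Fin (m + 1) => ℝ) 0).symm
  have h1 := (e.integrable_comp_emb (MeasurableEquiv.measurableEmbedding _)).2 hh
  have h2 := integral_prod _ h1
  rw [← e.integral_comp (MeasurableEquiv.measurableEmbedding _)]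
  refine Eq.trans ?_ h2.symm
  simp [MeasurableEquiv.piFinSuccAbove, Fin.insertNthEquiv, Matrix.vecCons]

/-- The quadratic weight `1 + |x|²`. -/
def quadWeight {m : ℕ} (x : Fin m → ℝ) : ℝ := 1 + ∑ i, x i ^ 2

theorem one_le_quadWeight {m : ℕ} (x : Fin m → ℝ) : 1 ≤ quadWeight x := by
  have : 0 ≤ ∑ i, x i ^ 2 := Finset.sum_nonneg fun i _ => sq_nonneg _
  unfold quadWeight; linarith

theorem quadWeight_pos {m : ℕ} (x : Fin m → ℝ) : 0 < quadWeight x :=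
  zero_lt_one.trans_le (one_le_quadWeight x)

theorem continuous_quadWeight {m : ℕ} : Continuous (quadWeight (m := m)) := by
  unfold quadWeight; fun_prop

theorem sq_le_quadWeight {m : ℕ} (x : Fin m → ℝ) (i : Fin m) : x i ^ 2 ≤ quadWeight x := by
  have := Finset.single_le_sum (f := fun i => x i ^ 2) (fun i _ => sq_nonneg _)
    (Finset.mem_univ i)
  unfold quadWeight; linarith

theorem quadWeight_vecCons {m : ℕ} (s : ℝ) (y : Fin m → ℝ) :
    quadWeight (Matrix.vecCons s y) = s ^ 2 + quadWeight y := by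
  simp only [quadWeight, Fin.sum_univ_succ, Matrix.cons_val_zero, Matrix.cons_val_succ]; ring

theorem integrable_inv_quadWeight_pow {m p : ℕ} (h : m < 2 * p) :
    Integrable fun x : Fin m → ℝ => (quadWeight x ^ p)⁻¹ := by
  have h1 : Integrable fun x : Fin m → ℝ => (1 + ‖x‖ ^ 2) ^ (-((2 * p : ℕ) : ℝ) / 2) :=
    integrable_rpow_neg_one_add_norm_sq (by simpa using mod_cast h)
  refine h1.mono' ?_ (Filter.Eventually.of_forall fun x => ?_)
  · exact (Continuous.inv₀ (continuous_quadWeight.pow p)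
      fun x => (pow_pos (quadWeight_pos x) p).ne').aestronglyMeasurable
  · have hx : ‖x‖ ^ 2 ≤ ∑ i, x i ^ 2 := by
      rcases isEmpty_or_nonempty (Fin m) with h | h
      · simp [Subsingleton.elim x 0]
      · obtain ⟨i, hi⟩ := Finite.exists_max fun i => ‖x i‖
        have : ‖x‖ ≤ ‖x i‖ := (pi_norm_le_iff_of_nonneg (norm_nonneg _)).2 hi
        calc ‖x‖ ^ 2 ≤ ‖x i‖ ^ 2 := by gcongr
          _ = x i ^ 2 := by simp
          _ ≤ _ := Finset.single_le_sum (f := fun i => x i ^ 2) (fun i _ => sq_nonneg _)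
              (Finset.mem_univ i)
    have e : (-((2 * p : ℕ) : ℝ) / 2) = -(p : ℝ) := by push_cast; ring
    rw [e, rpow_neg (by positivity), rpow_natCast, norm_inv, norm_pow,
      Real.norm_of_nonneg (quadWeight_pos x).le]
    unfold quadWeight
    gcongr

/-- Functions on `ℝ^m` that grow at least quadratically, with partial derivatives `D i` that grow
at most linearly. -/
structure QuadGrowth {m : ℕ} (g : (Fin m → ℝ) → ℝ) (D : Fin m → (Fin m → ℝ) → ℝ)
    (c₁ c₃ : ℝ) : Prop where
  continuous : Continuous g
  continuous_deriv : ∀ i, Continuous (D i)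
  hasDerivAt : ∀ i x t,
    HasDerivAt (fun s => g (Function.update x i s)) (D i (Function.update x i t)) t
  pos : 0 < c₁
  lower : ∀ x, c₁ * quadWeight x ≤ g x
  growth : ∀ i x, D i x ^ 2 ≤ c₃ * quadWeight x

namespace QuadGrowth

variable {m : ℕ}

theorem fun_pos {g : (Fin m → ℝ) → ℝ} {D : Fin m → (Fin m → ℝ) → ℝ} {c₁ c₃ : ℝ}
    (h : QuadGrowth g D c₁ c₃) (x : Fin m → ℝ) : 0 < g x :=
  (mul_pos h.pos (quadWeight_pos x)).trans_le (h.lower x)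

/-- Slices of a function of quadratic growth. -/
theorem slice {g : (Fin (m + 1) → ℝ) → ℝ} {D : Fin (m + 1) → (Fin (m + 1) → ℝ) → ℝ}
    {c₁ c₃ : ℝ} (h : QuadGrowth g D c₁ c₃) (s : ℝ) :
    QuadGrowth (fun y => g (Matrix.vecCons s y)) (fun i y => D i.succ (Matrix.vecCons s y))
      c₁ (c₃ * (1 + s ^ 2)) where
  continuous := h.continuous.comp (by fun_prop)
  continuous_deriv i := (h.continuous_deriv _).comp (by fun_prop)
  hasDerivAt i x t := by
    have := h.hasDerivAt i.succ (Matrix.vecCons s x) t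
    simpa only [Matrix.vecCons, ← Fin.cons_update] using this
  pos := h.pos
  lower y := by
    refine le_trans ?_ (h.lower _)
    rw [quadWeight_vecCons]
    have := h.pos
    gcongr
    nlinarith [sq_nonneg s]
  growth i y := by
    refine (h.growth _ _).trans ?_
    rw [quadWeight_vecCons, mul_assoc]
    have hc : 0 ≤ c₃ := by
      have h1 := (sq_nonneg _).trans (h.growth 0 0)
      exact nonneg_of_mul_nonneg_left h1 (quadWeight_pos _)
    gcongr
    nlinarith [sq_nonneg s, one_le_quadWeight y]

/-- Everything that grows at most quadratically is integrable against `g⁻ᴺ`. -/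
theorem integrable_div {g : (Fin m → ℝ) → ℝ} {D : Fin m → (Fin m → ℝ) → ℝ} {c₁ c₃ : ℝ}
    (h : QuadGrowth g D c₁ c₃) {N : ℕ} (hN : 3 ≤ N) (hm : m ≤ N) {k : (Fin m → ℝ) → ℝ}
    (hk : Continuous k) {C : ℝ} (hkC : ∀ x, |k x| ≤ C * quadWeight x) :
    Integrable fun x => k x / g x ^ N := by
  have h1 : Integrable fun x : Fin m → ℝ => (quadWeight x ^ (N - 1))⁻¹ :=
    integrable_inv_quadWeight_pow (by omega)
  refine (h1.const_mul (C / c₁ ^ N)).mono' ?_ (Filter.Eventually.of_forall fun x => ?_)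
  · exact (hk.div (h.continuous.pow N) fun x => (pow_pos (h.fun_pos x) N).ne').aestronglyMeasurable
  · have hc := h.pos
    have hw := quadWeight_pos x
    rw [norm_div, norm_pow, Real.norm_of_nonneg (h.fun_pos x).le, Real.norm_eq_abs]
    calc |k x| / g x ^ N ≤ (C * quadWeight x) / (c₁ * quadWeight x) ^ N :=
          div_le_div₀ ((abs_nonneg _).trans (hkC x)) (hkC x) (by positivity)
            (pow_le_pow_left₀ (by positivity) (h.lower x) N)
      _ = C / c₁ ^ N * (quadWeight x ^ (N - 1))⁻¹ := by
          obtain ⟨M, rfl⟩ : ∃ M, N = M + 1 := ⟨N - 1, by omega⟩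
          rw [mul_pow, pow_succ (quadWeight x) M, Nat.add_sub_cancel]
          field_simp

theorem integrable_inv_pow {g : (Fin m → ℝ) → ℝ} {D : Fin m → (Fin m → ℝ) → ℝ} {c₁ c₃ : ℝ}
    (h : QuadGrowth g D c₁ c₃) {N : ℕ} (hN : 3 ≤ N) (hm : m ≤ N) :
    Integrable fun x => 1 / g x ^ N :=
  h.integrable_div hN hm (k := fun _ => 1) (C := 1) continuous_const fun x => by
    simpa using one_le_quadWeight x

theorem integrable_inv_pow_pred {g : (Fin m → ℝ) → ℝ} {D : Fin m → (Fin m → ℝ) → ℝ} {c₁ c₃ : ℝ}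
    (h : QuadGrowth g D c₁ c₃) {N : ℕ} (hN : 3 ≤ N) (hm : m ≤ N) :
    Integrable fun x => 1 / g x ^ (N - 1) := by
  have h1 : Integrable fun x : Fin m → ℝ => (quadWeight x ^ (N - 1))⁻¹ :=
    integrable_inv_quadWeight_pow (by omega)
  refine (h1.const_mul (1 / c₁ ^ (N - 1))).mono' ?_ (Filter.Eventually.of_forall fun x => ?_)
  · exact (continuous_const.div (h.continuous.pow _)
      fun x => (pow_pos (h.fun_pos x) _).ne').aestronglyMeasurable
  · have hc := h.pos
    have hw := quadWeight_pos x
    rw [norm_div, norm_pow, Real.norm_of_nonneg (h.fun_pos x).le, norm_one]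
    calc 1 / g x ^ (N - 1) ≤ 1 / (c₁ * quadWeight x) ^ (N - 1) :=
          div_le_div₀ zero_le_one le_rfl (by positivity)
            (pow_le_pow_left₀ (by positivity) (h.lower x) _)
      _ = _ := by rw [mul_pow]; field_simp

theorem integrable_sq_div {g : (Fin m → ℝ) → ℝ} {D : Fin m → (Fin m → ℝ) → ℝ} {c₁ c₃ : ℝ}
    (h : QuadGrowth g D c₁ c₃) {N : ℕ} (hN : 3 ≤ N) (hm : m ≤ N) (i : Fin m) :
    Integrable fun x => D i x ^ 2 / g x ^ N :=
  h.integrable_div hN hm ((h.continuous_deriv i).pow 2) (C := c₃) fun x => by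
    rw [abs_of_nonneg (sq_nonneg _)]; exact h.growth i x

theorem integrable_coord_sq_div {g : (Fin m → ℝ) → ℝ} {D : Fin m → (Fin m → ℝ) → ℝ} {c₁ c₃ : ℝ}
    (h : QuadGrowth g D c₁ c₃) {N : ℕ} (hN : 3 ≤ N) (hm : m ≤ N) (i : Fin m) :
    Integrable fun x => x i ^ 2 / g x ^ N :=
  h.integrable_div hN hm (k := fun x => x i ^ 2) (by fun_prop) (C := 1) fun x => by
    rw [abs_of_nonneg (sq_nonneg _), one_mul]; exact sq_le_quadWeight x i

/-- The extremal profile `c (B + |x|²)`. -/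
theorem profile {c B : ℝ} (hc : 0 < c) (hB : 0 < B) :
    QuadGrowth (fun y : Fin m → ℝ => c * (B + ∑ i, y i ^ 2)) (fun i y => 2 * c * y i)
      (c * min 1 B) (4 * c ^ 2) where
  continuous := by fun_prop
  continuous_deriv i := by fun_prop
  hasDerivAt i x t := by
    have h : ∀ s, c * (B + ∑ j, Function.update x i s j ^ 2)
        = c * (B + ∑ j ∈ Finset.univ.erase i, x j ^ 2) + c * s ^ 2 := fun s => by
      rw [← Finset.add_sum_erase _ _ (Finset.mem_univ i), Function.update_self]
      rw [Finset.sum_congr rfl fun j hj => by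
        rw [Function.update_of_ne (Finset.ne_of_mem_erase hj)]]
      ring
    simp only [h, Function.update_self]
    have := ((hasDerivAt_pow 2 t).const_mul c).const_add
      (c * (B + ∑ j ∈ Finset.univ.erase i, x j ^ 2))
    refine this.congr_deriv ?_
    push_cast
    rw [pow_one]
    ring
  pos := mul_pos hc (lt_min one_pos hB)
  lower x := by
    have : 0 ≤ ∑ i, x i ^ 2 := Finset.sum_nonneg fun i _ => sq_nonneg _
    rw [mul_assoc]
    refine mul_le_mul_of_nonneg_left ?_ hc.le
    unfold quadWeight
    rw [mul_add, mul_one]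
    exact add_le_add (min_le_right _ _) (mul_le_of_le_one_left this (min_le_left _ _))
  growth i x := by
    have := sq_le_quadWeight x i
    nlinarith [sq_nonneg c]

end QuadGrowth

namespace QuadGrowth

variable {m : ℕ}

theorem abs_deriv_le {g : (Fin m → ℝ) → ℝ} {D : Fin m → (Fin m → ℝ) → ℝ} {c₁ c₃ : ℝ}
    (h : QuadGrowth g D c₁ c₃) (i : Fin m) (x : Fin m → ℝ) :
    |D i x| ≤ (c₃ + 1) * quadWeight x := by
  have h1 := h.growth i x
  have hw := one_le_quadWeight x
  have hc : 0 ≤ c₃ := nonneg_of_mul_nonneg_left ((sq_nonneg _).trans h1) (quadWeight_pos x)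
  refine abs_le_of_sq_le_sq ?_ (by positivity)
  have : c₃ * quadWeight x ≤ ((c₃ + 1) * quadWeight x) * ((c₃ + 1) * quadWeight x) := by
    have h2 : c₃ ≤ c₃ + 1 := by linarith
    have h3 : 1 ≤ (c₃ + 1) * quadWeight x := by nlinarith
    nlinarith [mul_le_mul_of_nonneg_right h2 (quadWeight_pos x).le]
  nlinarith

theorem integral_inv_pow_pos {g : (Fin m → ℝ) → ℝ} {D : Fin m → (Fin m → ℝ) → ℝ} {c₁ c₃ : ℝ}
    (h : QuadGrowth g D c₁ c₃) {N : ℕ} (hN : 3 ≤ N) (hm : m ≤ N) : 0 < ∫ x, 1 / g x ^ N := by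
  have hp : ∀ x, 0 < 1 / g x ^ N := fun x => one_div_pos.2 (pow_pos (h.fun_pos x) N)
  rw [integral_pos_iff_support_of_nonneg (fun x => (hp x).le) (h.integrable_inv_pow hN hm)]
  have : (Function.support fun x => 1 / g x ^ N) = Set.univ := by
    ext x; simpa using fun hx => absurd hx (h.fun_pos x).ne'
  rw [this]
  exact NeZero.pos _

theorem one_div_pow_slice_le {g : (Fin (m + 1) → ℝ) → ℝ}
    {D : Fin (m + 1) → (Fin (m + 1) → ℝ) → ℝ} {c₁ c₃ : ℝ} (h : QuadGrowth g D c₁ c₃) (p : ℕ)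
    (s : ℝ) (y : Fin m → ℝ) :
    1 / g (Matrix.vecCons s y) ^ p ≤ 1 / c₁ ^ p * (quadWeight y ^ p)⁻¹ := by
  have hc := h.pos
  have hw := quadWeight_pos y
  calc 1 / g (Matrix.vecCons s y) ^ p ≤ 1 / (c₁ * quadWeight y) ^ p := by
        refine div_le_div₀ zero_le_one le_rfl (by positivity)
          (pow_le_pow_left₀ (by positivity) (le_trans ?_ (h.lower _)) _)
        rw [quadWeight_vecCons]
        gcongr
        linarith [sq_nonneg s]
    _ = _ := by rw [mul_pow]; field_simp

/-- Marginals are continuous. -/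
theorem continuous_marginal {g : (Fin (m + 1) → ℝ) → ℝ}
    {D : Fin (m + 1) → (Fin (m + 1) → ℝ) → ℝ} {c₁ c₃ : ℝ} (h : QuadGrowth g D c₁ c₃)
    {N : ℕ} (hN : 3 ≤ N) (hm : m + 1 ≤ N) :
    Continuous fun s : ℝ => ∫ y : Fin m → ℝ, 1 / g (Matrix.vecCons s y) ^ N := by
  refine continuous_of_dominated (bound := fun y => 1 / c₁ ^ N * (quadWeight y ^ N)⁻¹)
    (fun s => ((h.slice s).integrable_inv_pow hN (by omega)).aestronglyMeasurable)
    (fun s => Filter.Eventually.of_forall fun y => ?_)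
    ((integrable_inv_quadWeight_pow (by omega)).const_mul _)
    (Filter.Eventually.of_forall fun y => ?_)
  · rw [Real.norm_of_nonneg (one_div_pos.2 (pow_pos (h.fun_pos _) N)).le]
    exact h.one_div_pow_slice_le N s y
  · exact continuous_const.div ((h.continuous.comp (by fun_prop)).pow N)
      fun s => (pow_pos (h.fun_pos _) N).ne'

theorem hasDerivAt_marginal {g : (Fin (m + 1) → ℝ) → ℝ}
    {D : Fin (m + 1) → (Fin (m + 1) → ℝ) → ℝ} {c₁ c₃ : ℝ} (h : QuadGrowth g D c₁ c₃)
    {N : ℕ} (hN : 3 ≤ N) (hm : m + 1 ≤ N) (s : ℝ) :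
    HasDerivAt (fun s : ℝ => ∫ y : Fin m → ℝ, 1 / g (Matrix.vecCons s y) ^ (N - 1))
      (∫ y : Fin m → ℝ, -((N : ℝ) - 1) * (D 0 (Matrix.vecCons s y) / g (Matrix.vecCons s y) ^ N))
      s := by
  have hd : ∀ (y : Fin m → ℝ) (s : ℝ),
      HasDerivAt (fun s => 1 / g (Matrix.vecCons s y) ^ (N - 1))
        (-((N : ℝ) - 1) * (D 0 (Matrix.vecCons s y) / g (Matrix.vecCons s y) ^ N)) s := by
    intro y s
    have h1 := h.hasDerivAt 0 (Matrix.vecCons s y) s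
    simp only [Matrix.vecCons, Fin.update_cons_zero] at h1
    have hg := h.fun_pos (Matrix.vecCons s y)
    have h2 := (h1.fun_pow (N - 1)).fun_inv (pow_pos hg (N - 1)).ne'
    simp only [one_div]
    refine h2.congr_deriv ?_
    obtain ⟨M, rfl⟩ : ∃ M, N = M + 2 := ⟨N - 2, by omega⟩
    simp only [Matrix.vecCons] at hg ⊢
    simp only [show M + 2 - 1 = M + 1 by omega, show M + 1 - 1 = M by omega]
    field_simp
    push_cast
    ring
  have hc := h.pos
  refine (hasDerivAt_integral_of_dominated_loc_of_deriv_le (s := Set.univ)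
    (bound := fun y => ((N : ℝ) - 1) * ((c₃ + 1) / c₁ ^ N) * (quadWeight y ^ (N - 1))⁻¹)
    Filter.univ_mem (Filter.Eventually.of_forall fun s =>
      ((h.slice s).integrable_inv_pow_pred hN (by omega)).aestronglyMeasurable)
    ((h.slice s).integrable_inv_pow_pred hN (by omega)) ?_
    (Filter.Eventually.of_forall fun y s _ => ?_)
    ((integrable_inv_quadWeight_pow (by omega)).const_mul _)
    (Filter.Eventually.of_forall fun y s _ => hd y s)).2
  · exact (continuous_const.mul (((h.continuous_deriv 0).comp (by fun_prop)).div
      ((h.continuous.comp (by fun_prop)).pow N)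
      fun s => (pow_pos (h.fun_pos _) N).ne')).aestronglyMeasurable
  · have hN1 : (0 : ℝ) ≤ (N : ℝ) - 1 := by
      have : (3 : ℝ) ≤ N := by exact_mod_cast hN
      linarith
    have hg := h.fun_pos (Matrix.vecCons s y)
    have hw := quadWeight_pos y
    rw [norm_mul, norm_neg, Real.norm_of_nonneg hN1, norm_div, norm_pow,
      Real.norm_of_nonneg hg.le, Real.norm_eq_abs, mul_assoc]
    refine mul_le_mul_of_nonneg_left ?_ hN1
    have hA := h.abs_deriv_le 0 (Matrix.vecCons s y)
    have hw' := quadWeight_pos (Matrix.vecCons s y)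
    have hww : quadWeight y ≤ quadWeight (Matrix.vecCons s y) := by
      rw [quadWeight_vecCons]; linarith [sq_nonneg s]
    calc |D 0 (Matrix.vecCons s y)| / g (Matrix.vecCons s y) ^ N
        ≤ ((c₃ + 1) * quadWeight (Matrix.vecCons s y)) /
            (c₁ * quadWeight (Matrix.vecCons s y)) ^ N :=
          div_le_div₀ ((abs_nonneg _).trans hA) hA (by positivity)
            (pow_le_pow_left₀ (by positivity) (h.lower _) N)
      _ = (c₃ + 1) / c₁ ^ N * (quadWeight (Matrix.vecCons s y) ^ (N - 1))⁻¹ := by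
          obtain ⟨M, rfl⟩ : ∃ M, N = M + 1 := ⟨N - 1, by omega⟩
          rw [mul_pow, pow_succ (quadWeight (Matrix.vecCons s y)) M, Nat.add_sub_cancel]
          field_simp
      _ ≤ _ := by
          have hc3 : 0 ≤ c₃ + 1 :=
            nonneg_of_mul_nonneg_left ((abs_nonneg _).trans hA) hw'
          gcongr

end QuadGrowth

/-- The extremal inequality for densities of equal mass implies the one for densities whose masses
differ by a factor `T`, with a share of the arithmetic-geometric mean inequality spent on `T`. -/
theorem transport_inequality_rescale {N m : ℕ} (hm : m + 1 ≤ N) {l : ℝ}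
    (g : (Fin m → ℝ) → ℝ) (A : Fin m → ℝ)
    (ih : ∀ c B δ : ℝ, 0 < c → 0 < B → 0 < δ →
      (∫ x, 1 / g x ^ N = ∫ x : Fin m → ℝ, 1 / (c * (B + ∑ i, x i ^ 2)) ^ N) →
      δ ^ (((N : ℝ) - m) / N) * ∫ x : Fin m → ℝ, 1 / (c * (B + ∑ i, x i ^ 2)) ^ (N - 1) ≤
        1 / N * (((N : ℝ) - m) * δ * (∫ x, 1 / g x ^ (N - 1)) +
          ∑ i, (A i + l / 2 * ∫ x : Fin m → ℝ, x i ^ 2 / (c * (B + ∑ i, x i ^ 2)) ^ N)))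
    {c B δ T : ℝ} (hc : 0 < c) (hB : 0 < B) (hδ : 0 < δ) (hT : 0 < T)
    (hK : 0 ≤ ∫ x, 1 / g x ^ (N - 1))
    (hmass : ∫ x, 1 / g x ^ N = T * ∫ x : Fin m → ℝ, 1 / (c * (B + ∑ i, x i ^ 2)) ^ N) :
    δ ^ (((N : ℝ) - (m + 1)) / N) *
        (T * ∫ x : Fin m → ℝ, 1 / (c * (B + ∑ i, x i ^ 2)) ^ (N - 1)) ≤
      1 / N * (((N : ℝ) - (m + 1)) * δ * (∫ x, 1 / g x ^ (N - 1)) + T * (∫ x, 1 / g x ^ (N - 1)) +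
        ∑ i, (A i + l / 2 * (T * ∫ x : Fin m → ℝ, x i ^ 2 / (c * (B + ∑ i, x i ^ 2)) ^ N))) := by
  have hN0 : (0 : ℝ) < N := by exact_mod_cast (by omega : 0 < N)
  have hmN : (m : ℝ) + 1 ≤ N := by exact_mod_cast hm
  have hNm : (0 : ℝ) < N - m := by linarith
  obtain ⟨θ, hθ⟩ : ∃ θ, θ = T ^ (1 / (N : ℝ)) := ⟨_, rfl⟩
  have hθ0 : 0 < θ := hθ ▸ rpow_pos_of_pos hT _
  have hθN : θ ^ N = T := by
    rw [hθ, ← rpow_natCast, ← rpow_mul hT.le, one_div_mul_cancel hN0.ne', rpow_one]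
  have hscale : ∀ (p : ℕ) (k : (Fin m → ℝ) → ℝ),
      ∫ x : Fin m → ℝ, k x / (c / θ * (B + ∑ i, x i ^ 2)) ^ p
        = θ ^ p * ∫ x : Fin m → ℝ, k x / (c * (B + ∑ i, x i ^ 2)) ^ p := fun p k => by
    rw [← integral_const_mul]
    congr 1 with x
    have : 0 < B + ∑ i, x i ^ 2 :=
      add_pos_of_pos_of_nonneg hB (Finset.sum_nonneg fun i _ => sq_nonneg _)
    rw [show c / θ * (B + ∑ i, x i ^ 2) = c * (B + ∑ i, x i ^ 2) / θ by ring, div_pow,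
      div_div_eq_mul_div]
    ring
  set w₁ : ℝ := ((N : ℝ) - (m + 1)) / (N - m) with hw₁
  set w₂ : ℝ := 1 / ((N : ℝ) - m) with hw₂
  have hw₁0 : 0 ≤ w₁ := div_nonneg (by linarith) hNm.le
  have hw₂0 : 0 ≤ w₂ := (one_div_pos.2 hNm).le
  have hw : w₁ + w₂ = 1 := by rw [hw₁, hw₂]; field_simp; ring
  have hamgm := geom_mean_le_arith_mean2_weighted hw₁0 hw₂0 hδ.le hT.le hw
  have hpow : (δ ^ w₁ * T ^ w₂) ^ (((N : ℝ) - m) / N) = δ ^ (((N : ℝ) - (m + 1)) / N) * θ := by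
    rw [mul_rpow (by positivity) (by positivity), ← rpow_mul hδ.le, ← rpow_mul hT.le, hθ]
    congr 2
    · rw [hw₁]; field_simp
    · rw [hw₂]; field_simp
  have h := ih (c / θ) B (δ ^ w₁ * T ^ w₂) (by positivity) hB (by positivity)
    (by rw [hscale, hθN, hmass])
  rw [hpow, hscale] at h
  simp only [hscale, hθN] at h
  have hθ' : θ * θ ^ (N - 1) = T := by rw [← hθN, ← pow_succ']; congr 1; omega
  calc _ = δ ^ (((N : ℝ) - (m + 1)) / N) * θ *
        (θ ^ (N - 1) * ∫ x : Fin m → ℝ, 1 / (c * (B + ∑ i, x i ^ 2)) ^ (N - 1)) := by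
        rw [← hθ']; ring
    _ ≤ _ := h
    _ ≤ _ := by
        refine mul_le_mul_of_nonneg_left (add_le_add ?_ le_rfl) (by positivity)
        rw [← add_mul]
        refine mul_le_mul_of_nonneg_right ?_ hK
        calc ((N : ℝ) - m) * (δ ^ w₁ * T ^ w₂) ≤ ((N : ℝ) - m) * (w₁ * δ + w₂ * T) := by gcongr
          _ = _ := by rw [hw₁, hw₂]; field_simp

/-- Dimension-by-dimension mass transport (the Knothe map, one coordinate at a time) from `g⁻ᴺ` to
the extremal density. -/
theorem QuadGrowth.transport_inequality {N : ℕ} (hN : 3 ≤ N) {l : ℝ} (hl : 0 < l) :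
    ∀ (m : ℕ), m ≤ N → ∀ (g : (Fin m → ℝ) → ℝ) (D : Fin m → (Fin m → ℝ) → ℝ) (c₁ c₃ c B δ : ℝ),
      QuadGrowth g D c₁ c₃ → 0 < c → 0 < B → 0 < δ →
      (∫ x, 1 / g x ^ N = ∫ x : Fin m → ℝ, 1 / (c * (B + ∑ i, x i ^ 2)) ^ N) →
      δ ^ (((N : ℝ) - m) / N) * ∫ x : Fin m → ℝ, 1 / (c * (B + ∑ i, x i ^ 2)) ^ (N - 1) ≤
        1 / N * (((N : ℝ) - m) * δ * (∫ x, 1 / g x ^ (N - 1)) +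
          ∑ i, (((N : ℝ) - 1) ^ 2 / (2 * l) * (∫ x, D i x ^ 2 / g x ^ N) +
            l / 2 * ∫ x : Fin m → ℝ, x i ^ 2 / (c * (B + ∑ i, x i ^ 2)) ^ N)) := by
  have hN0 : (0 : ℝ) < N := by exact_mod_cast (by omega : 0 < N)
  intro m
  induction m with
  | zero =>
    intro _ g D c₁ c₃ c B δ hg hc hB hδ h
    have e : ∀ f : (Fin 0 → ℝ) → ℝ, ∫ x, f x = f 0 := fun f => by
      rw [show f = fun _ => f 0 from funext fun x => congrArg f (Subsingleton.elim _ _)]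
      simp [volume_pi, Measure.real]
    simp only [e, Finset.univ_eq_empty, Finset.sum_empty, add_zero, CharP.cast_eq_zero,
      sub_zero] at h ⊢
    have h1 : g 0 ^ N = (c * B) ^ N := by
      have := hg.fun_pos 0
      field_simp at h
      exact h.symm
    have h2 : g 0 = c * B := (pow_left_inj₀ (hg.fun_pos 0).le (by positivity) (by omega)).1 h1
    rw [h2, div_self hN0.ne', rpow_one]
    refine le_of_eq ?_
    field_simp
  | succ m ih =>
    intro hm g D c₁ c₃ c B δ hg hc hB hδ hmass
    have hH := QuadGrowth.profile (m := m + 1) hc hB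
    obtain ⟨H, hHdef⟩ : ∃ H : (Fin (m + 1) → ℝ) → ℝ, H = fun x => c * (B + ∑ i, x i ^ 2) :=
      ⟨_, rfl⟩
    have hHx : ∀ x, c * (B + ∑ i, x i ^ 2) = H x := fun x => by rw [hHdef]
    have hHs : ∀ (s : ℝ) (y : Fin m → ℝ),
        c * ((B + s ^ 2) + ∑ i, y i ^ 2) = H (Matrix.vecCons s y) := fun s y => by
      rw [← hHx, Fin.sum_univ_succ]; simp [add_assoc]
    simp only [hHx] at hmass hH ⊢
    obtain ⟨t, htm, hts, htd⟩ := exists_monotone_transport (hg.continuous_marginal hN hm)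
      (hH.continuous_marginal hN hm)
      (fun s => (hg.slice s).integral_inv_pow_pos hN (by omega))
      (fun s => (hH.slice s).integral_inv_pow_pos hN (by omega))
      (integrable_vecCons (hg.integrable_inv_pow hN hm))
      (integrable_vecCons (hH.integrable_inv_pow hN hm))
      (by rw [integral_vecCons (hg.integrable_inv_pow hN hm),
        integral_vecCons (hH.integrable_inv_pow hN hm), hmass])
    obtain ⟨F₀, hF₀⟩ : ∃ F₀ : ℝ → ℝ, F₀ = fun s => ∫ y, 1 / g (Matrix.vecCons s y) ^ N := ⟨_, rfl⟩
    obtain ⟨G₀, hG₀⟩ : ∃ G₀ : ℝ → ℝ, G₀ = fun s => ∫ y, 1 / H (Matrix.vecCons s y) ^ N := ⟨_, rfl⟩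
    obtain ⟨T, hT⟩ : ∃ T : ℝ → ℝ, T = fun x => F₀ x / G₀ (t x) := ⟨_, rfl⟩
    have hF₀pos : ∀ s, 0 < F₀ s := fun s => by
      rw [hF₀]; exact (hg.slice s).integral_inv_pow_pos hN (by omega)
    have hG₀pos : ∀ s, 0 < G₀ s := fun s => by
      rw [hG₀]; exact (hH.slice s).integral_inv_pow_pos hN (by omega)
    have hTpos : ∀ x, 0 < T x := fun x => by rw [hT]; exact div_pos (hF₀pos _) (hG₀pos _)
    have htd' : ∀ x, HasDerivAt t (T x) x := fun x => by rw [hT, hF₀, hG₀]; exact htd x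
    have htc : Continuous t := continuous_iff_continuousAt.2 fun x => (htd x).continuousAt
    have hF₀c : Continuous F₀ := hF₀ ▸ hg.continuous_marginal hN hm
    have hG₀c : Continuous G₀ := hG₀ ▸ hH.continuous_marginal hN hm
    have hTc : Continuous T :=
      hT ▸ hF₀c.div (hG₀c.comp htc) fun x => (hG₀pos _).ne'
    have hTG : ∀ x, T x * G₀ (t x) = F₀ x := fun x => by
      rw [hT]; exact div_mul_cancel₀ _ (hG₀pos _).ne'
    obtain ⟨K, hK⟩ : ∃ K : ℝ → ℝ, K = fun s => ∫ y, 1 / g (Matrix.vecCons s y) ^ (N - 1) :=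
      ⟨_, rfl⟩
    obtain ⟨J, hJ⟩ : ∃ J : ℝ → ℝ, J = fun s => ∫ y, 1 / H (Matrix.vecCons s y) ^ (N - 1) :=
      ⟨_, rfl⟩
    obtain ⟨A, hA⟩ : ∃ A : Fin (m + 1) → ℝ → ℝ, A = fun i s =>
      ∫ y, D i (Matrix.vecCons s y) ^ 2 / g (Matrix.vecCons s y) ^ N := ⟨_, rfl⟩
    obtain ⟨M, hM⟩ : ∃ M : Fin (m + 1) → ℝ → ℝ, M = fun i s =>
      ∫ y : Fin m → ℝ, Matrix.vecCons s y i ^ 2 / H (Matrix.vecCons s y) ^ N := ⟨_, rfl⟩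
    have hKint : Integrable K := hK ▸ integrable_vecCons (hg.integrable_inv_pow_pred hN hm)
    have hJint : Integrable J := hJ ▸ integrable_vecCons (hH.integrable_inv_pow_pred hN hm)
    have hAint : ∀ i, Integrable (A i) := fun i => by
      rw [hA]; exact integrable_vecCons (hg.integrable_sq_div hN hm i)
    have hMint : ∀ i, Integrable (M i) := fun i => by
      rw [hM]; exact integrable_vecCons (hH.integrable_coord_sq_div hN hm i)
    have hIK : ∫ s, K s = ∫ x, 1 / g x ^ (N - 1) := by
      rw [hK]; exact integral_vecCons (hg.integrable_inv_pow_pred hN hm)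
    have hIJ : ∫ s, J s = ∫ x, 1 / H x ^ (N - 1) := by
      rw [hJ]; exact integral_vecCons (hH.integrable_inv_pow_pred hN hm)
    have hIA : ∀ i, ∫ s, A i s = ∫ x, D i x ^ 2 / g x ^ N := fun i => by
      rw [hA]; exact integral_vecCons (hg.integrable_sq_div hN hm i)
    have hIM : ∀ i, ∫ s, M i s = ∫ x, x i ^ 2 / H x ^ N := fun i => by
      rw [hM]; exact integral_vecCons (hH.integrable_coord_sq_div hN hm i)
    have hK0 : ∀ s, 0 ≤ K s := fun s => by
      rw [hK]; exact integral_nonneg fun y => (one_div_pos.2 (pow_pos (hg.fun_pos _) _)).le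
    -- the inequality on each slice
    have hslice : ∀ x, δ ^ (((N : ℝ) - (m + 1)) / N) * (T x * J (t x)) ≤
        1 / N * (((N : ℝ) - (m + 1)) * δ * K x + T x * K x +
          ∑ i : Fin m, (((N : ℝ) - 1) ^ 2 / (2 * l) * A i.succ x +
            l / 2 * (T x * M i.succ (t x)))) := by
      intro x
      have := transport_inequality_rescale (l := l) (δ := δ) hm
        (fun y => g (Matrix.vecCons x y)) (fun i => ((N : ℝ) - 1) ^ 2 / (2 * l) * A i.succ x)
        (fun c' B' δ' hc' hB' hδ' hmass' => by
          rw [hA]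
          exact ih (by omega) _ _ _ _ c' B' δ' (hg.slice x) hc' hB' hδ' hmass')
        hc (add_pos_of_pos_of_nonneg hB (sq_nonneg (t x))) hδ (hTpos x)
        (by have := hK0 x; rwa [hK] at this)
        (by
          simp only [hHs]
          have := hTG x
          rw [hG₀, hF₀] at this
          exact this.symm)
      simp only [hHs] at this
      rw [hK, hJ, hM]
      simpa only [Matrix.cons_val_succ] using this
    -- integration by parts in the first variable
    have hparts : Integrable (fun x => T x * K x) ∧ ∫ x, T x * K x ≤
        ((N : ℝ) - 1) ^ 2 / (2 * l) * (∫ x, A 0 x) + l / 2 * ∫ x, M 0 x := by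
      have hM0 : ∀ s, M 0 s = s ^ 2 * G₀ s := fun s => by
        rw [hM, hG₀]
        simp only [Matrix.cons_val_zero]
        rw [← integral_const_mul]
        simp only [mul_one_div]
      have hbint : Integrable fun x => ((N : ℝ) - 1) ^ 2 / (2 * l) * A 0 x +
          l / 2 * (T x * M 0 (t x)) :=
        ((hAint 0).const_mul _).add (((integrable_deriv_mul_comp_iff htm hts htd'
          (fun x => (hTpos x).le) _).2 (hMint 0)).const_mul _)
      have hkd := fun s => hg.hasDerivAt_marginal hN hm s
      have hDint : Integrable fun x => D 0 x / g x ^ N :=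
        hg.integrable_div hN hm (hg.continuous_deriv 0) (hg.abs_deriv_le 0)
      have hk'i := integrable_vecCons (hDint.const_mul (-((N : ℝ) - 1)))
      rw [← hK] at hkd
      have := integral_deriv_mul_le_of_monotone htm.monotone htd' hTc hK0 hkd hKint hk'i
        (b := fun x => ((N : ℝ) - 1) ^ 2 / (2 * l) * A 0 x + l / 2 * (T x * M 0 (t x)))
        (fun x => ?_) hbint
      · refine ⟨this.1, this.2.trans (le_of_eq ?_)⟩
        rw [integral_add ((hAint 0).const_mul _) (((integrable_deriv_mul_comp_iff htm hts htd'
          (fun x => (hTpos x).le) _).2 (hMint 0)).const_mul _), integral_const_mul,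
          integral_const_mul, integral_deriv_mul_comp htm hts htd' (fun x => (hTpos x).le)]
      · have e1 : T x * M 0 (t x) = t x ^ 2 * F₀ x := by rw [hM0, ← hTG]; ring
        have hi1 := ((hg.slice x).integrable_inv_pow hN (by omega)).const_mul (t x ^ 2)
        have hi2 : Integrable fun y : Fin m → ℝ =>
            D 0 (Matrix.vecCons x y) ^ 2 / g (Matrix.vecCons x y) ^ N :=
          (hg.slice x).integrable_div hN (by omega)
            (((hg.continuous_deriv 0).comp (by fun_prop)).pow 2) (C := c₃ * (1 + x ^ 2))
            fun y => by
              rw [abs_of_nonneg (sq_nonneg _)]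
              refine (hg.growth _ _).trans ?_
              rw [quadWeight_vecCons, mul_assoc]
              have hc : 0 ≤ c₃ :=
                nonneg_of_mul_nonneg_left ((sq_nonneg _).trans (hg.growth 0 0)) (quadWeight_pos _)
              gcongr
              nlinarith [sq_nonneg x, one_le_quadWeight y]
        have e2 : ((N : ℝ) - 1) ^ 2 / (2 * l) * A 0 x + l / 2 * (t x ^ 2 * F₀ x) =
            ∫ y : Fin m → ℝ, (((N : ℝ) - 1) ^ 2 / (2 * l) *
              (D 0 (Matrix.vecCons x y) ^ 2 / g (Matrix.vecCons x y) ^ N) +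
              l / 2 * (t x ^ 2 * (1 / g (Matrix.vecCons x y) ^ N))) := by
          rw [integral_add (hi2.const_mul _) (hi1.const_mul _), integral_const_mul,
            integral_const_mul, integral_const_mul, hA, hF₀]
        rw [e1, e2, ← integral_const_mul]
        have hi3 : Integrable fun y : Fin m → ℝ => ((N : ℝ) - 1) ^ 2 / (2 * l) *
            (D 0 (Matrix.vecCons x y) ^ 2 / g (Matrix.vecCons x y) ^ N) +
            l / 2 * (t x ^ 2 * (1 / g (Matrix.vecCons x y) ^ N)) :=
          (hi2.const_mul _).add (hi1.const_mul _)
        rw [← Real.norm_eq_abs]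
        refine norm_integral_le_of_norm_le hi3 (Filter.Eventually.of_forall fun y => ?_)
        have hgp := pow_pos (hg.fun_pos (Matrix.vecCons x y)) N
        rw [norm_mul, norm_mul, norm_div, Real.norm_of_nonneg hgp.le]
        simp only [Real.norm_eq_abs, abs_neg]
        have key : |t x| * (|(N : ℝ) - 1| * |D 0 (Matrix.vecCons x y)|) ≤
            ((N : ℝ) - 1) ^ 2 / (2 * l) * D 0 (Matrix.vecCons x y) ^ 2 + l / 2 * t x ^ 2 := by
          rw [← sq_abs ((N : ℝ) - 1), ← sq_abs (D 0 (Matrix.vecCons x y)), ← sq_abs (t x)]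
          have := sq_nonneg (|(N : ℝ) - 1| * |D 0 (Matrix.vecCons x y)| - l * |t x|)
          field_simp
          nlinarith
        calc _ = |t x| * (|(N : ℝ) - 1| * |D 0 (Matrix.vecCons x y)|) /
              g (Matrix.vecCons x y) ^ N := by ring
          _ ≤ (((N : ℝ) - 1) ^ 2 / (2 * l) * D 0 (Matrix.vecCons x y) ^ 2 + l / 2 * t x ^ 2) /
              g (Matrix.vecCons x y) ^ N := by gcongr
          _ = _ := by ring
    have hcomp : ∀ k : ℝ → ℝ, Integrable k → Integrable fun x => T x * k (t x) := fun k hk =>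
      (integrable_deriv_mul_comp_iff htm hts htd' (fun x => (hTpos x).le) _).2 hk
    have hicomp : ∀ k : ℝ → ℝ, ∫ x, T x * k (t x) = ∫ x, k x := fun k =>
      integral_deriv_mul_comp htm hts htd' (fun x => (hTpos x).le) k
    have hsum : ∀ i : Fin m, Integrable fun x => ((N : ℝ) - 1) ^ 2 / (2 * l) * A i.succ x +
            l / 2 * (T x * M i.succ (t x)) := fun i =>
      ((hAint _).const_mul _).add ((hcomp _ (hMint _)).const_mul _)
    have hleft : Integrable fun x => ((N : ℝ) - (m + 1)) * δ * K x + T x * K x :=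
      (hKint.const_mul _).add hparts.1
    have hright : Integrable fun x => ∑ i : Fin m, (((N : ℝ) - 1) ^ 2 / (2 * l) * A i.succ x +
        l / 2 * (T x * M i.succ (t x))) := integrable_finsetSum Finset.univ fun i _ => hsum i
    have hI := integral_mono ((hcomp J hJint).const_mul _)
      ((hleft.add hright).const_mul (1 / (N : ℝ))) hslice
    simp only [Pi.add_apply] at hI
    rw [integral_const_mul, hicomp, hIJ, integral_const_mul, integral_add hleft hright,
      integral_add (hKint.const_mul _) hparts.1, integral_const_mul, hIK,
      integral_finsetSum _ fun i _ => hsum i] at hI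
    push_cast
    refine hI.trans (mul_le_mul_of_nonneg_left ?_ (by positivity))
    rw [add_assoc]
    refine add_le_add le_rfl ?_
    rw [Fin.sum_univ_succ]
    refine add_le_add (hparts.2.trans (le_of_eq ?_)) (Finset.sum_le_sum fun i _ => le_of_eq ?_)
    · rw [hIA, hIM]
    · rw [integral_add ((hAint _).const_mul _) ((hcomp _ (hMint _)).const_mul _),
        integral_const_mul, integral_const_mul, hicomp, hIA, hIM]

theorem integral_exp_neg_mul_quadWeight {m : ℕ} {t : ℝ} (ht : 0 < t) :
    ∫ x : Fin m → ℝ, exp (-(quadWeight x * t)) = exp (-t) * (π / t) ^ ((m : ℝ) / 2) := by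
  have h : ∀ x : Fin m → ℝ, exp (-(quadWeight x * t)) = exp (-t) * ∏ i, exp (-t * x i ^ 2) :=
    fun x => by
      rw [← exp_sum, ← exp_add, ← Finset.mul_sum, quadWeight]
      congr 1; ring
  simp only [h]
  rw [integral_const_mul, integral_fintype_prod_volume_eq_pow fun s => exp (-t * s ^ 2),
    integral_gaussian, Fintype.card_fin,
    ← rpow_natCast, sqrt_eq_rpow, ← rpow_mul (by positivity)]
  congr 2; ring

theorem integral_inv_quadWeight_pow {m p : ℕ} (h : m < 2 * p) :
    ∫ x : Fin m → ℝ, 1 / quadWeight x ^ p =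
      π ^ ((m : ℝ) / 2) * (Gamma (p - (m : ℝ) / 2) / Gamma p) := by
  have hp : (0 : ℝ) < p := by exact_mod_cast (by omega : 0 < p)
  have hmp : (0 : ℝ) < p - (m : ℝ) / 2 := by
    have : (m : ℝ) < 2 * p := by exact_mod_cast h
    linarith
  have h1 : ∀ x : Fin m → ℝ, ∫ t in Set.Ioi (0 : ℝ), t ^ ((p : ℝ) - 1) *
      exp (-(quadWeight x * t)) = 1 / quadWeight x ^ p * Gamma p := fun x => by
    rw [integral_rpow_mul_exp_neg_mul_Ioi hp (quadWeight_pos x), rpow_natCast, div_pow, one_pow]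
  have h_integrable : Integrable (Function.uncurry fun (x : Fin m → ℝ) (t : ℝ) =>
      t ^ ((p : ℝ) - 1) * exp (-(quadWeight x * t)))
      (volume.prod (volume.restrict (Set.Ioi 0))) := by
    refine (integrable_prod_iff ?_).2 ⟨Filter.Eventually.of_forall fun x => ?_, ?_⟩
    · have := (continuous_quadWeight (m := m)).measurable
      exact Measurable.aestronglyMeasurable (by unfold Function.uncurry; fun_prop)
    · refine .of_integral_ne_zero ?_
      have := pow_pos (quadWeight_pos x) p
      have := Gamma_pos_of_pos hp
      simp only [Function.uncurry]
      rw [h1]; positivity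
    · refine ((integrable_inv_quadWeight_pow h).mul_const (Gamma p)).congr
        (Filter.Eventually.of_forall fun x => ?_)
      simp only
      rw [← one_div, ← h1 x]
      refine setIntegral_congr_fun measurableSet_Ioi fun t ht => ?_
      have ht : 0 < t := ht
      simp only [Function.uncurry]
      rw [Real.norm_of_nonneg (by positivity)]
  have hswap := integral_integral_swap h_integrable
  simp only [h1] at hswap
  rw [integral_mul_const] at hswap
  have h2 : ∫ t in Set.Ioi (0 : ℝ), ∫ x : Fin m → ℝ, t ^ ((p : ℝ) - 1) *
      exp (-(quadWeight x * t)) = π ^ ((m : ℝ) / 2) * Gamma (p - (m : ℝ) / 2) := by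
    have e : ∀ t ∈ Set.Ioi (0 : ℝ), ∫ x : Fin m → ℝ, t ^ ((p : ℝ) - 1) *
        exp (-(quadWeight x * t)) =
        π ^ ((m : ℝ) / 2) * (t ^ (((p : ℝ) - (m : ℝ) / 2) - 1) * exp (-(1 * t))) := fun t ht => by
      have ht : 0 < t := ht
      rw [integral_const_mul, integral_exp_neg_mul_quadWeight ht, div_rpow pi_pos.le ht.le,
        sub_right_comm, rpow_sub ht _ ((m : ℝ) / 2), one_mul]
      ring
    rw [setIntegral_congr_fun measurableSet_Ioi e, integral_const_mul,
      integral_rpow_mul_exp_neg_mul_Ioi hmp one_pos]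
    simp
  rw [h2] at hswap
  rw [← mul_div_assoc, eq_div_iff (Gamma_pos_of_pos hp).ne', hswap]

/-- The mass of the extremal density. -/
noncomputable def bubbleMass (n : ℕ) : ℝ := ∫ x : Fin n → ℝ, 1 / quadWeight x ^ n

theorem bubbleMass_eq {n : ℕ} (hn : 3 ≤ n) :
    bubbleMass n = π ^ ((n : ℝ) / 2) * (Gamma ((n : ℝ) / 2) / Gamma n) := by
  rw [bubbleMass, integral_inv_quadWeight_pow (by omega)]
  congr 3; ring

theorem bubbleMass_pos {n : ℕ} (hn : 3 ≤ n) : 0 < bubbleMass n := by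
  have hn0 : (0 : ℝ) < n := by exact_mod_cast (by omega : 0 < n)
  have := Gamma_pos_of_pos hn0
  have := Gamma_pos_of_pos (half_pos hn0)
  rw [bubbleMass_eq hn]
  positivity

theorem sobolevConst_eq {n : ℕ} (hn : 3 ≤ n) :
    sobolevConst n = n * ((n : ℝ) - 2) * bubbleMass n ^ (2 / (n : ℝ)) := by
  have hn0 : (0 : ℝ) < n := by exact_mod_cast (by omega : 0 < n)
  have h1 := Gamma_pos_of_pos hn0
  have h2 := Gamma_pos_of_pos (half_pos hn0)
  rw [bubbleMass_eq hn, sobolevConst, mul_rpow (by positivity) (by positivity),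
    ← rpow_mul pi_pos.le]
  have : (n : ℝ) / 2 * (2 / n) = 1 := by field_simp
  rw [this, rpow_one]
  ring

theorem integral_inv_quadWeight_pow_pred {n : ℕ} (hn : 3 ≤ n) :
    ∫ x : Fin n → ℝ, 1 / quadWeight x ^ (n - 1) =
      2 * ((n : ℝ) - 1) / ((n : ℝ) - 2) * bubbleMass n := by
  have hn3 : (3 : ℝ) ≤ n := by exact_mod_cast hn
  have hn0 : (0 : ℝ) < n := by linarith
  rw [bubbleMass_eq hn, integral_inv_quadWeight_pow (by omega), Nat.cast_sub (by omega : 1 ≤ n),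
    Nat.cast_one]
  have e1 : Gamma (n : ℝ) = ((n : ℝ) - 1) * Gamma ((n : ℝ) - 1) := by
    rw [← Gamma_add_one (by linarith : (n : ℝ) - 1 ≠ 0)]; congr 1; ring
  have e2 : Gamma ((n : ℝ) / 2) = ((n : ℝ) / 2 - 1) * Gamma ((n : ℝ) / 2 - 1) := by
    rw [← Gamma_add_one (by linarith : (n : ℝ) / 2 - 1 ≠ 0)]; congr 1; ring
  have e3 : (n : ℝ) - 1 - n / 2 = n / 2 - 1 := by ring
  rw [e1, e2, e3]
  have h3 := (Gamma_pos_of_pos (by linarith : (0 : ℝ) < n - 1)).ne'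
  have h4 : (n : ℝ) - 2 ≠ 0 := by linarith
  have h5 : (n : ℝ) - 1 ≠ 0 := by linarith
  field_simp

theorem integrable_coord_sq_div_quadWeight {n : ℕ} (hn : 3 ≤ n) (i : Fin n) :
    Integrable fun x : Fin n → ℝ => x i ^ 2 / quadWeight x ^ n := by
  simpa [quadWeight] using
    (QuadGrowth.profile (m := n) one_pos one_pos).integrable_coord_sq_div hn le_rfl i

theorem sum_integral_coord_sq_div_quadWeight {n : ℕ} (hn : 3 ≤ n) :
    ∑ i, ∫ x : Fin n → ℝ, x i ^ 2 / quadWeight x ^ n = n / ((n : ℝ) - 2) * bubbleMass n := by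
  have hn3 : (3 : ℝ) ≤ n := by exact_mod_cast hn
  have hn2 : (n : ℝ) - 2 ≠ 0 := by linarith
  rw [← integral_finsetSum _ fun i _ => integrable_coord_sq_div_quadWeight hn i]
  have e : ∀ x : Fin n → ℝ, ∑ i, x i ^ 2 / quadWeight x ^ n =
      1 / quadWeight x ^ (n - 1) - 1 / quadWeight x ^ n := fun x => by
    have hw := quadWeight_pos x
    obtain ⟨p, rfl⟩ : ∃ p, n = p + 1 := ⟨n - 1, by omega⟩
    rw [← Finset.sum_div, show ∑ i, x i ^ 2 = quadWeight x - 1 by rw [quadWeight]; ring,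
      Nat.add_sub_cancel]
    field_simp
    ring
  have i1 : Integrable fun x : Fin n → ℝ => 1 / quadWeight x ^ (n - 1) := by
    simpa using integrable_inv_quadWeight_pow (m := n) (p := n - 1) (by omega)
  have i2 : Integrable fun x : Fin n → ℝ => 1 / quadWeight x ^ n := by
    simpa using integrable_inv_quadWeight_pow (m := n) (p := n) (by omega)
  simp only [e]
  rw [integral_sub i1 i2, integral_inv_quadWeight_pow_pred hn, ← bubbleMass]
  field_simp
  ring

theorem hasDerivAt_quadWeight_update {n : ℕ} (x : Fin n → ℝ) (i : Fin n) (t : ℝ) :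
    HasDerivAt (fun s => quadWeight (Function.update x i s)) (2 * t) t := by
  have := (QuadGrowth.profile (m := n) one_pos one_pos).hasDerivAt i x t
  simpa [quadWeight] using this

/-- A compactly supported function, regularised and rewritten as a function of quadratic growth. -/
theorem quadGrowth_regularization {n q : ℕ} (hq : 0 < q) {φ : (Fin n → ℝ) → ℝ}
    (hφ : ContDiff ℝ 1 φ) (hc : HasCompactSupport φ) {e : ℝ} (he : 0 < e) :
    ∃ c₁ c₃, QuadGrowth
      (fun x => quadWeight x * (φ x ^ 2 * quadWeight x ^ q + e) ^ (-(1 / (q : ℝ))))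
      (fun i x => 2 * (φ x ^ 2 * quadWeight x ^ q + e) ^ (-(1 / (q : ℝ))) *
        (e * q * x i - quadWeight x ^ (q + 1) * φ x * fderiv ℝ φ x (Pi.single i 1)) /
          (q * (φ x ^ 2 * quadWeight x ^ q + e))) c₁ c₃ := by
  have hq0 : (0 : ℝ) < q := by exact_mod_cast hq
  have hWc := continuous_quadWeight (m := n)
  have hφc := hφ.continuous
  have hdc : ∀ i, Continuous fun x => fderiv ℝ φ x (Pi.single i 1) := fun i =>
    (hφ.continuous_fderiv one_ne_zero).clm_apply continuous_const
  obtain ⟨G, hG⟩ : ∃ G : (Fin n → ℝ) → ℝ, G = fun x => φ x ^ 2 * quadWeight x ^ q + e :=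
    ⟨_, rfl⟩
  have hGx : ∀ x, φ x ^ 2 * quadWeight x ^ q + e = G x := fun x => by rw [hG]
  have hGe : ∀ x, e ≤ G x := fun x => by
    have := quadWeight_pos x
    rw [← hGx]
    linarith [mul_nonneg (sq_nonneg (φ x)) (pow_pos this q).le]
  have hG0 : ∀ x, 0 < G x := fun x => he.trans_le (hGe x)
  have hGc : Continuous G := by rw [hG]; fun_prop
  obtain ⟨C, hC⟩ : ∃ C, ∀ x, G x ≤ C := by
    obtain ⟨C, hC⟩ := (show HasCompactSupport fun x => φ x * (φ x * quadWeight x ^ q) from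
      hc.mul_right).exists_bound_of_continuous (by fun_prop)
    refine ⟨C + e, fun x => ?_⟩
    have := (le_abs_self _).trans (hC x)
    rw [← hGx]
    nlinarith
  have hC0 : 0 < C := (hG0 0).trans_le (hC 0)
  have hb : ∀ i, ∃ C', ∀ x, |quadWeight x ^ (q + 1) * φ x * fderiv ℝ φ x (Pi.single i 1)| ≤ C' :=
    fun i => by
      have := hdc i
      exact HasCompactSupport.exists_bound_of_continuous
        ((hc.mul_left (f := fun x => quadWeight x ^ (q + 1))).mul_right
          (f' := fun x => fderiv ℝ φ x (Pi.single i 1))) (by fun_prop)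
  choose C' hC' using hb
  obtain ⟨h, hh⟩ : ∃ h : (Fin n → ℝ) → ℝ, h = fun x => G x ^ (-(1 / (q : ℝ))) := ⟨_, rfl⟩
  have hhx : ∀ x, G x ^ (-(1 / (q : ℝ))) = h x := fun x => by rw [hh]
  have hh0 : ∀ x, 0 < h x := fun x => by rw [hh]; exact rpow_pos_of_pos (hG0 x) _
  have hhc : Continuous h := by
    rw [hh]; exact hGc.rpow_const fun x => Or.inl (hG0 x).ne'
  simp only [hGx, hhx]
  refine ⟨C ^ (-(1 / (q : ℝ))), 8 / (q * e) ^ 2 * (e ^ (-(1 / (q : ℝ)))) ^ 2 *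
    ((e * q) ^ 2 + (∑ i, C' i ^ 2)), ⟨hWc.mul hhc, fun i => ?_, fun i x t => ?_,
      rpow_pos_of_pos hC0 _, fun x => ?_, fun i x => ?_⟩⟩
  · have := hdc i
    exact Continuous.div (by fun_prop) (by fun_prop) fun x => (mul_pos hq0 (hG0 x)).ne'
  · set y := Function.update x i t with hy
    have hW := hasDerivAt_quadWeight_update x i t
    have hphi : HasDerivAt (fun s => φ (Function.update x i s)) (fderiv ℝ φ y (Pi.single i 1)) t :=
      ((hφ.differentiable one_ne_zero y).hasFDerivAt).comp_hasDerivAt t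
        (hasDerivAt_update x i t)
    have hGd := ((hphi.pow 2).mul (hW.pow q)).add_const e
    have hhd := hGd.rpow_const (p := -(1 / (q : ℝ))) (Or.inl (by
      simp only [Pi.mul_apply, Pi.pow_apply]
      rw [hGx]; exact (hG0 _).ne'))
    have := hW.mul hhd
    rw [hh]
    beta_reduce
    simp only [Pi.mul_apply, Pi.pow_apply, hGx] at this
    refine this.congr_deriv ?_
    rw [← hy, rpow_sub_one (hG0 y).ne', hhx y]
    have hty : y i = t := by rw [hy, Function.update_self]
    rw [hty]
    have hGy := hG0 y
    obtain ⟨p, rfl⟩ : ∃ p, q = p + 1 := ⟨q - 1, by omega⟩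
    have hg' := hGx y
    rw [Nat.add_sub_cancel]
    generalize h y = hy' at *
    generalize quadWeight y = w at *
    generalize φ y = f at *
    field_simp
    rw [← hg']
    push_cast
    ring
  · rw [mul_comm, ← hhx]
    refine mul_le_mul_of_nonneg_left ?_ (quadWeight_pos x).le
    exact rpow_le_rpow_of_nonpos (hG0 x) (hC x) (by simp)
  · have h1 : h x ≤ e ^ (-(1 / (q : ℝ))) := by
      rw [← hhx]; exact rpow_le_rpow_of_nonpos he (hGe x) (by simp)
    have h2 : (e * q * x i - quadWeight x ^ (q + 1) * φ x * fderiv ℝ φ x (Pi.single i 1)) ^ 2 ≤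
        2 * (((e * q) ^ 2 + ∑ i, C' i ^ 2) * quadWeight x) := by
      have h3 := sq_le_sq' (abs_le.1 (hC' i x)).1 (abs_le.1 (hC' i x)).2
      have h4 := Finset.single_le_sum (f := fun i => C' i ^ 2) (fun i _ => sq_nonneg _)
        (Finset.mem_univ i)
      have h5 := mul_le_mul_of_nonneg_left (sq_le_quadWeight x i) (sq_nonneg (e * q))
      have h6 := one_le_quadWeight x
      have h7 : ∑ i, C' i ^ 2 ≤ (∑ i, C' i ^ 2) * quadWeight x :=
        le_mul_of_one_le_right ((sq_nonneg _).trans h4) h6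
      have h8 := sq_nonneg (e * q * x i + quadWeight x ^ (q + 1) * φ x *
        fderiv ℝ φ x (Pi.single i 1))
      nlinarith
    rw [div_pow, mul_pow, mul_pow]
    have h9 : (0 : ℝ) ≤ ∑ i, C' i ^ 2 := Finset.sum_nonneg fun i _ => sq_nonneg _
    have hhx0 := hh0 x
    have := quadWeight_pos x
    calc _ ≤ 2 ^ 2 * (e ^ (-(1 / (q : ℝ)))) ^ 2 *
          (2 * (((e * q) ^ 2 + ∑ i, C' i ^ 2) * quadWeight x)) / (q * e) ^ 2 := by
          gcongr
          exact hGe x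
      _ = _ := by ring

theorem sobolev_regularized {n : ℕ} (hn : 3 ≤ n) {φ : (Fin n → ℝ) → ℝ}
    (hφ : ContDiff ℝ 1 φ) (hc : HasCompactSupport φ) {e : ℝ} (he : 0 < e) :
    sobolevConst n * (∫ x, |φ x| ^ (2 * (n : ℝ) / ((n : ℝ) - 2))) ^ (((n : ℝ) - 2) / n) ≤
      ∑ i, (∫ x, fderiv ℝ φ x (Pi.single i 1) ^ 2) + e * (n * ((n : ℝ) - 2) * bubbleMass n) := by
  obtain ⟨q, rfl⟩ : ∃ q, n = q + 2 := ⟨n - 2, by omega⟩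
  have hq : 0 < q := by omega
  have hq0 : (0 : ℝ) < q := by exact_mod_cast hq
  have hI := bubbleMass_pos hn
  set I := bubbleMass (q + 2) with hIdef
  obtain ⟨c₁, c₃, hg⟩ := quadGrowth_regularization hq hφ hc he
  have hE0 : ∀ i, Integrable fun x => fderiv ℝ φ x (Pi.single i 1) ^ 2 := fun i => by
    have hd : Continuous fun x => fderiv ℝ φ x (Pi.single i 1) :=
      (hφ.continuous_fderiv one_ne_zero).clm_apply continuous_const
    refine (hd.pow 2).integrable_of_hasCompactSupport ?_
    have := hc.fderiv_apply ℝ (Pi.single i 1)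
    simpa [pow_two] using this.mul_right (f' := fun x => fderiv ℝ φ x (Pi.single i 1))
  obtain ⟨g, hgdef⟩ : ∃ g : (Fin (q + 2) → ℝ) → ℝ, g = fun x =>
    quadWeight x * (φ x ^ 2 * quadWeight x ^ q + e) ^ (-(1 / (q : ℝ))) := ⟨_, rfl⟩
  obtain ⟨D, hDdef⟩ : ∃ D : Fin (q + 2) → (Fin (q + 2) → ℝ) → ℝ, D = fun i x =>
    2 * (φ x ^ 2 * quadWeight x ^ q + e) ^ (-(1 / (q : ℝ))) *
        (e * q * x i - quadWeight x ^ (q + 1) * φ x * fderiv ℝ φ x (Pi.single i 1)) /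
          (q * (φ x ^ 2 * quadWeight x ^ q + e)) := ⟨_, rfl⟩
  rw [← hgdef, ← hDdef] at hg
  have hG0 : ∀ x, 0 < φ x ^ 2 * quadWeight x ^ q + e := fun x => by
    have := quadWeight_pos x
    positivity
  have hgpow : ∀ x, 1 / g x ^ (q + 2) =
      (φ x ^ 2 * quadWeight x ^ q + e) ^ (((q : ℝ) + 2) / q) / quadWeight x ^ (q + 2) := fun x => by
    have hw := quadWeight_pos x
    rw [hgdef]
    simp only
    rw [mul_pow, ← rpow_natCast ((_ : ℝ) ^ (-(1 / (q : ℝ)))), ← rpow_mul (hG0 x).le,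
      show -(1 / (q : ℝ)) * ((q + 2 : ℕ) : ℝ) = -(((q : ℝ) + 2) / q) by push_cast; ring,
      rpow_neg (hG0 x).le]
    field_simp
  have hDle : ∀ i x, (q : ℝ) ^ 2 / 4 * (D i x ^ 2 / g x ^ (q + 2)) ≤
      fderiv ℝ φ x (Pi.single i 1) ^ 2 + e * q ^ 2 * (x i ^ 2 / quadWeight x ^ (q + 2)) :=
    fun i x => by
      have hw := quadWeight_pos x
      have hG := hG0 x
      rw [hDdef, hgdef]
      simp only
      have hpow : ((φ x ^ 2 * quadWeight x ^ q + e) ^ (-(1 / (q : ℝ)))) ^ q *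
          (φ x ^ 2 * quadWeight x ^ q + e) = 1 := by
        rw [← rpow_natCast ((_ : ℝ) ^ (-(1 / (q : ℝ)))), ← rpow_mul hG.le,
          show -(1 / (q : ℝ)) * (q : ℝ) = -1 by field_simp, rpow_neg_one, inv_mul_cancel₀ hG.ne']
      have hh := rpow_pos_of_pos hG (-(1 / (q : ℝ)))
      generalize (φ x ^ 2 * quadWeight x ^ q + e) ^ (-(1 / (q : ℝ))) = h at hpow hh
      generalize hGe : φ x ^ 2 * quadWeight x ^ q + e = G at hpow hG
      generalize quadWeight x = w at *
      generalize φ x = f at *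
      generalize fderiv ℝ φ x (Pi.single i 1) = d at *
      generalize x i = y at *
      have e1 : (q : ℝ) ^ 2 / 4 * ((2 * h * (e * q * y - w ^ (q + 1) * f * d) / (q * G)) ^ 2 /
          (w * h) ^ (q + 2)) = (e * q * y - w ^ (q + 1) * f * d) ^ 2 / (G * w ^ (q + 2)) := by
        rw [mul_pow w h, pow_add h, eq_div_of_mul_eq hG.ne' hpow]
        field_simp
        ring
      rw [e1, div_le_iff₀ (by positivity), ← hGe, ← sub_nonneg]
      have e2 : (d ^ 2 + e * q ^ 2 * (y ^ 2 / w ^ (q + 2))) * ((f ^ 2 * w ^ q + e) * w ^ (q + 2)) -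
          (e * q * y - w ^ (q + 1) * f * d) ^ 2 = e * w ^ q * (f * q * y + d * w) ^ 2 := by
        field_simp
        ring
      rw [e2]
      positivity
  have hMint := hg.integrable_inv_pow hn le_rfl
  obtain ⟨M, hM⟩ : ∃ M, M = ∫ x, 1 / g x ^ (q + 2) := ⟨_, rfl⟩
  have hMpos : 0 < M := by rw [hM]; exact hg.integral_inv_pow_pos hn le_rfl
  have hφM : ∫ x, |φ x| ^ (2 * ((q + 2 : ℕ) : ℝ) / (((q + 2 : ℕ) : ℝ) - 2)) ≤ M := by
    rw [hM]
    refine integral_mono_of_nonneg (Filter.Eventually.of_forall fun x => by positivity) hMint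
      (Filter.Eventually.of_forall fun x => ?_)
    have hw := quadWeight_pos x
    simp only
    rw [hgpow, le_div_iff₀ (by positivity)]
    calc _ = (φ x ^ 2 * quadWeight x ^ q) ^ (((q : ℝ) + 2) / q) := by
          rw [mul_rpow (by positivity) (by positivity), ← sq_abs, ← rpow_natCast |φ x|,
            ← rpow_mul (abs_nonneg _), ← rpow_natCast (quadWeight x) q, ← rpow_mul hw.le,
            ← rpow_natCast (quadWeight x) (q + 2)]
          congr 2
          · push_cast; rw [add_sub_cancel_right]; ring
          · push_cast; field_simp
      _ ≤ _ := rpow_le_rpow (by positivity) (by linarith) (by positivity)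
  obtain ⟨μ, hμ⟩ : ∃ μ, μ = (I / M) ^ (1 / ((q + 2 : ℕ) : ℝ)) := ⟨_, rfl⟩
  have hμ0 : 0 < μ := hμ ▸ rpow_pos_of_pos (div_pos hI hMpos) _
  have hμpow : μ ^ (q + 2) = I / M := by
    rw [hμ, ← rpow_natCast, ← rpow_mul (div_pos hI hMpos).le, one_div_mul_cancel (by positivity),
      rpow_one]
  have hprof : ∀ (p : ℕ) (k : (Fin (q + 2) → ℝ) → ℝ),
      ∫ x : Fin (q + 2) → ℝ, k x / (μ * (1 + ∑ i, x i ^ 2)) ^ p =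
        (1 / μ ^ p) * ∫ x : Fin (q + 2) → ℝ, k x / quadWeight x ^ p := fun p k => by
    rw [← integral_const_mul]
    congr 1 with x
    rw [quadWeight, mul_pow, div_mul_div_comm, one_mul]
  have hT := QuadGrowth.transport_inequality hn (l := 2 * μ * (q + 1)) (by positivity) (q + 2)
    le_rfl g D c₁ c₃ μ 1 1 hg hμ0 one_pos one_pos (by
      rw [← hM, hprof, hμpow]
      change M = 1 / (I / M) * I
      field_simp)
  simp only [hprof] at hT
  rw [integral_inv_quadWeight_pow_pred hn, one_rpow, one_mul, sub_self, zero_mul, zero_mul,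
    zero_add, Finset.sum_add_distrib, ← Finset.mul_sum, ← Finset.mul_sum, ← Finset.mul_sum,
    sum_integral_coord_sq_div_quadWeight hn, ← hIdef] at hT
  have hE : (q : ℝ) ^ 2 / 4 * (∑ i, ∫ x, D i x ^ 2 / g x ^ (q + 2)) ≤
      ∑ i, (∫ x, fderiv ℝ φ x (Pi.single i 1) ^ 2) + e * ((q + 2 : ℕ) * q * I) := by
    calc _ = ∑ i, ∫ x, (q : ℝ) ^ 2 / 4 * (D i x ^ 2 / g x ^ (q + 2)) := by
          rw [Finset.mul_sum]; simp only [integral_const_mul]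
      _ ≤ ∑ i, ∫ x, (fderiv ℝ φ x (Pi.single i 1) ^ 2 +
          e * q ^ 2 * (x i ^ 2 / quadWeight x ^ (q + 2))) :=
          Finset.sum_le_sum fun i _ => integral_mono
            ((hg.integrable_sq_div hn le_rfl i).const_mul _)
            ((hE0 i).add ((integrable_coord_sq_div_quadWeight hn i).const_mul _)) (hDle i)
      _ = ∑ i, (∫ x, fderiv ℝ φ x (Pi.single i 1) ^ 2) + e * q ^ 2 *
          ∑ i, ∫ x : Fin (q + 2) → ℝ, x i ^ 2 / quadWeight x ^ (q + 2) := by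
          rw [Finset.mul_sum, ← Finset.sum_add_distrib]
          refine Finset.sum_congr rfl fun i _ => ?_
          rw [integral_add (hE0 i) ((integrable_coord_sq_div_quadWeight hn i).const_mul _),
            integral_const_mul]
      _ = _ := by
          rw [sum_integral_coord_sq_div_quadWeight hn, ← hIdef]
          push_cast
          rw [add_sub_cancel_right]
          field_simp
  have hSM : sobolevConst (q + 2) * M ^ ((((q + 2 : ℕ) : ℝ) - 2) / ((q + 2 : ℕ) : ℝ)) =
      ((q + 2 : ℕ) : ℝ) * q * I / μ ^ q := by
    rw [sobolevConst_eq hn, ← hIdef]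
    have e1 : μ ^ q = I ^ ((q : ℝ) / (q + 2)) / M ^ ((q : ℝ) / (q + 2)) := by
      rw [hμ, ← rpow_natCast, ← rpow_mul (div_pos hI hMpos).le, ← div_rpow hI.le hMpos.le]
      congr 1
      push_cast; ring
    have e2 : I = I ^ (2 / ((q : ℝ) + 2)) * I ^ ((q : ℝ) / (q + 2)) := by
      rw [← rpow_add hI, ← add_div, add_comm 2, div_self (by positivity), rpow_one]
    have h1 := rpow_pos_of_pos hI ((q : ℝ) / (q + 2))
    have h2 := rpow_pos_of_pos hMpos ((q : ℝ) / (q + 2))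
    rw [e1]
    push_cast
    rw [add_sub_cancel_right]
    nth_rewrite 2 [e2]
    field_simp
  calc _ ≤ sobolevConst (q + 2) * M ^ ((((q + 2 : ℕ) : ℝ) - 2) / ((q + 2 : ℕ) : ℝ)) := by
        have : 0 < sobolevConst (q + 2) := by
          rw [sobolevConst_eq hn, ← hIdef]; push_cast; rw [add_sub_cancel_right]; positivity
        have h2 : 0 ≤ (((q + 2 : ℕ) : ℝ) - 2) / ((q + 2 : ℕ) : ℝ) := by
          push_cast; rw [add_sub_cancel_right]; positivity
        exact mul_le_mul_of_nonneg_left (rpow_le_rpow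
          (integral_nonneg fun x => by positivity) hφM h2) this.le
    _ = _ := hSM
    _ ≤ (q : ℝ) ^ 2 / 4 * (∑ i, ∫ x, D i x ^ 2 / g x ^ (q + 2)) := by
        generalize (∑ i, ∫ x, D i x ^ 2 / g x ^ (q + 2)) = E at hT
        rw [Nat.add_sub_assoc one_le_two, show 2 - 1 = 1 from rfl, pow_add, pow_add] at hT
        push_cast at hT ⊢
        rw [add_sub_cancel_right, show (q : ℝ) + 2 - 1 = q + 1 by ring] at hT
        have hp := pow_pos hμ0 q
        generalize μ ^ q = p at hT hp
        rw [← sub_nonneg] at hT ⊢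
        have key : (q : ℝ) ^ 2 / 4 * E - ((q : ℝ) + 2) * q * I / p = (q : ℝ) ^ 2 * μ *
          (q + 2) / (q + 1) * (1 / ((q : ℝ) + 2) * ((q + 1) ^ 2 / (2 * (2 * μ * (q + 1))) * E +
            2 * μ * (q + 1) / 2 * (1 / (p * μ ^ 2) * ((q + 2) / q * I))) -
            1 / (p * μ ^ 1) * (2 * (q + 1) / q * I)) := by
          field_simp
          ring
        rw [key]
        positivity
    _ ≤ _ := hE
    _ = _ := by push_cast; ring

/-- The sharp Sobolev inequality. -/
theorem sobolev_pi {n : ℕ} (hn : 3 ≤ n) {φ : (Fin n → ℝ) → ℝ}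
    (hφ : ContDiff ℝ 1 φ) (hc : HasCompactSupport φ) :
    sobolevConst n * (∫ x, |φ x| ^ (2 * (n : ℝ) / ((n : ℝ) - 2))) ^ (((n : ℝ) - 2) / n) ≤
      ∑ i, ∫ x, fderiv ℝ φ x (Pi.single i 1) ^ 2 := by
  have hn3 : (3 : ℝ) ≤ n := by exact_mod_cast hn
  have hK : 0 < n * ((n : ℝ) - 2) * bubbleMass n := by
    have := bubbleMass_pos hn
    have : (0 : ℝ) < n - 2 := by linarith
    positivity
  refine le_of_forall_pos_le_add fun ε hε => ?_
  have := sobolev_regularized hn hφ hc (div_pos hε hK)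
  rwa [div_mul_cancel₀ _ hK.ne'] at this

theorem integral_euclideanSpace_eq {n : ℕ} (f : EuclideanSpace ℝ (Fin n) → ℝ) :
    ∫ x, f x = ∫ y : Fin n → ℝ, f (WithLp.toLp 2 y) :=
  ((EuclideanSpace.volume_preserving_symm_measurableEquiv_toLp (Fin n)).symm.integral_comp
    (MeasurableEquiv.measurableEmbedding _) f).symm

theorem integrable_euclideanSpace_iff {n : ℕ} (f : EuclideanSpace ℝ (Fin n) → ℝ) :
    Integrable f ↔ Integrable fun y : Fin n → ℝ => f (WithLp.toLp 2 y) :=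
  ((EuclideanSpace.volume_preserving_symm_measurableEquiv_toLp (Fin n)).symm.integrable_comp_emb
    (MeasurableEquiv.measurableEmbedding _)).symm

theorem quadWeight_eq_norm {n : ℕ} (y : Fin n → ℝ) :
    quadWeight y = 1 + ‖WithLp.toLp 2 y‖ ^ 2 := by
  simp [quadWeight, EuclideanSpace.norm_sq_eq]

theorem norm_gradient_eq_norm_fderiv {n : ℕ} (f : EuclideanSpace ℝ (Fin n) → ℝ)
    (x : EuclideanSpace ℝ (Fin n)) : ‖gradient f x‖ = ‖fderiv ℝ f x‖ := by
  simp [gradient]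

theorem norm_fderiv_sq_eq_sum {n : ℕ} (L : EuclideanSpace ℝ (Fin n) →L[ℝ] ℝ) :
    ‖L‖ ^ 2 = ∑ i, L (EuclideanSpace.single i 1) ^ 2 := by
  obtain ⟨v, rfl⟩ := (InnerProductSpace.toDual ℝ (EuclideanSpace ℝ (Fin n))).surjective L
  simp [EuclideanSpace.norm_sq_eq, EuclideanSpace.inner_single_right]

/-- The sharp Sobolev inequality in Euclidean space. -/
theorem sobolev_euclideanSpace {n : ℕ} (hn : 3 ≤ n) {φ : EuclideanSpace ℝ (Fin n) → ℝ}
    (hφ : ContDiff ℝ 1 φ) (hc : HasCompactSupport φ) :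
    sobolevConst n * (∫ x, |φ x| ^ (2 * (n : ℝ) / ((n : ℝ) - 2))) ^ (((n : ℝ) - 2) / n) ≤
      ∫ x, ‖fderiv ℝ φ x‖ ^ 2 := by
  set T := (PiLp.continuousLinearEquiv 2 ℝ fun _ : Fin n => ℝ).symm with hT
  have hTx : ∀ y, T y = WithLp.toLp 2 y := fun y => rfl
  have h1 : ContDiff ℝ 1 (φ ∘ T) := hφ.comp T.contDiff
  have h2 : HasCompactSupport (φ ∘ T) := hc.comp_homeomorph T.toHomeomorph
  have hd : ∀ y i, fderiv ℝ (φ ∘ T) y (Pi.single i 1) =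
      fderiv ℝ φ (WithLp.toLp 2 y) (EuclideanSpace.single i 1) := fun y i => by
    rw [fderiv_comp y (hφ.differentiable one_ne_zero _) T.differentiableAt]
    rw [T.fderiv]
    rfl
  have := sobolev_pi hn h1 h2
  rw [integral_euclideanSpace_eq, integral_euclideanSpace_eq]
  refine this.trans (le_of_eq ?_)
  rw [← integral_finsetSum]
  · simp only [hd, norm_fderiv_sq_eq_sum]
  · intro i _
    have hdc : Continuous fun x => fderiv ℝ (φ ∘ T) x (Pi.single i 1) :=
      (h1.continuous_fderiv one_ne_zero).clm_apply continuous_const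
    refine (hdc.pow 2).integrable_of_hasCompactSupport ?_
    have := h2.fderiv_apply ℝ (Pi.single i 1)
    simpa [pow_two] using this.mul_right (f' := fun x => fderiv ℝ (φ ∘ T) x (Pi.single i 1))

theorem integrable_inv_one_add_norm_sq_pow {n p : ℕ} (h : n < 2 * p) :
    Integrable fun x : EuclideanSpace ℝ (Fin n) => 1 / (1 + ‖x‖ ^ 2) ^ p := by
  rw [integrable_euclideanSpace_iff]
  simpa [← quadWeight_eq_norm] using integrable_inv_quadWeight_pow h

theorem integral_inv_one_add_norm_sq_pow {n : ℕ} :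
    ∫ x : EuclideanSpace ℝ (Fin n), 1 / (1 + ‖x‖ ^ 2) ^ n = bubbleMass n := by
  rw [integral_euclideanSpace_eq, bubbleMass]
  simp only [quadWeight_eq_norm]

theorem integral_norm_sq_div_one_add_norm_sq_pow {n : ℕ} (hn : 3 ≤ n) :
    ∫ x : EuclideanSpace ℝ (Fin n), ‖x‖ ^ 2 / (1 + ‖x‖ ^ 2) ^ n =
      n / ((n : ℝ) - 2) * bubbleMass n := by
  rw [integral_euclideanSpace_eq, ← sum_integral_coord_sq_div_quadWeight hn,
    ← integral_finsetSum _ fun i _ => integrable_coord_sq_div_quadWeight hn i]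
  congr 1 with y
  rw [← Finset.sum_div, quadWeight_eq_norm, EuclideanSpace.norm_sq_eq]
  simp

/-- The extremal of the Sobolev inequality. -/
noncomputable def bubble {n : ℕ} (x : EuclideanSpace ℝ (Fin n)) : ℝ :=
  (1 + ‖x‖ ^ 2) ^ (-(((n : ℝ) - 2) / 2))

theorem contDiff_bubble {n : ℕ} {m : WithTop ℕ∞} : ContDiff ℝ m (bubble (n := n)) :=
  ContDiff.rpow_const_of_ne (contDiff_const.add (contDiff_norm_sq ℝ)) fun x => by positivity

theorem bubble_sq {n : ℕ} (hn : 3 ≤ n) (x : EuclideanSpace ℝ (Fin n)) :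
    bubble x ^ 2 = 1 / (1 + ‖x‖ ^ 2) ^ (n - 2) := by
  have h : 0 < 1 + ‖x‖ ^ 2 := by positivity
  rw [bubble]
  generalize 1 + ‖x‖ ^ 2 = v at h
  rw [← rpow_natCast, ← rpow_mul h.le, one_div, ← rpow_natCast, ← rpow_neg h.le]
  congr 1
  push_cast [Nat.cast_sub (by omega : 2 ≤ n)]
  ring

theorem abs_bubble_rpow {n : ℕ} (hn : 3 ≤ n) (x : EuclideanSpace ℝ (Fin n)) :
    |bubble x| ^ (2 * (n : ℝ) / ((n : ℝ) - 2)) = 1 / (1 + ‖x‖ ^ 2) ^ n := by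
  have hn3 : (3 : ℝ) ≤ n := by exact_mod_cast hn
  have h : 0 < 1 + ‖x‖ ^ 2 := by positivity
  have h2 : (n : ℝ) - 2 ≠ 0 := by linarith
  rw [bubble]
  generalize 1 + ‖x‖ ^ 2 = v at h
  rw [abs_of_pos (rpow_pos_of_pos h _), ← rpow_mul h.le, one_div, ← rpow_natCast,
    ← rpow_neg h.le]
  congr 1
  field_simp

theorem norm_fderiv_bubble_sq {n : ℕ} (x : EuclideanSpace ℝ (Fin n)) :
    ‖fderiv ℝ bubble x‖ ^ 2 = ((n : ℝ) - 2) ^ 2 * (‖x‖ ^ 2 / (1 + ‖x‖ ^ 2) ^ n) := by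
  have h : 0 < 1 + ‖x‖ ^ 2 := by positivity
  have h1 := (((hasStrictFDerivAt_norm_sq x).hasFDerivAt.const_add 1).rpow_const
    (p := -(((n : ℝ) - 2) / 2)) (Or.inl h.ne')).fderiv
  have h2 : fderiv ℝ bubble x = _ := h1
  have h3 : ((1 + ‖x‖ ^ 2) ^ (-(((n : ℝ) - 2) / 2) - 1)) ^ 2 = 1 / (1 + ‖x‖ ^ 2) ^ n := by
    generalize 1 + ‖x‖ ^ 2 = v at h
    rw [← rpow_natCast, ← rpow_mul h.le, one_div, ← rpow_natCast, ← rpow_neg h.le]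
    congr 1
    push_cast; ring
  have h4 : ‖(2 : ℕ) • innerSL ℝ x‖ = 2 * ‖x‖ := by
    rw [← Nat.cast_smul_eq_nsmul ℝ, norm_smul, innerSL_apply_norm]; simp
  rw [h2, norm_smul, mul_pow, h4, norm_mul, mul_pow, Real.norm_eq_abs, Real.norm_eq_abs, sq_abs,
    sq_abs, h3]
  ring

open Filter Topology in
/-- Smooth compactly supported functions come arbitrarily close to equality in the sharp Sobolev
inequality. -/
theorem exists_almost_extremal {n : ℕ} (hn : 3 ≤ n) {C : ℝ} (hC : sobolevConst n < C) :
    ∃ ψ : EuclideanSpace ℝ (Fin n) → ℝ, ContDiff ℝ (⊤ : ℕ∞) ψ ∧ HasCompactSupport ψ ∧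
      ∫ x, ‖fderiv ℝ ψ x‖ ^ 2 <
        C * (∫ x, |ψ x| ^ (2 * (n : ℝ) / ((n : ℝ) - 2))) ^ (((n : ℝ) - 2) / n) := by
  have hn3 : (3 : ℝ) ≤ n := by exact_mod_cast hn
  have hn2 : (0 : ℝ) < n - 2 := by linarith
  have hI := bubbleMass_pos hn
  let χ : ContDiffBump (0 : EuclideanSpace ℝ (Fin n)) := ⟨1, 2, one_pos, one_lt_two⟩
  have hχc : ContDiff ℝ (⊤ : ℕ∞) χ := χ.contDiff
  have hdc : Continuous (fderiv ℝ χ) := hχc.continuous_fderiv (by simp)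
  obtain ⟨A, hA⟩ := (χ.hasCompactSupport.fderiv ℝ).exists_bound_of_continuous hdc
  have hA0 : 0 ≤ A := (norm_nonneg _).trans (hA 0)
  have hin : ∀ y : EuclideanSpace ℝ (Fin n), ‖y‖ < 1 → χ y = 1 ∧ fderiv ℝ χ y = 0 := fun y hy => by
    have : y ∈ Metric.ball (0 : EuclideanSpace ℝ (Fin n)) χ.rIn := by simpa using hy
    have h := χ.eventuallyEq_one_of_mem_ball this
    exact ⟨h.eq_of_nhds, by rw [h.fderiv_eq]; exact fderiv_const_apply 1⟩
  have hout : ∀ y : EuclideanSpace ℝ (Fin n), 2 < ‖y‖ → fderiv ℝ χ y = 0 := fun y hy => by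
    have : y ∉ tsupport χ := by
      rw [χ.tsupport_eq]; simpa [χ] using hy
    by_contra h
    exact this (support_fderiv_subset ℝ h)
  let r : ℕ → ℝ := fun j => 1 / ((j : ℝ) + 1)
  have hr0 : ∀ j, 0 < r j := fun j => by positivity
  have hr1 : ∀ j, r j ≤ 1 := fun j => by
    simp only [r]; rw [div_le_one (by positivity)]; linarith [(Nat.cast_nonneg j : (0 : ℝ) ≤ j)]
  have hrt : Tendsto r atTop (𝓝 0) := tendsto_one_div_add_atTop_nhds_zero_nat
  let ψ : ℕ → EuclideanSpace ℝ (Fin n) → ℝ := fun j x => bubble x * χ (r j • x)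
  have hψc : ∀ j, ContDiff ℝ (⊤ : ℕ∞) (ψ j) := fun j =>
    contDiff_bubble.mul (hχc.comp (contDiff_const_smul _))
  have hψs : ∀ j, HasCompactSupport (ψ j) := fun j =>
    (χ.hasCompactSupport.comp_smul (hr0 j).ne').mul_left
  have hψd : ∀ j x, fderiv ℝ (ψ j) x =
      bubble x • (r j • fderiv ℝ χ (r j • x)) + χ (r j • x) • fderiv ℝ bubble x := fun j x => by
    have h1 : HasFDerivAt bubble (fderiv ℝ bubble x) x :=
      ((contDiff_bubble (m := 1)).differentiable one_ne_zero x).hasFDerivAt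
    have h2 : HasFDerivAt χ (fderiv ℝ χ (r j • x)) (r j • x) :=
      (hχc.differentiable (by simp) _).hasFDerivAt
    have h3 : HasFDerivAt (fun x : EuclideanSpace ℝ (Fin n) => χ (r j • x))
        (r j • fderiv ℝ χ (r j • x)) x := by
      refine (h2.comp x ((hasFDerivAt_id x).const_smul (r j))).congr_fderiv ?_
      ext; simp
    exact (h1.mul h3).fderiv
  have hev : ∀ x : EuclideanSpace ℝ (Fin n), ∀ᶠ j in atTop, ‖r j • x‖ < 1 := fun x => by
    have : Tendsto (fun j => ‖r j • x‖) atTop (𝓝 0) := by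
      simpa using (hrt.smul_const x).norm
    exact this.eventually_lt_const one_pos
  have hlim1 : Tendsto (fun j => ∫ x, ‖fderiv ℝ (ψ j) x‖ ^ 2) atTop
      (𝓝 (∫ x : EuclideanSpace ℝ (Fin n), ‖fderiv ℝ bubble x‖ ^ 2)) := by
    refine tendsto_integral_of_dominated_convergence
      (fun x => (10 * A ^ 2 + 2 * ((n : ℝ) - 2) ^ 2) * (1 / (1 + ‖x‖ ^ 2) ^ (n - 1))) (fun j => ?_)
      ((integrable_inv_one_add_norm_sq_pow (by omega)).const_mul _) (fun j => ?_) ?_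
    · exact (((hψc j).continuous_fderiv (by simp)).norm.pow 2).aestronglyMeasurable
    · refine Eventually.of_forall fun x => ?_
      have hv : 0 < 1 + ‖x‖ ^ 2 := by positivity
      rw [Real.norm_of_nonneg (by positivity), hψd]
      obtain ⟨p, rfl⟩ : ∃ p, n = p + 2 := ⟨n - 2, by omega⟩
      have hb := bubble_sq hn x
      have hbd := norm_fderiv_bubble_sq x
      rw [show p + 2 - 1 = p + 1 by omega]
      rw [show p + 2 - 2 = p by omega] at hb
      have h1 : ‖bubble x • (r j • fderiv ℝ χ (r j • x))‖ ^ 2 ≤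
          5 * A ^ 2 * (1 / (1 + ‖x‖ ^ 2) ^ (p + 1)) := by
        by_cases hx : 2 < ‖r j • x‖
        · rw [hout _ hx]; simp; positivity
        · have hrx : r j ^ 2 * ‖x‖ ^ 2 ≤ 2 ^ 2 := by
            rw [not_lt, norm_smul, Real.norm_of_nonneg (hr0 j).le] at hx
            rw [← mul_pow]
            exact pow_le_pow_left₀ (mul_nonneg (hr0 j).le (norm_nonneg _)) hx 2
          have hr5 : r j ^ 2 ≤ 5 / (1 + ‖x‖ ^ 2) := by
            rw [le_div_iff₀ hv]
            nlinarith [pow_le_one₀ (n := 2) (hr0 j).le (hr1 j)]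
          have hA2 := pow_le_pow_left₀ (norm_nonneg _) (hA (r j • x)) 2
          rw [norm_smul, norm_smul, mul_pow, mul_pow, Real.norm_eq_abs, Real.norm_eq_abs, sq_abs,
            sq_abs, hb]
          calc _ ≤ 1 / (1 + ‖x‖ ^ 2) ^ p * (5 / (1 + ‖x‖ ^ 2) * A ^ 2) := by gcongr
            _ = _ := by rw [pow_succ]; field_simp; ring
      have h2 : ‖χ (r j • x) • fderiv ℝ bubble x‖ ^ 2 ≤
          (((p + 2 : ℕ) : ℝ) - 2) ^ 2 * (1 / (1 + ‖x‖ ^ 2) ^ (p + 1)) := by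
        rw [norm_smul, mul_pow, hbd, Real.norm_of_nonneg χ.nonneg]
        have h5 : ‖x‖ ^ 2 / (1 + ‖x‖ ^ 2) ^ (p + 2) ≤ 1 / (1 + ‖x‖ ^ 2) ^ (p + 1) := by
          rw [pow_succ _ (p + 1), div_le_div_iff₀ (by positivity) (by positivity)]
          nlinarith [pow_pos hv (p + 1)]
        calc _ ≤ 1 * ((((p + 2 : ℕ) : ℝ) - 2) ^ 2 * (1 / (1 + ‖x‖ ^ 2) ^ (p + 1))) := by
              gcongr
              exact pow_le_one₀ χ.nonneg χ.le_one
          _ = _ := one_mul _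
      have h3 := pow_le_pow_left₀ (norm_nonneg _) (norm_add_le
        (bubble x • (r j • fderiv ℝ χ (r j • x))) (χ (r j • x) • fderiv ℝ bubble x)) 2
      have h4 := sq_nonneg (‖bubble x • (r j • fderiv ℝ χ (r j • x))‖ -
        ‖χ (r j • x) • fderiv ℝ bubble x‖)
      nlinarith
    · refine Eventually.of_forall fun x => tendsto_const_nhds.congr' ?_
      filter_upwards [hev x] with j hj
      rw [hψd, (hin _ hj).1, (hin _ hj).2]
      simp
  have hlim2 : Tendsto (fun j => ∫ x, |ψ j x| ^ (2 * (n : ℝ) / ((n : ℝ) - 2))) atTop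
      (𝓝 (bubbleMass n)) := by
    rw [← integral_inv_one_add_norm_sq_pow]
    refine tendsto_integral_of_dominated_convergence (fun x => 1 / (1 + ‖x‖ ^ 2) ^ n)
      (fun j => ?_) (integrable_inv_one_add_norm_sq_pow (by omega)) (fun j => ?_) ?_
    · exact ((hψc j).continuous.abs.rpow_const fun x =>
        Or.inr (by positivity)).aestronglyMeasurable
    · refine Eventually.of_forall fun x => ?_
      rw [Real.norm_of_nonneg (by positivity), ← abs_bubble_rpow hn]
      refine rpow_le_rpow (abs_nonneg _) ?_ (by positivity)
      rw [abs_mul, abs_of_nonneg (χ.nonneg (x := r j • x))]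
      exact mul_le_of_le_one_right (abs_nonneg _) χ.le_one
    · refine Eventually.of_forall fun x => tendsto_const_nhds.congr' ?_
      filter_upwards [hev x] with j hj
      simp only [ψ]
      rw [(hin _ hj).1, mul_one, abs_bubble_rpow hn]
  have hB : ∫ x : EuclideanSpace ℝ (Fin n), ‖fderiv ℝ bubble x‖ ^ 2 <
      C * bubbleMass n ^ (((n : ℝ) - 2) / n) := by
    simp only [norm_fderiv_bubble_sq]
    rw [integral_const_mul, integral_norm_sq_div_one_add_norm_sq_pow hn]
    have h1 := mul_lt_mul_of_pos_right hC (rpow_pos_of_pos hI (((n : ℝ) - 2) / n))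
    refine lt_of_eq_of_lt ?_ h1
    rw [sobolevConst_eq hn, mul_assoc _ (bubbleMass n ^ _), ← rpow_add hI, ← add_div,
      add_sub_cancel, div_self (by positivity), rpow_one]
    field_simp
  have hlim3 : Tendsto (fun j => C * (∫ x, |ψ j x| ^ (2 * (n : ℝ) / ((n : ℝ) - 2))) ^
      (((n : ℝ) - 2) / n)) atTop (𝓝 (C * bubbleMass n ^ (((n : ℝ) - 2) / n))) :=
    (hlim2.rpow_const (Or.inl hI.ne')).const_mul C
  obtain ⟨j, hj⟩ := (hlim1.eventually_lt hlim3 hB).exists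
  exact ⟨ψ j, hψc j, hψs j, hj⟩

/-- The iterated logarithms `X_1(a,s), …, X_{k+1}(a,s)` are well defined for `s ∈ (0,1]`. -/
def IterLogDefined (a : ℝ) (k : ℕ) : Prop :=
  ∀ s ∈ Set.Ioc (0 : ℝ) 1, ∀ i ≤ k, 0 < a - log (Xiter a i s)

theorem iterLogDefined_of_pos {a : ℝ} {k : ℕ} (ha0 : 0 < a)
    (hdef : ∀ s ∈ Set.Ioc (0 : ℝ) 1, ∀ i, 1 ≤ i → i ≤ k → 0 < a - Real.log (Xiter a i s)) :
    IterLogDefined a k := by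
  intro s hs i hi
  rcases Nat.eq_zero_or_pos i with rfl | hi0
  · have := log_nonpos hs.1.le hs.2
    simp only [Xiter]
    linarith
  · exact hdef s hs i hi0 hi

/-- The product `X_1(a,s) ⋯ X_i(a,s)`. -/
noncomputable def Xprod (a : ℝ) (i : ℕ) (s : ℝ) : ℝ := ∏ j ∈ Finset.Icc 1 i, Xiter a j s

theorem Xprod_zero (a s : ℝ) : Xprod a 0 s = 1 := by simp [Xprod]

theorem Xprod_succ (a : ℝ) (i : ℕ) (s : ℝ) :
    Xprod a (i + 1) s = Xprod a i s * Xiter a (i + 1) s :=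
  Finset.prod_Icc_succ_top (by omega) _

/-- The sum `∑_{i ≤ k} X_1(a,s) ⋯ X_i(a,s)`. -/
noncomputable def Xsum (a : ℝ) (k : ℕ) (s : ℝ) : ℝ := ∑ i ∈ Finset.Icc 1 k, Xprod a i s

theorem Xsum_succ (a : ℝ) (i : ℕ) (s : ℝ) :
    Xsum a (i + 1) s = Xsum a i s + Xprod a (i + 1) s :=
  Finset.sum_Icc_succ_top (by omega) _

namespace IterLogDefined

variable {a : ℝ} {k : ℕ}

theorem Xiter_pos (h : IterLogDefined a k) {s : ℝ} (hs : s ∈ Set.Ioc (0 : ℝ) 1) {i : ℕ}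
    (hi : i ≤ k + 1) : 0 < Xiter a i s := by
  cases i with
  | zero => exact hs.1
  | succ i => exact inv_pos.2 (h s hs i (by omega))

theorem Xprod_pos (h : IterLogDefined a k) {s : ℝ} (hs : s ∈ Set.Ioc (0 : ℝ) 1) {i : ℕ}
    (hi : i ≤ k + 1) : 0 < Xprod a i s :=
  Finset.prod_pos fun _ hj => h.Xiter_pos hs ((Finset.mem_Icc.1 hj).2.trans hi)

theorem Xiter_mono (h : IterLogDefined a k) {s s' : ℝ} (hs : 0 < s) (hss : s ≤ s') (hs' : s' ≤ 1)
    {i : ℕ} (hi : i ≤ k + 1) : Xiter a i s ≤ Xiter a i s' := by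
  induction i with
  | zero => exact hss
  | succ i ih =>
    have h1 := ih (by omega)
    have h2 := h.Xiter_pos ⟨hs, hss.trans hs'⟩ (i := i) (by omega)
    have h3 := h s' ⟨hs.trans_le hss, hs'⟩ i (by omega)
    exact inv_anti₀ h3 (sub_le_sub_left (log_le_log h2 h1) a)

theorem Xprod_mono (h : IterLogDefined a k) {s s' : ℝ} (hs : 0 < s) (hss : s ≤ s') (hs' : s' ≤ 1)
    {i : ℕ} (hi : i ≤ k + 1) : Xprod a i s ≤ Xprod a i s' :=
  Finset.prod_le_prod
    (fun _ hj => (h.Xiter_pos ⟨hs, hss.trans hs'⟩ ((Finset.mem_Icc.1 hj).2.trans hi)).le)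
    fun _ hj => h.Xiter_mono hs hss hs' ((Finset.mem_Icc.1 hj).2.trans hi)

theorem hasDerivAt_Xiter (h : IterLogDefined a k) {s : ℝ} (hs : s ∈ Set.Ioc (0 : ℝ) 1) {i : ℕ}
    (hi : i ≤ k + 1) : HasDerivAt (Xiter a i) (Xiter a i s * (Xprod a i s / s)) s := by
  induction i with
  | zero =>
    have : Xiter a 0 = id := rfl
    rw [Xprod_zero, this, id, mul_one_div_cancel hs.1.ne']
    exact hasDerivAt_id s
  | succ i ih =>
    have h2 := h.Xiter_pos hs (i := i) (by omega)
    have h3 := h s hs i (by omega)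
    have h4 := (((ih (by omega)).log h2.ne').const_sub a).inv h3.ne'
    have h5 : (a - log (Xiter a i s))⁻¹ = Xiter a (i + 1) s := rfl
    refine h4.congr_deriv ?_
    rw [Xprod_succ, ← h5]
    have := hs.1.ne'
    field_simp

theorem contDiffAt_Xiter (h : IterLogDefined a k) {s : ℝ} (hs : s ∈ Set.Ioc (0 : ℝ) 1) {i : ℕ}
    (hi : i ≤ k + 1) {m : WithTop ℕ∞} : ContDiffAt ℝ m (Xiter a i) s := by
  induction i with
  | zero => exact contDiffAt_id
  | succ i ih =>
    have h2 := h.Xiter_pos hs (i := i) (by omega)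
    have h3 := h s hs i (by omega)
    exact (contDiffAt_const.sub ((ih (by omega)).log h2.ne')).inv h3.ne'

theorem contDiffAt_Xprod (h : IterLogDefined a k) {s : ℝ} (hs : s ∈ Set.Ioc (0 : ℝ) 1) {i : ℕ}
    (hi : i ≤ k + 1) {m : WithTop ℕ∞} : ContDiffAt ℝ m (Xprod a i) s :=
  contDiffAt_prod fun _ hj => h.contDiffAt_Xiter hs ((Finset.mem_Icc.1 hj).2.trans hi)

theorem hasDerivAt_Xprod (h : IterLogDefined a k) {s : ℝ} (hs : s ∈ Set.Ioc (0 : ℝ) 1) {i : ℕ}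
    (hi : i ≤ k + 1) : HasDerivAt (Xprod a i) (Xprod a i s * (Xsum a i s / s)) s := by
  induction i with
  | zero =>
    have : Xprod a 0 = fun _ => 1 := funext (Xprod_zero a)
    rw [this]
    simpa [Xsum] using hasDerivAt_const s (1 : ℝ)
  | succ i ih =>
    have h4 := (ih (by omega)).mul (h.hasDerivAt_Xiter hs hi)
    have h5 : Xprod a (i + 1) = Xprod a i * Xiter a (i + 1) := funext (Xprod_succ a i)
    rw [← h5] at h4
    refine h4.congr_deriv ?_
    rw [Xsum_succ, Xprod_succ]
    ring

theorem contDiffAt_Xsum (h : IterLogDefined a k) {s : ℝ} (hs : s ∈ Set.Ioc (0 : ℝ) 1) {i : ℕ}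
    (hi : i ≤ k + 1) {m : WithTop ℕ∞} : ContDiffAt ℝ m (Xsum a i) s :=
  ContDiffAt.sum fun _ hj => h.contDiffAt_Xprod hs ((Finset.mem_Icc.1 hj).2.trans hi)

theorem hasDerivAt_Xsum (h : IterLogDefined a k) {s : ℝ} (hs : s ∈ Set.Ioc (0 : ℝ) 1) {i : ℕ}
    (hi : i ≤ k + 1) : HasDerivAt (Xsum a i)
      ((Xsum a i s ^ 2 + ∑ j ∈ Finset.Icc 1 i, Xprod a j s ^ 2) / (2 * s)) s := by
  induction i with
  | zero =>
    have : Xsum a 0 = fun _ => 0 := by ext; simp [Xsum]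
    rw [this]
    simpa using hasDerivAt_const s (0 : ℝ)
  | succ i ih =>
    have h4 := (ih (by omega)).add (h.hasDerivAt_Xprod hs hi)
    have h5 : Xsum a (i + 1) = Xsum a i + Xprod a (i + 1) := funext (Xsum_succ a i)
    rw [← h5] at h4
    refine h4.congr_deriv ?_
    rw [Finset.sum_Icc_succ_top (by omega), Xsum_succ]
    have := hs.1.ne'
    field_simp
    ring

end IterLogDefined

theorem measurable_Xiter (a : ℝ) (i : ℕ) : Measurable (Xiter a i) := by
  induction i with
  | zero => exact measurable_id
  | succ i ih => exact (measurable_const.sub ih.log).inv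

theorem measurable_Xprod (a : ℝ) (i : ℕ) : Measurable (Xprod a i) :=
  Finset.measurable_fun_prod _ fun j _ => measurable_Xiter a j

/-- The inverse of `Xiter a i`. -/
noncomputable def XiterInv (a : ℝ) : ℕ → ℝ → ℝ
  | 0, σ => σ
  | (i + 1), σ => XiterInv a i (exp (a - σ⁻¹))

theorem Xiter_XiterInv (a : ℝ) (i : ℕ) (σ : ℝ) : Xiter a i (XiterInv a i σ) = σ := by
  induction i generalizing σ with
  | zero => rfl
  | succ i ih => simp [Xiter, XiterInv, ih, X1]

theorem XiterInv_pos (a : ℝ) (i : ℕ) {σ : ℝ} (hσ : 0 < σ) : 0 < XiterInv a i σ := by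
  induction i generalizing σ with
  | zero => exact hσ
  | succ i ih => exact ih (exp_pos _)

theorem contDiffAt_XiterInv (a : ℝ) (i : ℕ) {σ : ℝ} (hσ : 0 < σ) {m : WithTop ℕ∞} :
    ContDiffAt ℝ m (XiterInv a i) σ := by
  induction i generalizing σ with
  | zero => exact contDiffAt_id
  | succ i ih =>
    exact (ih (exp_pos (a - σ⁻¹))).comp σ ((contDiffAt_const.sub (contDiffAt_inv ℝ hσ.ne')).exp)

namespace IterLogDefined

variable {a : ℝ} {k : ℕ}

theorem XiterInv_Xiter (h : IterLogDefined a k) {s : ℝ} (hs : s ∈ Set.Ioc (0 : ℝ) 1) {i : ℕ}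
    (hi : i ≤ k + 1) : XiterInv a i (Xiter a i s) = s := by
  induction i with
  | zero => rfl
  | succ i ih =>
    have h2 := h.Xiter_pos hs (i := i) (by omega)
    simp only [XiterInv, Xiter, X1, inv_inv, sub_sub_cancel, exp_log h2]
    exact ih (by omega)

theorem XiterInv_lt_one (h : IterLogDefined a k) {i : ℕ} (hi : i ≤ k + 1) {σ : ℝ} (hσ : 0 < σ)
    (hlt : σ < Xiter a i 1) : XiterInv a i σ < 1 := by
  induction i generalizing σ with
  | zero => exact hlt
  | succ i ih =>
    refine ih (by omega) (exp_pos _) ?_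
    have h1 : (1 : ℝ) ∈ Set.Ioc (0 : ℝ) 1 := by simp
    have h2 := h.Xiter_pos h1 (i := i) (by omega)
    rw [← lt_log_iff_exp_lt h2]
    have h3 := inv_strictAnti₀ hσ hlt
    simp only [Xiter, X1, inv_inv] at h3
    linarith

end IterLogDefined

section Radial

variable {E : Type*} [NormedAddCommGroup E] [InnerProductSpace ℝ E]

theorem hasFDerivAt_comp_norm {f : ℝ → ℝ} {f' : ℝ} {x : E} (hx : x ≠ 0)
    (hf : HasDerivAt f f' ‖x‖) :
    HasFDerivAt (fun y : E => f ‖y‖) ((f' / ‖x‖) • innerSL ℝ x) x := by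
  have hr : ‖x‖ ≠ 0 := norm_ne_zero_iff.2 hx
  have h1 : HasFDerivAt (fun y : E => ‖y‖) ((1 / ‖x‖) • innerSL ℝ x) x := by
    have h2 := (hasStrictFDerivAt_norm_sq x).hasFDerivAt.sqrt (pow_ne_zero 2 hr)
    simp only [sqrt_sq (norm_nonneg _)] at h2
    refine h2.congr_fderiv ?_
    ext y
    simp
    field_simp
  refine (hf.comp_hasFDerivAt x h1).congr_fderiv ?_
  rw [smul_smul, mul_one_div]

/-- The radial map `r ω ↦ t(r) ω`. -/
noncomputable def radialMap (t : ℝ → ℝ) (x : E) : E := (t ‖x‖ / ‖x‖) • x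

theorem norm_radialMap {t : ℝ → ℝ} {x : E} (hx : x ≠ 0) (ht : 0 < t ‖x‖) :
    ‖radialMap t x‖ = t ‖x‖ := by
  have hr : 0 < ‖x‖ := norm_pos_iff.2 hx
  rw [radialMap, norm_smul, norm_eq_abs, abs_of_pos (div_pos ht hr), div_mul_cancel₀ _ hr.ne']

theorem radialMap_radialMap {t ρ : ℝ → ℝ} {x : E} (hx : x ≠ 0) (ht : 0 < t ‖x‖)
    (hρ : ρ (t ‖x‖) = ‖x‖) : radialMap ρ (radialMap t x) = x := by
  have hr : 0 < ‖x‖ := norm_pos_iff.2 hx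
  rw [radialMap, norm_radialMap hx ht, hρ, radialMap, smul_smul,
    div_mul_div_cancel₀ ht.ne', div_self hr.ne', one_smul]

/-- The linear map `h ↦ θ h + κ ⟨x, h⟩ x`. -/
noncomputable def radialDeriv (θ κ : ℝ) (x : E) : E →L[ℝ] E :=
  θ • ContinuousLinearMap.id ℝ E + (κ • innerSL ℝ x).smulRight x

theorem radialDeriv_apply (θ κ : ℝ) (x y : E) :
    radialDeriv θ κ x y = θ • y + (κ * inner ℝ x y) • x := by
  simp [radialDeriv]

theorem hasFDerivAt_radialMap {t : ℝ → ℝ} {t' : ℝ} {x : E} (hx : x ≠ 0)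
    (ht : HasDerivAt t t' ‖x‖) :
    HasFDerivAt (radialMap t)
      (radialDeriv (t ‖x‖ / ‖x‖) ((t' - t ‖x‖ / ‖x‖) / ‖x‖ ^ 2) x) x := by
  have hr : ‖x‖ ≠ 0 := norm_ne_zero_iff.2 hx
  have h1 : HasDerivAt (fun r => t r / r) ((t' * ‖x‖ - t ‖x‖ * 1) / ‖x‖ ^ 2) ‖x‖ :=
    ht.div (hasDerivAt_id _) hr
  refine ((hasFDerivAt_comp_norm hx h1).smul (hasFDerivAt_id x)).congr_fderiv ?_
  ext y
  simp only [radialDeriv, id]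
  congr 3
  field_simp

theorem contDiffAt_radialMap {t : ℝ → ℝ} {x : E} (hx : x ≠ 0) {m : WithTop ℕ∞}
    (ht : ContDiffAt ℝ m t ‖x‖) : ContDiffAt ℝ m (radialMap t) x := by
  have hr : ‖x‖ ≠ 0 := norm_ne_zero_iff.2 hx
  have h := contDiffAt_norm (n := m) ℝ hx
  exact ((ht.comp x h).div h hr).smul contDiffAt_id

theorem det_radialDeriv [FiniteDimensional ℝ E] {θ κ : ℝ} (hθ : θ ≠ 0) {x : E} :
    (radialDeriv θ κ x).det =
      θ ^ Module.finrank ℝ E * (1 + κ * ‖x‖ ^ 2 / θ) := by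
  have h : (radialDeriv θ κ x : E →ₗ[ℝ] E) =
      θ • LinearMap.transvection ((κ / θ) • (innerSL ℝ x : E →ₗ[ℝ] ℝ)) x := by
    ext y
    simp [radialDeriv_apply, LinearMap.transvection.apply, smul_smul]
    field_simp
  rw [ContinuousLinearMap.det, h, LinearMap.det_smul, LinearMap.transvection.det]
  simp
  exact Or.inl (by field_simp)

theorem norm_sq_le_of_comp_radialDeriv [CompleteSpace E] {θ κ D W : ℝ} {x : E}
    (hx : x ≠ 0) (hθ : D ≤ W * θ ^ 2) (hT : D ≤ W * (θ + κ * ‖x‖ ^ 2) ^ 2) (L : E →L[ℝ] ℝ) :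
    D * ‖L‖ ^ 2 ≤ W * ‖L.comp (radialDeriv θ κ x)‖ ^ 2 := by
  obtain ⟨g, rfl⟩ := (InnerProductSpace.toDual ℝ E).surjective L
  have hr : 0 < ‖x‖ ^ 2 := pow_pos (norm_pos_iff.2 hx) 2
  have h1 : ((InnerProductSpace.toDual ℝ E) g).comp (radialDeriv θ κ x) =
      (InnerProductSpace.toDual ℝ E) (θ • g + (κ * inner ℝ x g) • x) := by
    ext y
    simp [radialDeriv_apply, inner_add_right, inner_smul_right, real_inner_comm x g]
    ring
  rw [h1]
  simp only [LinearIsometryEquiv.norm_map]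
  have h2 : ‖θ • g + (κ * inner ℝ x g) • x‖ ^ 2 =
      θ ^ 2 * ‖g‖ ^ 2 + (2 * θ * κ + κ ^ 2 * ‖x‖ ^ 2) * inner ℝ x g ^ 2 := by
    rw [norm_add_sq_real]
    simp [norm_smul, inner_smul_left, inner_smul_right, mul_pow, real_inner_comm x g]
    ring
  have h3 : (inner ℝ x g) ^ 2 ≤ ‖x‖ ^ 2 * ‖g‖ ^ 2 := by
    rw [← mul_pow]
    exact sq_le_sq.2 (by
      rw [abs_of_nonneg (by positivity : (0 : ℝ) ≤ ‖x‖ * ‖g‖)]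
      exact abs_real_inner_le_norm x g)
  obtain ⟨p, hp⟩ : ∃ p, p = (inner ℝ x g) ^ 2 / ‖x‖ ^ 2 := ⟨_, rfl⟩
  have hp' : (inner ℝ x g) ^ 2 = p * ‖x‖ ^ 2 := by rw [hp, div_mul_cancel₀ _ hr.ne']
  have hp0 : 0 ≤ p := hp ▸ by positivity
  have hp1 : 0 ≤ ‖g‖ ^ 2 - p := by
    rw [hp', mul_comm] at h3
    linarith [le_of_mul_le_mul_left h3 hr]
  rw [h2, hp']
  nlinarith [mul_le_mul_of_nonneg_right hθ hp1, mul_le_mul_of_nonneg_right hT hp0]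

end Radial

theorem contDiff_of_forall_mem_contDiffAt {E : Type*} [NormedAddCommGroup E] [NormedSpace ℝ E]
    {f : E → ℝ} {K : Set E} {m : WithTop ℕ∞} (hK : IsClosed K) (h : ∀ x ∈ K, ContDiffAt ℝ m f x)
    (h0 : ∀ x ∉ K, f x = 0) : ContDiff ℝ m f := by
  rw [contDiff_iff_contDiffAt]
  intro x
  by_cases hx : x ∈ K
  · exact h x hx
  · refine contDiffAt_const (c := (0 : ℝ)).congr_of_eventuallyEq ?_
    filter_upwards [hK.isOpen_compl.mem_nhds hx] with y hy using h0 y hy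

/-- The punctured open unit ball. -/
def puncturedBall (E : Type*) [NormedAddCommGroup E] : Set E := Metric.ball 0 1 \ {0}

section

variable {E : Type*} [NormedAddCommGroup E]

theorem mem_puncturedBall {x : E} : x ∈ puncturedBall E ↔ ‖x‖ ∈ Set.Ioo (0 : ℝ) 1 := by
  simp [puncturedBall, and_comm]

theorem isOpen_puncturedBall : IsOpen (puncturedBall E) :=
  Metric.isOpen_ball.sdiff isClosed_singleton

end

/-- Bijections of `(0,1)` that are inverse to each other, with positive derivative. -/
structure IsRadialChange (t ρ t' : ℝ → ℝ) : Prop where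
  mapsTo : ∀ r ∈ Set.Ioo (0 : ℝ) 1, t r ∈ Set.Ioo (0 : ℝ) 1
  mapsTo_inv : ∀ r ∈ Set.Ioo (0 : ℝ) 1, ρ r ∈ Set.Ioo (0 : ℝ) 1
  left_inv : ∀ r ∈ Set.Ioo (0 : ℝ) 1, ρ (t r) = r
  right_inv : ∀ r ∈ Set.Ioo (0 : ℝ) 1, t (ρ r) = r
  hasDerivAt : ∀ r ∈ Set.Ioo (0 : ℝ) 1, HasDerivAt t (t' r) r
  deriv_pos : ∀ r ∈ Set.Ioo (0 : ℝ) 1, 0 < t' r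
  contDiffAt_inv : ∀ r ∈ Set.Ioo (0 : ℝ) 1, ContDiffAt ℝ 1 ρ r

namespace IsRadialChange

variable {E : Type*} [NormedAddCommGroup E] [InnerProductSpace ℝ E]
variable {t ρ t' : ℝ → ℝ}

theorem radialMap_mem (h : IsRadialChange t ρ t') {x : E} (hx : x ∈ puncturedBall E) :
    radialMap t x ∈ puncturedBall E := by
  have hr := mem_puncturedBall.1 hx
  rw [mem_puncturedBall, norm_radialMap hx.2 (h.mapsTo _ hr).1]
  exact h.mapsTo _ hr

theorem radialMap_inv_mem (h : IsRadialChange t ρ t') {x : E} (hx : x ∈ puncturedBall E) :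
    radialMap ρ x ∈ puncturedBall E := by
  have hr := mem_puncturedBall.1 hx
  rw [mem_puncturedBall, norm_radialMap hx.2 (h.mapsTo_inv _ hr).1]
  exact h.mapsTo_inv _ hr

theorem radialMap_left_inv (h : IsRadialChange t ρ t') {x : E} (hx : x ∈ puncturedBall E) :
    radialMap ρ (radialMap t x) = x :=
  radialMap_radialMap hx.2 (h.mapsTo _ (mem_puncturedBall.1 hx)).1
    (h.left_inv _ (mem_puncturedBall.1 hx))

theorem radialMap_right_inv (h : IsRadialChange t ρ t') {x : E} (hx : x ∈ puncturedBall E) :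
    radialMap t (radialMap ρ x) = x :=
  radialMap_radialMap hx.2 (h.mapsTo_inv _ (mem_puncturedBall.1 hx)).1
    (h.right_inv _ (mem_puncturedBall.1 hx))

theorem image_radialMap (h : IsRadialChange t ρ t') :
    radialMap t '' puncturedBall E = puncturedBall E := by
  ext y
  constructor
  · rintro ⟨x, hx, rfl⟩
    exact h.radialMap_mem hx
  · exact fun hy => ⟨radialMap ρ y, h.radialMap_inv_mem hy, h.radialMap_right_inv hy⟩

theorem injOn_radialMap (h : IsRadialChange t ρ t') :
    Set.InjOn (radialMap t) (puncturedBall E) := fun x hx y hy hxy => by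
  rw [← h.radialMap_left_inv hx, hxy, h.radialMap_left_inv hy]

theorem hasFDerivAt (h : IsRadialChange t ρ t') {x : E} (hx : x ∈ puncturedBall E) :
    HasFDerivAt (radialMap t)
      (radialDeriv (t ‖x‖ / ‖x‖) ((t' ‖x‖ - t ‖x‖ / ‖x‖) / ‖x‖ ^ 2) x) x :=
  hasFDerivAt_radialMap hx.2 (h.hasDerivAt _ (mem_puncturedBall.1 hx))

theorem abs_det_radialDeriv [FiniteDimensional ℝ E] (h : IsRadialChange t ρ t')
    {d : ℕ} (hd : Module.finrank ℝ E = d + 1) {x : E} (hx : x ∈ puncturedBall E) :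
    |(radialDeriv (t ‖x‖ / ‖x‖) ((t' ‖x‖ - t ‖x‖ / ‖x‖) / ‖x‖ ^ 2) x).det| =
      (t ‖x‖ / ‖x‖) ^ d * t' ‖x‖ := by
  have hr := mem_puncturedBall.1 hx
  have hr0 := hr.1
  have ht0 := (h.mapsTo _ hr).1
  have ht1 := h.deriv_pos _ hr
  have h1 : 1 + (t' ‖x‖ - t ‖x‖ / ‖x‖) / ‖x‖ ^ 2 * ‖x‖ ^ 2 / (t ‖x‖ / ‖x‖) =
      t' ‖x‖ / (t ‖x‖ / ‖x‖) := by
    field_simp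
    ring
  rw [det_radialDeriv (div_pos ht0 hr0).ne', hd, h1, pow_succ, mul_assoc,
    mul_div_cancel₀ _ (div_pos ht0 hr0).ne', abs_of_pos (by positivity)]

/-- A change of variables by a radial diffeomorphism of the punctured unit ball. -/
theorem integral_radialMap [FiniteDimensional ℝ E] [MeasurableSpace E] [BorelSpace E]
    (μ : Measure E) [μ.IsAddHaarMeasure] (h : IsRadialChange t ρ t')
    {d : ℕ} (hd : Module.finrank ℝ E = d + 1) (g : E → ℝ) :
    ∫ y in puncturedBall E, g y ∂μ = ∫ x in puncturedBall E,
      ((t ‖x‖ / ‖x‖) ^ d * t' ‖x‖) * g (radialMap t x) ∂μ := by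
  have hm : MeasurableSet (puncturedBall E) := isOpen_puncturedBall.measurableSet
  nth_rewrite 1 [← h.image_radialMap]
  rw [integral_image_eq_integral_abs_det_fderiv_smul μ hm
    (fun x hx => (h.hasFDerivAt hx).hasFDerivWithinAt) h.injOn_radialMap]
  exact setIntegral_congr_fun hm fun x hx => by
    simp only [h.abs_det_radialDeriv hd hx, smul_eq_mul]

theorem integrableOn_radialMap [FiniteDimensional ℝ E] [MeasurableSpace E] [BorelSpace E]
    (μ : Measure E) [μ.IsAddHaarMeasure] (h : IsRadialChange t ρ t')
    {d : ℕ} (hd : Module.finrank ℝ E = d + 1) {g : E → ℝ}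
    (hg : IntegrableOn g (puncturedBall E) μ) :
    IntegrableOn (fun x => ((t ‖x‖ / ‖x‖) ^ d * t' ‖x‖) * g (radialMap t x))
      (puncturedBall E) μ := by
  have hm : MeasurableSet (puncturedBall E) := isOpen_puncturedBall.measurableSet
  rw [← h.image_radialMap, integrableOn_image_iff_integrableOn_abs_det_fderiv_smul μ hm
    (fun x hx => (h.hasFDerivAt hx).hasFDerivWithinAt) h.injOn_radialMap] at hg
  exact hg.congr_fun (fun x hx => by simp only [h.abs_det_radialDeriv hd hx, smul_eq_mul]) hm

/-- Transplantation of a function along a radial diffeomorphism of the punctured unit ball. -/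
theorem exists_transplant [FiniteDimensional ℝ E] [MeasurableSpace E] [BorelSpace E]
    (μ : Measure E) [μ.IsAddHaarMeasure] (h : IsRadialChange t ρ t')
    {d : ℕ} (hd : Module.finrank ℝ E = d + 1) {v : E → ℝ} (hv : ContDiff ℝ 1 v)
    (hvc : HasCompactSupport v) (hvs : tsupport v ⊆ puncturedBall E) :
    ∃ z : E → ℝ, ContDiff ℝ 1 z ∧ HasCompactSupport z ∧
      (∀ p : ℝ, 0 < p →
        IntegrableOn (fun x => ((t ‖x‖ / ‖x‖) ^ d * t' ‖x‖) * |v x| ^ p) (puncturedBall E) μ ∧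
        ∫ y, |z y| ^ p ∂μ =
          ∫ x in puncturedBall E, ((t ‖x‖ / ‖x‖) ^ d * t' ‖x‖) * |v x| ^ p ∂μ) ∧
      ∀ W : ℝ → ℝ, (∀ r ∈ Set.Ioo (0 : ℝ) 1, (t r / r) ^ d * t' r ≤ W r * (t r / r) ^ 2) →
        (∀ r ∈ Set.Ioo (0 : ℝ) 1, (t r / r) ^ d * t' r ≤ W r * t' r ^ 2) →
        IntegrableOn (fun x => W ‖x‖ * ‖fderiv ℝ v x‖ ^ 2) (puncturedBall E) μ →
        ∫ y, ‖fderiv ℝ z y‖ ^ 2 ∂μ ≤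
          ∫ x in puncturedBall E, W ‖x‖ * ‖fderiv ℝ v x‖ ^ 2 ∂μ := by
  classical
  have hm : MeasurableSet (puncturedBall E) := isOpen_puncturedBall.measurableSet
  set K : Set E := radialMap t '' tsupport v with hKdef
  have hK : IsCompact K := hvc.isCompact.image_of_continuousOn
    fun x hx => (h.hasFDerivAt (hvs hx)).continuousAt.continuousWithinAt
  have hKU : K ⊆ puncturedBall E := by
    rintro _ ⟨x, hx, rfl⟩
    exact h.radialMap_mem (hvs hx)
  set z : E → ℝ := (puncturedBall E).indicator fun y => v (radialMap ρ y) with hz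
  have hzK : ∀ y ∉ K, z y = 0 := by
    intro y hy
    by_cases hyU : y ∈ puncturedBall E
    · rw [hz, Set.indicator_of_mem hyU]
      refine image_eq_zero_of_notMem_tsupport fun hc => hy ⟨_, hc, h.radialMap_right_inv hyU⟩
    · exact Set.indicator_of_notMem hyU _
  have hzU : ∀ y ∈ puncturedBall E, z =ᶠ[nhds y] fun y => v (radialMap ρ y) := fun y hy => by
    filter_upwards [isOpen_puncturedBall.mem_nhds hy] with y' hy'
    exact Set.indicator_of_mem hy' _
  have hz1 : ContDiff ℝ 1 z := by
    refine contDiff_of_forall_mem_contDiffAt hK.isClosed (fun y hy => ?_) hzK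
    have hyU := hKU hy
    refine ContDiffAt.congr_of_eventuallyEq ?_ (hzU y hyU)
    exact hv.contDiffAt.comp y (contDiffAt_radialMap hyU.2
      (h.contDiffAt_inv _ (mem_puncturedBall.1 hyU)))
  have hzt : ∀ x ∈ puncturedBall E, z (radialMap t x) = v x := fun x hx => by
    rw [hz, Set.indicator_of_mem (h.radialMap_mem hx), h.radialMap_left_inv hx]
  have hsupp : tsupport z ⊆ K :=
    closure_minimal (fun y hy => by_contra fun hc => hy (hzK y hc)) hK.isClosed
  have hzc : HasCompactSupport z := HasCompactSupport.intro hK hzK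
  refine ⟨z, hz1, hzc, fun p hp => ?_, fun W hW1 hW2 hWi => ?_⟩
  · have hzi : Integrable (fun y => |z y| ^ p) μ := by
      refine (hz1.continuous.abs.rpow_const fun _ => Or.inr hp.le).integrable_of_hasCompactSupport
        (hzc.mono fun y hy hc => hy ?_)
      simp only [hc, abs_zero, zero_rpow hp.ne']
    refine ⟨(h.integrableOn_radialMap μ hd hzi.integrableOn).congr_fun
      (fun x hx => by simp only [hzt x hx]) hm, ?_⟩
    rw [← setIntegral_eq_integral_of_forall_compl_eq_zero (s := puncturedBall E)
      (fun y hy => by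
        rw [hzK y fun hc => hy (hKU hc), abs_zero, zero_rpow hp.ne']),
      h.integral_radialMap μ hd]
    exact setIntegral_congr_fun hm fun x hx => by simp only [hzt x hx]
  · rw [← setIntegral_eq_integral_of_forall_compl_eq_zero (s := puncturedBall E)
      (fun y hy => by
        rw [image_eq_zero_of_notMem_tsupport (f := fderiv ℝ z)
          fun hc => hy (hKU (hsupp (tsupport_fderiv_subset ℝ hc)))]
        simp),
      h.integral_radialMap μ hd]
    refine integral_mono_of_nonneg ?_ hWi ?_
    · filter_upwards [ae_restrict_mem hm] with x hx
      have hr := mem_puncturedBall.1 hx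
      have := h.deriv_pos _ hr
      have := (h.mapsTo _ hr).1
      have := hr.1
      simp only [Pi.zero_apply]
      positivity
    · filter_upwards [ae_restrict_mem hm] with x hx
      have hr := mem_puncturedBall.1 hx
      have hr0 := hr.1
      have hfd : fderiv ℝ v x = (fderiv ℝ z (radialMap t x)).comp
          (radialDeriv (t ‖x‖ / ‖x‖) ((t' ‖x‖ - t ‖x‖ / ‖x‖) / ‖x‖ ^ 2) x) := by
        have h1 := (hz1.differentiable one_ne_zero (radialMap t x)).hasFDerivAt.comp x (h.hasFDerivAt hx)
        have h2 : v =ᶠ[nhds x] z ∘ radialMap t := by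
          filter_upwards [isOpen_puncturedBall.mem_nhds hx] with x' hx' using (hzt x' hx').symm
        exact (h1.congr_of_eventuallyEq h2).fderiv
      rw [hfd]
      refine norm_sq_le_of_comp_radialDeriv hx.2 (hW1 _ hr) ?_ _
      convert hW2 _ hr using 3
      field_simp
      ring

end IsRadialChange

theorem norm_sub_smul_innerSL_sq {E : Type*} [NormedAddCommGroup E] [InnerProductSpace ℝ E]
    [CompleteSpace E] (L : E →L[ℝ] ℝ) (c : ℝ) (x : E) :
    ‖L - c • innerSL ℝ x‖ ^ 2 = ‖L‖ ^ 2 - 2 * c * L x + c ^ 2 * ‖x‖ ^ 2 := by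
  obtain ⟨g, rfl⟩ := (InnerProductSpace.toDual ℝ E).surjective L
  have h1 : (InnerProductSpace.toDual ℝ E) g - c • innerSL ℝ x =
      (InnerProductSpace.toDual ℝ E) (g - c • x) := by
    ext y
    simp
  rw [h1]
  simp only [LinearIsometryEquiv.norm_map, InnerProductSpace.toDual_apply_apply]
  rw [norm_sub_sq_real, norm_smul, mul_pow, norm_eq_abs, sq_abs, inner_smul_right]
  ring

theorem continuous_of_forall_mem_continuousAt {E : Type*} [NormedAddCommGroup E] {f : E → ℝ}
    {K : Set E} (hK : IsClosed K) (h : ∀ x ∈ K, ContinuousAt f x) (h0 : ∀ x ∉ K, f x = 0) :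
    Continuous f := by
  rw [continuous_iff_continuousAt]
  intro x
  by_cases hx : x ∈ K
  · exact h x hx
  · refine (continuousAt_const (y := (0 : ℝ))).congr ?_
    filter_upwards [hK.isOpen_compl.mem_nhds hx] with y hy using (h0 y hy).symm

section

variable {n : ℕ}

theorem integrable_fderiv_self {g : EuclideanSpace ℝ (Fin n) → ℝ} (hg : ContDiff ℝ 1 g)
    (hc : HasCompactSupport g) : Integrable fun x => fderiv ℝ g x x :=
  ((hg.continuous_fderiv one_ne_zero).clm_apply continuous_id).integrable_of_hasCompactSupport
    ((hc.fderiv ℝ).mono fun x hx hc => hx (by simp [hc]))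

/-- The divergence of the compactly supported field `x ↦ g(x) x` integrates to zero. -/
theorem integral_fderiv_self {g : EuclideanSpace ℝ (Fin n) → ℝ} (hg : ContDiff ℝ 1 g)
    (hc : HasCompactSupport g) : ∫ x, (fderiv ℝ g x x + n * g x) = 0 := by
  have hgi : Integrable g := hg.continuous.integrable_of_hasCompactSupport hc
  have hd : ∀ i : Fin n, Continuous fun x => fderiv ℝ g x (EuclideanSpace.single i 1) := fun i =>
    (hg.continuous_fderiv one_ne_zero).clm_apply continuous_const
  have hi : ∀ i : Fin n, Integrable fun x : EuclideanSpace ℝ (Fin n) =>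
      fderiv ℝ g x (EuclideanSpace.single i 1) * x i := fun i =>
    ((hd i).mul (EuclideanSpace.proj (𝕜 := ℝ) i).continuous).integrable_of_hasCompactSupport
      ((hc.fderiv_apply ℝ _).mul_right)
  have h1 : ∀ i : Fin n, ∫ x, fderiv ℝ g x (EuclideanSpace.single i 1) * x i = -∫ x, g x := by
    intro i
    have hp : ∀ x : EuclideanSpace ℝ (Fin n), fderiv ℝ (fun x : EuclideanSpace ℝ (Fin n) => x i) x
        (EuclideanSpace.single i 1) = 1 := fun x => by
      have h2 : fderiv ℝ (fun x : EuclideanSpace ℝ (Fin n) => x i) x = EuclideanSpace.proj i :=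
        (EuclideanSpace.proj (𝕜 := ℝ) i).hasFDerivAt.fderiv
      simp [h2]
    have h2 := integral_mul_fderiv_eq_neg_fderiv_mul_of_integrable (𝕜 := ℝ) (μ := volume)
      (f := g) (g := fun x : EuclideanSpace ℝ (Fin n) => x i) (v := EuclideanSpace.single i 1)
      (hi i) (by simpa only [hp, mul_one] using hgi)
      ((hg.continuous.mul
        (EuclideanSpace.proj (𝕜 := ℝ) i).continuous).integrable_of_hasCompactSupport hc.mul_right)
      (fun x _ => hg.differentiable one_ne_zero x)
      (fun x _ => (EuclideanSpace.proj (𝕜 := ℝ) i).differentiableAt)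
    simp only [hp, mul_one] at h2
    rw [h2, neg_neg]
  have h2 : ∀ x : EuclideanSpace ℝ (Fin n), fderiv ℝ g x x =
      ∑ i, fderiv ℝ g x (EuclideanSpace.single i 1) * x i := by
    intro x
    have h3 := congrArg (fderiv ℝ g x) ((EuclideanSpace.basisFun (Fin n) ℝ).sum_repr x).symm
    simpa [map_sum, mul_comm] using h3
  rw [integral_add (integrable_fderiv_self hg hc) (hgi.const_mul _), integral_const_mul]
  simp only [h2]
  rw [integral_finsetSum _ fun i _ => hi i]
  simp [h1]

/-- The ground state representation of a Hardy type functional with potential `V(|x|)/|x|²`. -/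
theorem ground_state_representation {w m V : ℝ → ℝ}
    (hw : ∀ r ∈ Set.Ioo (0 : ℝ) 1, 0 < w r)
    (hwd : ∀ r ∈ Set.Ioo (0 : ℝ) 1, HasDerivAt w (w r * (m r / r)) r)
    (hmd : ∀ r ∈ Set.Ioo (0 : ℝ) 1,
      HasDerivAt m (-(V r + m r ^ 2 + ((n : ℝ) - 2) * m r) / r) r)
    (hmc : ∀ r ∈ Set.Ioo (0 : ℝ) 1, ContDiffAt ℝ 1 m r)
    (hVc : ∀ r ∈ Set.Ioo (0 : ℝ) 1, ContinuousAt V r)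
    {u : EuclideanSpace ℝ (Fin n) → ℝ} (hu : ContDiff ℝ 1 u) (huc : HasCompactSupport u)
    (hus : tsupport u ⊆ puncturedBall _) :
    IntegrableOn (fun x => w ‖x‖ ^ 2 * ‖fderiv ℝ (fun y => u y / w ‖y‖) x‖ ^ 2) (puncturedBall _) ∧
    ∫ x in puncturedBall _, w ‖x‖ ^ 2 * ‖fderiv ℝ (fun y => u y / w ‖y‖) x‖ ^ 2 =
      (∫ x, ‖fderiv ℝ u x‖ ^ 2) - ∫ x, V ‖x‖ / ‖x‖ ^ 2 * u x ^ 2 := by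
  have hm : MeasurableSet (puncturedBall (EuclideanSpace ℝ (Fin n))) :=
    isOpen_puncturedBall.measurableSet
  have hclosed := isClosed_tsupport u
  have hu0 : ∀ x ∉ tsupport u, u x = 0 := fun x => image_eq_zero_of_notMem_tsupport
  set g : EuclideanSpace ℝ (Fin n) → ℝ := fun x => m ‖x‖ / ‖x‖ ^ 2 * u x ^ 2 with hgdef
  have hg0 : ∀ x ∉ tsupport u, g x = 0 := fun x hx => by simp [hgdef, hu0 x hx]
  have hg : ContDiff ℝ 1 g := by
    refine contDiff_of_forall_mem_contDiffAt hclosed (fun x hx => ?_) hg0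
    have hxU := hus hx
    have hr := mem_puncturedBall.1 hxU
    have hn := contDiffAt_norm (n := 1) ℝ hxU.2
    exact (((hmc _ hr).comp x hn).div (hn.pow 2) (pow_ne_zero 2 hr.1.ne')).mul
      (hu.contDiffAt.pow 2)
  have hgc : HasCompactSupport g := HasCompactSupport.intro huc.isCompact hg0
  have hVi : Integrable fun x => V ‖x‖ / ‖x‖ ^ 2 * u x ^ 2 := by
    have h0 : ∀ x ∉ tsupport u, V ‖x‖ / ‖x‖ ^ 2 * u x ^ 2 = 0 := fun x hx => by simp [hu0 x hx]
    refine Continuous.integrable_of_hasCompactSupport ?_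
      (HasCompactSupport.intro huc.isCompact h0)
    refine continuous_of_forall_mem_continuousAt hclosed (fun x hx => ?_) h0
    have hr := mem_puncturedBall.1 (hus hx)
    exact (((hVc _ hr).comp continuous_norm.continuousAt).div
      (continuous_norm.continuousAt.pow 2) (pow_ne_zero 2 hr.1.ne')).mul
      (hu.continuous.continuousAt.pow 2)
  have hDi : Integrable fun x => ‖fderiv ℝ u x‖ ^ 2 :=
    ((hu.continuous_fderiv one_ne_zero).norm.pow 2).integrable_of_hasCompactSupport
      ((huc.fderiv ℝ).mono fun x hx hc => hx (by simp [hc]))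
  have hgi := (integrable_fderiv_self hg hgc).add
    ((hg.continuous.integrable_of_hasCompactSupport hgc).const_mul (n : ℝ))
  have key : Set.EqOn
      (fun x => w ‖x‖ ^ 2 * ‖fderiv ℝ (fun y => u y / w ‖y‖) x‖ ^ 2)
      (fun x => ‖fderiv ℝ u x‖ ^ 2 - V ‖x‖ / ‖x‖ ^ 2 * u x ^ 2 - (fderiv ℝ g x x + n * g x))
      (puncturedBall _) := by
    intro x hx
    have hr := mem_puncturedBall.1 hx
    have hr0 := hr.1
    have hw0 := hw _ hr
    have hud := (hu.differentiable one_ne_zero x).hasFDerivAt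
    have h1 := hud.mul (hasFDerivAt_comp_norm hx.2 ((hwd _ hr).inv hw0.ne'))
    have h2 : fderiv ℝ (fun y => u y / w ‖y‖) x =
        (w ‖x‖)⁻¹ • (fderiv ℝ u x - (u x * m ‖x‖ / ‖x‖ ^ 2) • innerSL ℝ x) := by
      have h3 : (fun y => u y / w ‖y‖) = u * fun y => (w⁻¹) ‖y‖ := by
        ext y
        simp [div_eq_mul_inv]
      rw [h3, h1.fderiv]
      ext y
      simp
      field_simp
      ring
    have h4 := (hasFDerivAt_comp_norm hx.2 ((hmd _ hr).div (hasDerivAt_pow 2 _)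
      (pow_ne_zero 2 hr0.ne'))).mul (hud.pow 2)
    have h5 : fderiv ℝ g x x = -(V ‖x‖ + m ‖x‖ ^ 2 + ((n : ℝ) - 2) * m ‖x‖) / ‖x‖ ^ 2 * u x ^ 2
        - 2 * m ‖x‖ / ‖x‖ ^ 2 * u x ^ 2 + 2 * m ‖x‖ / ‖x‖ ^ 2 * u x * fderiv ℝ u x x := by
      have h6 : fderiv ℝ g x = _ := h4.fderiv
      rw [h6]
      simp
      field_simp
      ring
    simp only
    rw [h2, norm_smul, mul_pow, norm_sub_smul_innerSL_sq, h5, hgdef, norm_inv, norm_eq_abs, inv_pow,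
      sq_abs]
    field_simp
    ring
  refine ⟨(integrableOn_congr_fun key hm).2 ((hDi.sub hVi).sub hgi).integrableOn, ?_⟩
  rw [setIntegral_congr_fun hm key, setIntegral_eq_integral_of_forall_compl_eq_zero]
  · refine (integral_sub (hDi.sub hVi) hgi).trans ?_
    have h1 : ∫ x, ((fun x => fderiv ℝ g x x) + fun x => n * g x) x = 0 :=
      integral_fderiv_self hg hgc
    rw [h1, sub_zero]
    exact integral_sub hDi hVi
  · intro x hx
    have hx' : x ∉ tsupport u := fun hc => hx (hus hc)
    have hsupp : tsupport g ⊆ tsupport u :=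
      closure_minimal (fun y hy => by_contra fun hc => hy (hg0 y hc)) hclosed
    have hxg : x ∉ tsupport g := fun hc => hx' (hsupp hc)
    rw [image_eq_zero_of_notMem_tsupport fun hc => hx' (tsupport_fderiv_subset ℝ hc),
      image_eq_zero_of_notMem_tsupport (f := fderiv ℝ g)
        fun hc => hxg (tsupport_fderiv_subset ℝ hc), hg0 x hx', hu0 x hx']
    simp

end

/-- The quantity `t(r)^{-q}`, where `t` is the radial change of variables `hardyRadius`. -/
noncomputable def hardyRadiusInvPow (a : ℝ) (k q : ℕ) (r : ℝ) : ℝ :=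
  1 + ((Xiter a (k + 1) r)⁻¹ - (Xiter a (k + 1) 1)⁻¹) * (q / Xprod a k 1)

/-- The radial change of variables that transplants the Hardy functional. -/
noncomputable def hardyRadius (a : ℝ) (k q : ℕ) (r : ℝ) : ℝ :=
  hardyRadiusInvPow a k q r ^ (-(1 / (q : ℝ)))

/-- The inverse of `hardyRadius`. -/
noncomputable def hardyRadiusInv (a : ℝ) (k q : ℕ) (s : ℝ) : ℝ :=
  XiterInv a (k + 1) ((((s ^ q)⁻¹ - 1) / (q / Xprod a k 1) + (Xiter a (k + 1) 1)⁻¹)⁻¹)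

/-- The derivative of `hardyRadius`. -/
noncomputable def hardyRadiusDeriv (a : ℝ) (k q : ℕ) (r : ℝ) : ℝ :=
  hardyRadius a k q r ^ (q + 1) * (Xprod a k r / (r * Xprod a k 1))

namespace IterLogDefined

variable {a : ℝ} {k q : ℕ}

theorem Xiter_lt (h : IterLogDefined a k) {r : ℝ} (hr : r ∈ Set.Ioo (0 : ℝ) 1) {i : ℕ}
    (hi : i ≤ k + 1) : Xiter a i r < Xiter a i 1 := by
  refine (h.Xiter_mono hr.1 hr.2.le le_rfl hi).lt_of_ne fun hc => hr.2.ne ?_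
  rw [← h.XiterInv_Xiter ⟨hr.1, hr.2.le⟩ hi, hc, h.XiterInv_Xiter (by simp) hi]

theorem one_lt_hardyRadiusInvPow (h : IterLogDefined a k) (hq : 1 ≤ q) {r : ℝ}
    (hr : r ∈ Set.Ioo (0 : ℝ) 1) : 1 < hardyRadiusInvPow a k q r := by
  have h0 := h.Xiter_pos (⟨hr.1, hr.2.le⟩ : r ∈ Set.Ioc (0 : ℝ) 1) (le_refl (k + 1))
  have h1 := inv_strictAnti₀ h0 (h.Xiter_lt hr le_rfl)
  have h2 := h.Xprod_pos (by simp : (1 : ℝ) ∈ Set.Ioc (0 : ℝ) 1) (i := k) (by omega)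
  have h3 : (0 : ℝ) < q := by exact_mod_cast hq
  have := mul_pos (sub_pos.2 h1) (div_pos h3 h2)
  rw [hardyRadiusInvPow]
  linarith

theorem hardyRadius_pow (h : IterLogDefined a k) (hq : 1 ≤ q) {r : ℝ}
    (hr : r ∈ Set.Ioo (0 : ℝ) 1) : hardyRadius a k q r ^ q = (hardyRadiusInvPow a k q r)⁻¹ := by
  have h3 : (q : ℝ) ≠ 0 := by exact_mod_cast (by omega : q ≠ 0)
  have h4 := zero_lt_one.trans (h.one_lt_hardyRadiusInvPow hq hr)
  rw [hardyRadius, ← rpow_natCast, ← rpow_mul h4.le, ← rpow_neg_one]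
  congr 1
  field_simp

theorem hardyRadius_mem (h : IterLogDefined a k) (hq : 1 ≤ q) {r : ℝ}
    (hr : r ∈ Set.Ioo (0 : ℝ) 1) : hardyRadius a k q r ∈ Set.Ioo (0 : ℝ) 1 := by
  have h3 : (0 : ℝ) < q := by exact_mod_cast hq
  have h4 := h.one_lt_hardyRadiusInvPow hq hr
  exact ⟨rpow_pos_of_pos (zero_lt_one.trans h4) _,
    rpow_lt_one_of_one_lt_of_neg h4 (neg_lt_zero.2 (one_div_pos.2 h3))⟩

theorem isRadialChange (h : IterLogDefined a k) (hq : 1 ≤ q) :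
    IsRadialChange (hardyRadius a k q) (hardyRadiusInv a k q) (hardyRadiusDeriv a k q) := by
  have hone : (1 : ℝ) ∈ Set.Ioc (0 : ℝ) 1 := by simp
  have hq0 : (0 : ℝ) < q := by exact_mod_cast hq
  have hQ1 := h.Xprod_pos hone (i := k) (by omega)
  have hX1 := h.Xiter_pos hone (le_refl (k + 1))
  have hA : 0 < (q : ℝ) / Xprod a k 1 := div_pos hq0 hQ1
  have hσ : ∀ s ∈ Set.Ioo (0 : ℝ) 1,
      0 < ((s ^ q)⁻¹ - 1) / (q / Xprod a k 1) := by
    intro s hs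
    have h1 : 1 < (s ^ q)⁻¹ :=
      (one_lt_inv₀ (pow_pos hs.1 q)).2 (pow_lt_one₀ hs.1.le hs.2 (by omega))
    exact div_pos (sub_pos.2 h1) hA
  refine ⟨fun r hr => h.hardyRadius_mem hq hr, fun s hs => ⟨?_, ?_⟩, fun r hr => ?_, fun s hs => ?_,
    fun r hr => ?_, fun r hr => ?_, fun s hs => ?_⟩
  · have := hσ s hs
    exact XiterInv_pos _ _ (by positivity)
  · have := hσ s hs
    refine h.XiterInv_lt_one le_rfl (by positivity) ?_
    rw [inv_lt_comm₀ (by positivity) hX1]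
    linarith
  · rw [hardyRadiusInv, h.hardyRadius_pow hq hr, inv_inv, hardyRadiusInvPow, add_sub_cancel_left,
      mul_div_cancel_right₀ _ hA.ne', sub_add_cancel, inv_inv,
      h.XiterInv_Xiter ⟨hr.1, hr.2.le⟩ le_rfl]
  · rw [hardyRadius, hardyRadiusInvPow, hardyRadiusInv, Xiter_XiterInv, inv_inv, add_sub_cancel_right,
      div_mul_cancel₀ _ hA.ne', add_sub_cancel, ← rpow_natCast, ← rpow_neg hs.1.le,
      ← rpow_mul hs.1.le]
    have : -(q : ℝ) * -(1 / q) = 1 := by field_simp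
    rw [this, rpow_one]
  · have hr' : r ∈ Set.Ioc (0 : ℝ) 1 := ⟨hr.1, hr.2.le⟩
    have h0 := h.Xiter_pos hr' (le_refl (k + 1))
    have hB := h.one_lt_hardyRadiusInvPow hq hr
    have hB0 := zero_lt_one.trans hB
    have h1 : HasDerivAt (hardyRadiusInvPow a k q)
        (-(Xprod a k r / r) * (q / Xprod a k 1)) r := by
      refine ((((h.hasDerivAt_Xiter hr' le_rfl).inv h0.ne').sub_const _).mul_const _).const_add _
        |>.congr_deriv ?_
      rw [Xprod_succ]
      field_simp
    refine (h1.rpow_const (Or.inl hB0.ne')).congr_deriv ?_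
    have h2 : hardyRadiusInvPow a k q r ^ (-(1 / (q : ℝ)) - 1) = hardyRadius a k q r ^ (q + 1) := by
      rw [pow_succ, h.hardyRadius_pow hq hr, sub_eq_add_neg, rpow_add hB0, rpow_neg_one,
        hardyRadius, mul_comm]
    rw [h2, hardyRadiusDeriv]
    have := hr.1
    field_simp
  · have h0 := h.Xprod_pos (⟨hr.1, hr.2.le⟩ : r ∈ Set.Ioc (0 : ℝ) 1) (i := k) (by omega)
    have := (h.hardyRadius_mem hq hr).1
    have := hr.1
    rw [hardyRadiusDeriv]
    positivity
  · have := hσ s hs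
    have hpos : 0 < ((s ^ q)⁻¹ - 1) / (q / Xprod a k 1) + (Xiter a (k + 1) 1)⁻¹ := by positivity
    refine (contDiffAt_XiterInv a (k + 1) (inv_pos.2 hpos)).comp s (ContDiffAt.inv ?_ hpos.ne')
    exact (((((contDiffAt_id.pow q).inv (pow_pos hs.1 q).ne').sub contDiffAt_const).div_const _).add
      contDiffAt_const)

end IterLogDefined

/-- The ground state of the Hardy functional with iterated logarithmic potential. -/
noncomputable def hardyWeight (a : ℝ) (k q : ℕ) (r : ℝ) : ℝ := (√(r ^ q * Xprod a k r))⁻¹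

/-- The logarithmic derivative of `hardyWeight`, multiplied by `r`. -/
noncomputable def hardyExponent (a : ℝ) (k q : ℕ) (r : ℝ) : ℝ := -(q / 2) - Xsum a k r / 2

/-- The potential of the improved Hardy inequality, multiplied by `r²`. -/
noncomputable def hardyPotential (a : ℝ) (k q : ℕ) (r : ℝ) : ℝ :=
  ((q : ℝ) / 2) ^ 2 + 1 / 4 * ∑ i ∈ Finset.Icc 1 k, Xprod a i r ^ 2

namespace IterLogDefined

variable {a : ℝ} {k q : ℕ}

theorem hardyWeight_pos (h : IterLogDefined a k) {r : ℝ} (hr : r ∈ Set.Ioo (0 : ℝ) 1) :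
    0 < hardyWeight a k q r := by
  have h0 := h.Xprod_pos (⟨hr.1, hr.2.le⟩ : r ∈ Set.Ioc (0 : ℝ) 1) (i := k) (by omega)
  have := hr.1
  rw [hardyWeight]
  positivity

theorem hardyWeight_sq (h : IterLogDefined a k) {r : ℝ} (hr : r ∈ Set.Ioo (0 : ℝ) 1) :
    hardyWeight a k q r ^ 2 = (r ^ q * Xprod a k r)⁻¹ := by
  have h0 := h.Xprod_pos (⟨hr.1, hr.2.le⟩ : r ∈ Set.Ioc (0 : ℝ) 1) (i := k) (by omega)
  have := hr.1
  rw [hardyWeight, inv_pow, sq_sqrt (by positivity)]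

theorem contDiffAt_hardyWeight (h : IterLogDefined a k) {r : ℝ} (hr : r ∈ Set.Ioo (0 : ℝ) 1)
    {m : WithTop ℕ∞} : ContDiffAt ℝ m (hardyWeight a k q) r := by
  have hr' : r ∈ Set.Ioc (0 : ℝ) 1 := ⟨hr.1, hr.2.le⟩
  have h0 := h.Xprod_pos hr' (i := k) (by omega)
  have h1 : 0 < r ^ q * Xprod a k r := mul_pos (pow_pos hr.1 q) h0
  exact (((contDiffAt_id.pow q).mul (h.contDiffAt_Xprod hr' (by omega))).sqrt h1.ne').inv
    (sqrt_pos.2 h1).ne'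

theorem hasDerivAt_hardyWeight (h : IterLogDefined a k) (hq : 1 ≤ q) {r : ℝ}
    (hr : r ∈ Set.Ioo (0 : ℝ) 1) :
    HasDerivAt (hardyWeight a k q) (hardyWeight a k q r * (hardyExponent a k q r / r)) r := by
  have hr' : r ∈ Set.Ioc (0 : ℝ) 1 := ⟨hr.1, hr.2.le⟩
  have h0 := h.Xprod_pos hr' (i := k) (by omega)
  have hr0 := hr.1
  have h1 : 0 < r ^ q * Xprod a k r := mul_pos (pow_pos hr.1 q) h0
  have h2 := (((hasDerivAt_pow q r).mul (h.hasDerivAt_Xprod hr' (i := k) (by omega))).sqrt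
    h1.ne').inv (sqrt_pos.2 h1).ne'
  refine h2.congr_deriv ?_
  simp only [Pi.mul_apply]
  rw [sq_sqrt h1.le, hardyWeight, hardyExponent]
  obtain ⟨p, rfl⟩ := Nat.exists_eq_add_of_le' hq
  have := sqrt_pos.2 h1
  rw [Nat.add_sub_cancel]
  field_simp
  ring

theorem hasDerivAt_hardyExponent (h : IterLogDefined a k) {r : ℝ} (hr : r ∈ Set.Ioo (0 : ℝ) 1) :
    HasDerivAt (hardyExponent a k q) (-(hardyPotential a k q r + hardyExponent a k q r ^ 2 +
      (((q + 2 : ℕ) : ℝ) - 2) * hardyExponent a k q r) / r) r := by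
  have hr' : r ∈ Set.Ioc (0 : ℝ) 1 := ⟨hr.1, hr.2.le⟩
  refine (((h.hasDerivAt_Xsum hr' (i := k) (by omega)).div_const 2).const_sub _).congr_deriv ?_
  have hr0 := hr.1
  rw [hardyPotential, hardyExponent]
  push_cast
  field_simp
  ring

theorem contDiffAt_hardyExponent (h : IterLogDefined a k) {r : ℝ} (hr : r ∈ Set.Ioo (0 : ℝ) 1)
    {m : WithTop ℕ∞} : ContDiffAt ℝ m (hardyExponent a k q) r :=
  contDiffAt_const.sub ((h.contDiffAt_Xsum ⟨hr.1, hr.2.le⟩ (by omega)).div_const _)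

theorem continuousAt_hardyPotential (h : IterLogDefined a k) {r : ℝ}
    (hr : r ∈ Set.Ioo (0 : ℝ) 1) : ContinuousAt (hardyPotential a k q) r :=
  continuousAt_const.add (continuousAt_const.mul (tendsto_finsetSum _ fun i hi =>
    ((h.contDiffAt_Xprod (m := 0) ⟨hr.1, hr.2.le⟩
      (by have := (Finset.mem_Icc.1 hi).2; omega)).continuousAt.pow 2)))

theorem rpow_le_jacobian (h : IterLogDefined a k) (hq : 1 ≤ q)
    (hP : (q : ℝ) < Xprod a (k + 1) 1) {r : ℝ} (hr : r ∈ Set.Ioo (0 : ℝ) 1) (c : ℝ) :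
    (Xiter a (k + 1) 1)⁻¹ ^ (2 * ((q : ℝ) + 1) / q) / Xprod a k 1 *
      (Xprod a (k + 1) r ^ (2 * ((q : ℝ) + 1) / q) * |c| ^ (2 * ((q : ℝ) + 2) / q)) ≤
    (hardyRadius a k q r / r) ^ (q + 1) * hardyRadiusDeriv a k q r *
      |c / hardyWeight a k q r| ^ (2 * ((q : ℝ) + 2) / q) := by
  have hone : (1 : ℝ) ∈ Set.Ioc (0 : ℝ) 1 := by simp
  have hr' : r ∈ Set.Ioc (0 : ℝ) 1 := ⟨hr.1, hr.2.le⟩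
  have hr0 := hr.1
  have hq0 : (0 : ℝ) < q := by exact_mod_cast hq
  have hQ1 := h.Xprod_pos hone (i := k) (by omega)
  have hX1 := h.Xiter_pos hone (le_refl (k + 1))
  have hQ := h.Xprod_pos hr' (i := k) (by omega)
  have hX := h.Xiter_pos hr' (le_refl (k + 1))
  have ht := (h.hardyRadius_mem hq hr).1
  have hw := h.hardyWeight_pos hr (q := q)
  have hB0 := zero_lt_one.trans (h.one_lt_hardyRadiusInvPow hq hr)
  have htq : (Xiter a (k + 1) 1)⁻¹ * Xiter a (k + 1) r ≤ hardyRadius a k q r ^ q := by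
    rw [h.hardyRadius_pow hq hr, le_inv_comm₀ (by positivity) hB0, hardyRadiusInvPow]
    have h1 := inv_anti₀ hX (h.Xiter_lt hr (le_refl (k + 1))).le
    have h2 : (q : ℝ) / Xprod a k 1 ≤ Xiter a (k + 1) 1 := by
      rw [Xprod_succ] at hP
      rw [div_le_iff₀ hQ1]
      linarith
    have h3 := mul_le_mul_of_nonneg_left h2 (sub_nonneg.2 h1)
    calc _ ≤ 1 + ((Xiter a (k + 1) r)⁻¹ - (Xiter a (k + 1) 1)⁻¹) * Xiter a (k + 1) 1 := by
          linarith
      _ = _ := by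
          field_simp
          ring
  have e1 : |c / hardyWeight a k q r| ^ (2 * ((q : ℝ) + 2) / q) =
      |c| ^ (2 * ((q : ℝ) + 2) / q) * (r ^ (q + 2) * Xprod a k r ^ (((q : ℝ) + 2) / q)) := by
    have h1 : (2 * ((q : ℝ) + 2) / q) = (2 : ℕ) * (((q : ℝ) + 2) / q) := by
      push_cast
      ring
    have h2 : (hardyWeight a k q r)⁻¹ ^ 2 = r ^ q * Xprod a k r := by
      rw [inv_pow, h.hardyWeight_sq hr, inv_inv]
    rw [div_eq_mul_inv, abs_mul, mul_rpow (abs_nonneg _) (abs_nonneg _),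
      abs_of_pos (inv_pos.2 hw)]
    congr 1
    rw [h1, rpow_mul (inv_pos.2 hw).le, rpow_natCast, h2, mul_rpow (by positivity) hQ.le]
    congr 1
    rw [← rpow_natCast, ← rpow_natCast, ← rpow_mul hr0.le]
    congr 1
    push_cast
    field_simp
  have e2 : Xprod a k r ^ (((q : ℝ) + 2) / q) * Xprod a k r = Xprod a k r ^ (2 * ((q : ℝ) + 1) / q) := by
    rw [← rpow_add_one hQ.ne']
    congr 1
    field_simp
    ring
  have e3 : hardyRadius a k q r ^ (q + 1) * hardyRadius a k q r ^ (q + 1) =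
      (hardyRadius a k q r ^ q) ^ (2 * ((q : ℝ) + 1) / q) := by
    rw [← rpow_natCast _ q, ← rpow_mul ht.le, ← pow_add, ← rpow_natCast]
    congr 1
    push_cast
    field_simp
    ring
  have e4 := rpow_le_rpow (by positivity) htq (by positivity : 0 ≤ 2 * ((q : ℝ) + 1) / q)
  rw [mul_rpow (by positivity) hX.le] at e4
  calc _ = (Xiter a (k + 1) 1)⁻¹ ^ (2 * ((q : ℝ) + 1) / q) *
        Xiter a (k + 1) r ^ (2 * ((q : ℝ) + 1) / q) *
        (Xprod a k r ^ (2 * ((q : ℝ) + 1) / q) * |c| ^ (2 * ((q : ℝ) + 2) / q) / Xprod a k 1) := by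
        rw [Xprod_succ, mul_rpow hQ.le hX.le]
        ring
    _ ≤ (hardyRadius a k q r ^ q) ^ (2 * ((q : ℝ) + 1) / q) *
        (Xprod a k r ^ (2 * ((q : ℝ) + 1) / q) * |c| ^ (2 * ((q : ℝ) + 2) / q) / Xprod a k 1) :=
        mul_le_mul_of_nonneg_right e4 (by positivity)
    _ = _ := by
        rw [e1, ← e2, ← e3, hardyRadiusDeriv, div_pow]
        field_simp
        ring

/-- The improved Hardy–Sobolev inequality away from the origin. -/
theorem hardy_sobolev_punctured (h : IterLogDefined a k) (hq : 1 ≤ q)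
    (hP : (q : ℝ) < Xprod a (k + 1) 1) {u : EuclideanSpace ℝ (Fin (q + 2)) → ℝ}
    (hu : ContDiff ℝ 1 u) (huc : HasCompactSupport u) (hus : tsupport u ⊆ puncturedBall _) :
    Xprod a (k + 1) 1 ^ (-(2 * ((q : ℝ) + 1)) / (q + 2)) * sobolevConst (q + 2) *
      (∫ x in puncturedBall _, Xprod a (k + 1) ‖x‖ ^ (2 * ((q : ℝ) + 1) / q) *
        |u x| ^ (2 * ((q : ℝ) + 2) / q)) ^ ((q : ℝ) / (q + 2)) ≤
      (∫ x, ‖fderiv ℝ u x‖ ^ 2) - ∫ x, hardyPotential a k q ‖x‖ / ‖x‖ ^ 2 * u x ^ 2 := by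
  have hone : (1 : ℝ) ∈ Set.Ioc (0 : ℝ) 1 := by simp
  have hq0 : (0 : ℝ) < q := by exact_mod_cast hq
  have hQ1 := h.Xprod_pos hone (i := k) (by omega)
  have hX1 := h.Xiter_pos hone (le_refl (k + 1))
  have hm : MeasurableSet (puncturedBall (EuclideanSpace ℝ (Fin (q + 2)))) :=
    isOpen_puncturedBall.measurableSet
  have hclosed := isClosed_tsupport u
  set v : EuclideanSpace ℝ (Fin (q + 2)) → ℝ := fun y => u y / hardyWeight a k q ‖y‖ with hvdef
  have hv0 : ∀ x ∉ tsupport u, v x = 0 := fun x hx => by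
    rw [hvdef]
    simp only [image_eq_zero_of_notMem_tsupport hx, zero_div]
  have hv : ContDiff ℝ 1 v := by
    refine contDiff_of_forall_mem_contDiffAt hclosed (fun x hx => ?_) hv0
    have hr := mem_puncturedBall.1 (hus hx)
    exact hu.contDiffAt.div ((h.contDiffAt_hardyWeight hr).comp x
      (contDiffAt_norm ℝ (hus hx).2)) (h.hardyWeight_pos hr).ne'
  have hvc : HasCompactSupport v := HasCompactSupport.intro huc.isCompact hv0
  have hvs : tsupport v ⊆ tsupport u :=
    closure_minimal (fun y hy => by_contra fun hc => hy (hv0 y hc)) hclosed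
  obtain ⟨z, hz, hzc, hzp, hzW⟩ := (h.isRadialChange hq).exists_transplant volume
    (d := q + 1) (by simp) hv hvc (hvs.trans hus)
  obtain ⟨hgi, hge⟩ := ground_state_representation (n := q + 2)
    (fun r hr => h.hardyWeight_pos hr (q := q)) (fun r hr => h.hasDerivAt_hardyWeight hq hr)
    (fun r hr => h.hasDerivAt_hardyExponent hr) (fun r hr => h.contDiffAt_hardyExponent hr)
    (fun r hr => h.continuousAt_hardyPotential hr) hu huc hus
  have hgrad : ∫ y, ‖fderiv ℝ z y‖ ^ 2 ≤ Xprod a k 1 * ((∫ x, ‖fderiv ℝ u x‖ ^ 2) -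
      ∫ x, hardyPotential a k q ‖x‖ / ‖x‖ ^ 2 * u x ^ 2) := by
    have h1 := hzW (fun r => Xprod a k 1 * hardyWeight a k q r ^ 2) ?_ ?_ ?_
    · simp only [mul_assoc] at h1
      rwa [integral_const_mul, hge] at h1
    · intro r hr
      have hr0 := hr.1
      have ht := h.hardyRadius_mem hq hr
      have hQ := h.Xprod_pos (⟨hr.1, hr.2.le⟩ : r ∈ Set.Ioc (0 : ℝ) 1) (i := k) (by omega)
      have hQle := h.Xprod_mono hr.1 hr.2.le le_rfl (i := k) (by omega)
      have h2 : (hardyRadius a k q r ^ q * Xprod a k r) ^ 2 ≤ Xprod a k 1 ^ 2 := by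
        refine pow_le_pow_left₀ (by have := ht.1; positivity) ?_ 2
        exact (mul_le_of_le_one_left hQ.le (pow_le_one₀ ht.1.le ht.2.le)).trans hQle
      have ht0 := ht.1
      rw [h.hardyWeight_sq hr, hardyRadiusDeriv]
      calc _ = hardyRadius a k q r ^ 2 / (r ^ (q + 2) * Xprod a k 1 * Xprod a k r) *
            (hardyRadius a k q r ^ q * Xprod a k r) ^ 2 := by
            simp only [div_pow]
            field_simp
            ring
        _ ≤ hardyRadius a k q r ^ 2 / (r ^ (q + 2) * Xprod a k 1 * Xprod a k r) *
            Xprod a k 1 ^ 2 := mul_le_mul_of_nonneg_left h2 (by positivity)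
        _ = _ := by
            field_simp
            ring
    · intro r hr
      have hr0 := hr.1
      have ht0 := (h.hardyRadius_mem hq hr).1
      have hQ := h.Xprod_pos (⟨hr.1, hr.2.le⟩ : r ∈ Set.Ioc (0 : ℝ) 1) (i := k) (by omega)
      rw [h.hardyWeight_sq hr, hardyRadiusDeriv]
      refine le_of_eq ?_
      simp only [div_pow]
      field_simp
      ring
    · simp only [mul_assoc]
      exact hgi.const_mul _
  obtain ⟨hpi, hpe⟩ := hzp (2 * ((q : ℝ) + 2) / q) (by positivity)
  have hnn : 0 ≤ ∫ x in puncturedBall (EuclideanSpace ℝ (Fin (q + 2))),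
      Xprod a (k + 1) ‖x‖ ^ (2 * ((q : ℝ) + 1) / q) * |u x| ^ (2 * ((q : ℝ) + 2) / q) := by
    refine setIntegral_nonneg hm fun x hx => ?_
    have hr := mem_puncturedBall.1 hx
    have := h.Xprod_pos (⟨hr.1, hr.2.le⟩ : ‖x‖ ∈ Set.Ioc (0 : ℝ) 1) (i := k + 1) le_rfl
    positivity
  have hLp : (Xiter a (k + 1) 1)⁻¹ ^ (2 * ((q : ℝ) + 1) / q) / Xprod a k 1 *
      ∫ x in puncturedBall (EuclideanSpace ℝ (Fin (q + 2))),
        Xprod a (k + 1) ‖x‖ ^ (2 * ((q : ℝ) + 1) / q) * |u x| ^ (2 * ((q : ℝ) + 2) / q) ≤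
      ∫ y, |z y| ^ (2 * ((q : ℝ) + 2) / q) := by
    rw [hpe, ← integral_const_mul]
    refine integral_mono_of_nonneg ?_ hpi ?_
    · filter_upwards [ae_restrict_mem hm] with x hx
      have hr := mem_puncturedBall.1 hx
      have := h.Xprod_pos (⟨hr.1, hr.2.le⟩ : ‖x‖ ∈ Set.Ioc (0 : ℝ) 1) (i := k + 1) le_rfl
      simp only [Pi.zero_apply]
      positivity
    · filter_upwards [ae_restrict_mem hm] with x hx
      exact h.rpow_le_jacobian hq hP (mem_puncturedBall.1 hx) (u x)
  have hsob := sobolev_euclideanSpace (n := q + 2) (by omega) hz hzc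
  have hcast : ((q + 2 : ℕ) : ℝ) = q + 2 := by push_cast; rfl
  rw [hcast, add_sub_cancel_right] at hsob
  have hS : 0 < sobolevConst (q + 2) := by
    rw [sobolevConst_eq (by omega), hcast, add_sub_cancel_right]
    have := bubbleMass_pos (n := q + 2) (by omega)
    positivity
  have h1 := rpow_le_rpow (by positivity) hLp (by positivity : 0 ≤ (q : ℝ) / (q + 2))
  have h2 := (mul_le_mul_of_nonneg_left h1 hS.le).trans (hsob.trans hgrad)
  rw [mul_rpow (by positivity) hnn] at h2
  have hconst : Xprod a (k + 1) 1 ^ (-(2 * ((q : ℝ) + 1)) / (q + 2)) * Xprod a k 1 =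
      ((Xiter a (k + 1) 1)⁻¹ ^ (2 * ((q : ℝ) + 1) / q) / Xprod a k 1) ^ ((q : ℝ) / (q + 2)) := by
    rw [Xprod_succ, mul_rpow hQ1.le hX1.le, div_rpow (by positivity) hQ1.le,
      ← rpow_mul (by positivity), inv_rpow hX1.le, ← rpow_neg hX1.le, div_eq_mul_inv _ (_ ^ _),
      ← rpow_neg hQ1.le, mul_right_comm, ← rpow_add_one hQ1.ne', mul_comm]
    congr 2
    · field_simp
    · field_simp
      ring
  refine le_of_mul_le_mul_left ?_ hQ1
  calc _ = sobolevConst (q + 2) *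
      ((Xprod a (k + 1) 1 ^ (-(2 * ((q : ℝ) + 1)) / (q + 2)) * Xprod a k 1) *
      (∫ x in puncturedBall _, Xprod a (k + 1) ‖x‖ ^ (2 * ((q : ℝ) + 1) / q) *
        |u x| ^ (2 * ((q : ℝ) + 2) / q)) ^ ((q : ℝ) / (q + 2))) := by ring
    _ ≤ _ := by
      rw [hconst]
      exact h2

end IterLogDefined

/-- Truncations of `u` near the origin. -/
theorem exists_truncation_seq {E : Type*} [NormedAddCommGroup E] [InnerProductSpace ℝ E]
    [FiniteDimensional ℝ E] {u : E → ℝ} (hu : ContDiff ℝ 1 u) (huc : HasCompactSupport u)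
    (hus : tsupport u ⊆ Metric.ball 0 1) :
    ∃ (C : ℝ) (v : ℕ → E → ℝ), 0 ≤ C ∧ ∀ j, ContDiff ℝ 1 (v j) ∧ HasCompactSupport (v j) ∧
      tsupport (v j) ⊆ puncturedBall E ∧ (∀ x, |v j x| ≤ |u x|) ∧
      (∀ x ≠ 0, ‖fderiv ℝ (v j) x‖ ≤ ‖fderiv ℝ u x‖ + C * (|u x| / ‖x‖)) ∧
      ∀ x, 2 < (j + 1) * ‖x‖ → v j =ᶠ[nhds x] u := by
  let χ : ContDiffBump (0 : E) := ⟨1, 2, one_pos, one_lt_two⟩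
  have hχ : ContDiff ℝ 1 χ := χ.contDiff
  have hcont : Continuous fun x => ‖fderiv ℝ χ x‖ * ‖x‖ :=
    (hχ.continuous_fderiv one_ne_zero).norm.mul continuous_norm
  obtain ⟨C, hC⟩ := hcont.bounded_above_of_compact_support
    ((χ.hasCompactSupport.fderiv ℝ).norm.mul_right)
  have hC0 : 0 ≤ C := (norm_nonneg _).trans (hC 0)
  refine ⟨C, fun j x => (1 - χ (((j : ℝ) + 1) • x)) * u x, hC0, fun j => ?_⟩
  have hj : (0 : ℝ) < j + 1 := by positivity
  have hη : ContDiff ℝ 1 fun x => 1 - χ (((j : ℝ) + 1) • x) :=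
    contDiff_const.sub (hχ.comp (contDiff_const_smul _))
  have hη0 : ∀ x, 0 ≤ 1 - χ (((j : ℝ) + 1) • x) := fun x => sub_nonneg.2 χ.le_one
  have hη1 : ∀ x, 1 - χ (((j : ℝ) + 1) • x) ≤ 1 := fun x => sub_le_self _ χ.nonneg
  have hsupp : tsupport (fun x => (1 - χ (((j : ℝ) + 1) • x)) * u x) ⊆ tsupport u :=
    tsupport_mul_subset_right
  refine ⟨hη.mul hu, huc.mul_left, fun x hx => ⟨hus (hsupp hx), ?_⟩, fun x => ?_, fun x hx => ?_,
    fun x hx => ?_⟩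
  · rintro rfl
    refine notMem_tsupport_iff_eventuallyEq.2 ?_ hx
    have hopen : IsOpen {y : E | (j + 1) * ‖y‖ < 1} :=
      isOpen_lt (continuous_const.mul continuous_norm) continuous_const
    filter_upwards [hopen.mem_nhds (show (j + 1) * ‖(0 : E)‖ < 1 by simp)] with y hy
    rw [χ.one_of_mem_closedBall, sub_self, zero_mul, Pi.zero_apply]
    rw [mem_closedBall_zero_iff, norm_smul, norm_of_nonneg hj.le]
    exact (show _ < (1 : ℝ) from hy).le
  · rw [abs_mul, abs_of_nonneg (hη0 x)]
    exact mul_le_of_le_one_left (abs_nonneg _) (hη1 x)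
  · have h1 : HasFDerivAt (fun x => 1 - χ (((j : ℝ) + 1) • x))
        (-((fderiv ℝ χ (((j : ℝ) + 1) • x)).comp (((j : ℝ) + 1) • ContinuousLinearMap.id ℝ E))) x :=
      (((hχ.differentiable one_ne_zero _).hasFDerivAt).comp x
        ((hasFDerivAt_id x).const_smul ((j : ℝ) + 1))).const_sub 1
    have h2 := h1.mul (hu.differentiable one_ne_zero x).hasFDerivAt
    have hx0 := norm_pos_iff.2 hx
    have h3 := hC (((j : ℝ) + 1) • x)
    have h4 : fderiv ℝ (fun x => (1 - χ (((j : ℝ) + 1) • x)) * u x) x = _ := h2.fderiv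
    simp only [h4]
    refine (norm_add_le _ _).trans (add_le_add ?_ ?_)
    · rw [norm_smul, norm_of_nonneg (hη0 x)]
      exact mul_le_of_le_one_left (norm_nonneg _) (hη1 x)
    · rw [norm_smul, norm_neg, ContinuousLinearMap.comp_smul, ContinuousLinearMap.comp_id,
        norm_smul, norm_of_nonneg hj.le, norm_eq_abs]
      rw [norm_smul, norm_of_nonneg hj.le, norm_of_nonneg (by positivity)] at h3
      calc _ = |u x| / ‖x‖ * (‖fderiv ℝ χ (((j : ℝ) + 1) • x)‖ * ((j + 1) * ‖x‖)) := by
            field_simp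
        _ ≤ |u x| / ‖x‖ * C := mul_le_mul_of_nonneg_left h3 (by positivity)
        _ = _ := mul_comm _ _
  · have hopen : IsOpen {y : E | 2 < (j + 1) * ‖y‖} :=
      isOpen_lt continuous_const (continuous_const.mul continuous_norm)
    filter_upwards [hopen.mem_nhds hx] with y hy
    rw [χ.zero_of_le_dist, sub_zero, one_mul]
    rw [dist_zero_right, norm_smul, norm_of_nonneg hj.le]
    exact (show (2 : ℝ) < _ from hy).le

theorem integrable_sq_div_norm_sq {n : ℕ} (hn : 3 ≤ n) {u : EuclideanSpace ℝ (Fin n) → ℝ}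
    (hu : Continuous u) (huc : HasCompactSupport u) (hus : tsupport u ⊆ Metric.ball 0 1) :
    Integrable fun x => u x ^ 2 / ‖x‖ ^ 2 := by
  obtain ⟨B, hB⟩ := hu.bounded_above_of_compact_support huc
  have : Nonempty (Fin n) := ⟨⟨0, by omega⟩⟩
  have h1 : Integrable fun x : EuclideanSpace ℝ (Fin n) =>
      (Set.Iio (1 : ℝ)).indicator (fun r => B ^ 2 / r ^ 2) ‖x‖ := by
    rw [integrable_fun_norm_addHaar, finrank_euclideanSpace_fin]
    have h2 : IntegrableOn (fun y : ℝ => y ^ (n - 3) * B ^ 2) (Set.Iio 1 ∩ Set.Ioi 0) :=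
      ((by fun_prop : Continuous fun y : ℝ => y ^ (n - 3) * B ^ 2).continuousOn.integrableOn_Icc
        (a := 0) (b := 1)).mono_set fun y hy => ⟨(Set.mem_Ioi.1 hy.2).le, (Set.mem_Iio.1 hy.1).le⟩
    rw [IntegrableOn, ← Measure.restrict_restrict measurableSet_Iio] at h2
    refine IntegrableOn.congr_fun ((integrable_indicator_iff measurableSet_Iio).2 h2)
      (fun y hy => ?_) measurableSet_Ioi
    have hy0 : (0 : ℝ) < y := hy
    by_cases h1 : y ∈ Set.Iio (1 : ℝ)
    · obtain ⟨m, rfl⟩ := Nat.exists_eq_add_of_le' hn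
      simp only [Set.indicator_of_mem h1, smul_eq_mul, Nat.add_sub_cancel, Nat.reduceSubDiff]
      field_simp
      ring
    · simp [Set.indicator_of_notMem h1]
  refine h1.mono' (((hu.measurable.pow_const 2).div (measurable_norm.pow_const 2)).aestronglyMeasurable) (Filter.Eventually.of_forall fun x => ?_)
  rw [norm_of_nonneg (by positivity)]
  by_cases hx : x ∈ Metric.ball (0 : EuclideanSpace ℝ (Fin n)) 1
  · rw [Set.indicator_of_mem (by simpa using hx), ← sq_abs (u x)]
    gcongr
    exact hB x
  · rw [image_eq_zero_of_notMem_tsupport fun hc => hx (hus hc), Set.indicator_of_notMem (by simpa using hx)]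
    simp

namespace IterLogDefined

variable {a : ℝ} {k q : ℕ}

theorem hardyPotential_nonneg (a : ℝ) (k q : ℕ) (r : ℝ) : 0 ≤ hardyPotential a k q r :=
  add_nonneg (sq_nonneg _) (mul_nonneg (by norm_num) (Finset.sum_nonneg fun _ _ => sq_nonneg _))

theorem hardyPotential_le (h : IterLogDefined a k) {r : ℝ} (hr : r ∈ Set.Ioo (0 : ℝ) 1) :
    hardyPotential a k q r ≤ hardyPotential a k q 1 := by
  refine add_le_add_right (mul_le_mul_of_nonneg_left (Finset.sum_le_sum fun i hi => ?_)
    (by norm_num)) _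
  have hi' := (Finset.mem_Icc.1 hi).2
  exact pow_le_pow_left₀ (h.Xprod_pos ⟨hr.1, hr.2.le⟩ (by omega)).le
    (h.Xprod_mono hr.1 hr.2.le le_rfl (by omega)) 2

theorem measurable_hardyPotential (a : ℝ) (k q : ℕ) : Measurable (hardyPotential a k q) :=
  measurable_const.add (measurable_const.mul
    (Finset.measurable_fun_sum _ fun i _ => (measurable_Xprod a i).pow_const 2))

/-- The weighted critical integrand is dominated by the unweighted one. -/
theorem Xprod_rpow_mul_le (h : IterLogDefined a k) {r : ℝ} (hr : r ∈ Set.Ioo (0 : ℝ) 1)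
    {p b c : ℝ} (hp : 0 ≤ p) (hb : 0 ≤ b) (hbc : b ≤ c) :
    Xprod a (k + 1) r ^ p * b ≤ Xprod a (k + 1) 1 ^ p * c :=
  mul_le_mul (rpow_le_rpow (h.Xprod_pos ⟨hr.1, hr.2.le⟩ le_rfl).le
    (h.Xprod_mono hr.1 hr.2.le le_rfl le_rfl) hp) hbc hb
    (rpow_nonneg (h.Xprod_pos (by simp) le_rfl).le _)

/-- The improved Hardy–Sobolev inequality. -/
theorem hardy_sobolev (h : IterLogDefined a k) (hq : 1 ≤ q)
    (hP : (q : ℝ) < Xprod a (k + 1) 1) {u : EuclideanSpace ℝ (Fin (q + 2)) → ℝ}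
    (hu : ContDiff ℝ 1 u) (huc : HasCompactSupport u) (hus : tsupport u ⊆ Metric.ball 0 1) :
    Xprod a (k + 1) 1 ^ (-(2 * ((q : ℝ) + 1)) / (q + 2)) * sobolevConst (q + 2) *
      (∫ x in puncturedBall _, Xprod a (k + 1) ‖x‖ ^ (2 * ((q : ℝ) + 1) / q) *
        |u x| ^ (2 * ((q : ℝ) + 2) / q)) ^ ((q : ℝ) / (q + 2)) ≤
      (∫ x, ‖fderiv ℝ u x‖ ^ 2) - ∫ x, hardyPotential a k q ‖x‖ / ‖x‖ ^ 2 * u x ^ 2 := by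
  have hq0 : (0 : ℝ) < q := by exact_mod_cast hq
  have : Nonempty (Fin (q + 2)) := ⟨0⟩
  obtain ⟨C, v, hC, hv⟩ := exists_truncation_seq hu huc hus
  have hsq := integrable_sq_div_norm_sq (by omega) hu.continuous huc hus
  have hne : ∀ᵐ x : EuclideanSpace ℝ (Fin (q + 2)), x ≠ 0 := by
    simp [ae_iff]
  have hev : ∀ x : EuclideanSpace ℝ (Fin (q + 2)), x ≠ 0 →
      ∀ᶠ j in Filter.atTop, v j =ᶠ[nhds x] u := by
    intro x hx
    have hx0 := norm_pos_iff.2 hx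
    have h1 : Filter.Tendsto (fun j : ℕ => ((j : ℝ) + 1) * ‖x‖) Filter.atTop Filter.atTop :=
      (Filter.tendsto_atTop_add_const_right _ _ tendsto_natCast_atTop_atTop).atTop_mul_const hx0
    filter_upwards [h1.eventually_gt_atTop 2] with j hj using (hv j).2.2.2.2.2 x hj
  have hlim1 : Filter.Tendsto (fun j => ∫ x, ‖fderiv ℝ (v j) x‖ ^ 2) Filter.atTop
      (nhds (∫ x, ‖fderiv ℝ u x‖ ^ 2)) := by
    refine tendsto_integral_of_dominated_convergence
      (fun x => 2 * ‖fderiv ℝ u x‖ ^ 2 + 2 * C ^ 2 * (u x ^ 2 / ‖x‖ ^ 2)) (fun j => ?_) ?_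
      (fun j => ?_) ?_
    · exact (((hv j).1.continuous_fderiv one_ne_zero).norm.pow 2).aestronglyMeasurable
    · refine Integrable.add (Integrable.const_mul ?_ _) (hsq.const_mul _)
      exact ((hu.continuous_fderiv one_ne_zero).norm.pow 2).integrable_of_hasCompactSupport
        ((huc.fderiv ℝ).mono fun x hx hc => hx (by simp [hc]))
    · filter_upwards [hne] with x hx
      have h1 := (hv j).2.2.2.2.1 x hx
      rw [norm_of_nonneg (by positivity)]
      calc _ ≤ (‖fderiv ℝ u x‖ + C * (|u x| / ‖x‖)) ^ 2 := by gcongr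
        _ ≤ 2 * (‖fderiv ℝ u x‖ ^ 2 + (C * (|u x| / ‖x‖)) ^ 2) := add_sq_le
        _ = _ := by
          rw [mul_pow, div_pow, sq_abs]
          ring
    · filter_upwards [hne] with x hx
      refine tendsto_const_nhds.congr' ?_
      filter_upwards [hev x hx] with j hj
      rw [hj.fderiv_eq]
  have hlim2 : Filter.Tendsto (fun j => ∫ x, hardyPotential a k q ‖x‖ / ‖x‖ ^ 2 * v j x ^ 2)
      Filter.atTop (nhds (∫ x, hardyPotential a k q ‖x‖ / ‖x‖ ^ 2 * u x ^ 2)) := by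
    refine tendsto_integral_of_dominated_convergence
      (fun x => hardyPotential a k q 1 * (u x ^ 2 / ‖x‖ ^ 2)) (fun j => ?_) (hsq.const_mul _)
      (fun j => ?_) ?_
    · exact ((((measurable_hardyPotential a k q).comp measurable_norm).div
        (measurable_norm.pow_const 2)).mul
        ((hv j).1.continuous.measurable.pow_const 2)).aestronglyMeasurable
    · filter_upwards [hne] with x hx
      have hV := hardyPotential_nonneg a k q ‖x‖
      have hV1 := hardyPotential_nonneg a k q 1
      rw [norm_of_nonneg (by positivity)]
      by_cases hxs : x ∈ tsupport (v j)
      · have h1 : v j x ^ 2 ≤ u x ^ 2 := sq_le_sq.2 ((hv j).2.2.2.1 x)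
        calc _ ≤ hardyPotential a k q 1 / ‖x‖ ^ 2 * u x ^ 2 := by
              have := h.hardyPotential_le (q := q) (mem_puncturedBall.1 ((hv j).2.2.1 hxs))
              gcongr
          _ = _ := by ring
      · rw [image_eq_zero_of_notMem_tsupport hxs]
        simp only [ne_eq, OfNat.ofNat_ne_zero, not_false_eq_true, zero_pow, mul_zero]
        positivity
    · filter_upwards [hne] with x hx
      refine tendsto_const_nhds.congr' ?_
      filter_upwards [hev x hx] with j hj
      rw [hj.eq_of_nhds]
  have hlim3 : Filter.Tendsto (fun j => ∫ x in puncturedBall _,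
      Xprod a (k + 1) ‖x‖ ^ (2 * ((q : ℝ) + 1) / q) * |v j x| ^ (2 * ((q : ℝ) + 2) / q))
      Filter.atTop (nhds (∫ x in puncturedBall _,
      Xprod a (k + 1) ‖x‖ ^ (2 * ((q : ℝ) + 1) / q) * |u x| ^ (2 * ((q : ℝ) + 2) / q))) := by
    have he : 0 < 2 * ((q : ℝ) + 2) / q := by positivity
    refine tendsto_integral_of_dominated_convergence
      (fun x => Xprod a (k + 1) 1 ^ (2 * ((q : ℝ) + 1) / q) * |u x| ^ (2 * ((q : ℝ) + 2) / q))
      (fun j => ?_) ?_ (fun j => ?_) ?_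
    · exact ((((measurable_Xprod a (k + 1)).comp measurable_norm).pow_const _).mul
        ((hv j).1.continuous.abs.measurable.pow_const _)).aestronglyMeasurable
    · refine ((Continuous.integrable_of_hasCompactSupport
        (hu.continuous.abs.rpow_const fun _ => Or.inr he.le) ?_).const_mul _).integrableOn
      exact huc.mono fun x hx hc => hx (by simp [hc, zero_rpow he.ne'])
    · refine (ae_restrict_iff' isOpen_puncturedBall.measurableSet).2
        (Filter.Eventually.of_forall fun x hx => ?_)
      have hr := mem_puncturedBall.1 hx
      have hX := h.Xprod_pos (⟨hr.1, hr.2.le⟩ : ‖x‖ ∈ Set.Ioc (0 : ℝ) 1) le_rfl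
      rw [norm_of_nonneg (by positivity)]
      exact h.Xprod_rpow_mul_le hr (by positivity) (by positivity)
        (rpow_le_rpow (abs_nonneg _) ((hv j).2.2.2.1 x) he.le)
    · filter_upwards [ae_restrict_of_ae hne] with x hx
      refine tendsto_const_nhds.congr' ?_
      filter_upwards [hev x hx] with j hj
      rw [hj.eq_of_nhds]
  refine le_of_tendsto_of_tendsto
    ((hlim3.rpow_const (Or.inr (by positivity : 0 ≤ (q : ℝ) / (q + 2)))).const_mul _)
    (hlim1.sub hlim2) (Filter.Eventually.of_forall fun j => ?_)
  exact h.hardy_sobolev_punctured hq hP (hv j).1 (hv j).2.1 (hv j).2.2.1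

end IterLogDefined

theorem hasFDerivAt_comp_inv_smul_sub {E : Type*} [NormedAddCommGroup E] [NormedSpace ℝ E]
    {ψ : E → ℝ} (hψ : Differentiable ℝ ψ) (c : ℝ) (x₀ x : E) :
    HasFDerivAt (fun x => ψ (c • (x - x₀))) (c • fderiv ℝ ψ (c • (x - x₀))) x := by
  have h := (hψ (c • (x - x₀))).hasFDerivAt.comp x
    (((hasFDerivAt_id x).sub_const x₀).const_smul c)
  refine h.congr_fderiv ?_
  ext y
  simp

theorem integral_comp_inv_smul_sub {E F : Type*} [NormedAddCommGroup E] [NormedSpace ℝ E]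
    [FiniteDimensional ℝ E] [MeasurableSpace E] [BorelSpace E] (μ : Measure E)
    [μ.IsAddHaarMeasure] [NormedAddCommGroup F] [NormedSpace ℝ F] (f : E → F) {ε : ℝ} (hε : 0 < ε)
    (x₀ : E) : ∫ x, f (ε⁻¹ • (x - x₀)) ∂μ = ε ^ Module.finrank ℝ E • ∫ x, f x ∂μ := by
  rw [integral_sub_right_eq_self (fun x => f (ε⁻¹ • x)), Measure.integral_comp_inv_smul,
    abs_of_pos (by positivity)]

/-- Rescaling concentrates the support in a given ball. -/
theorem exists_tsupport_comp_inv_smul_sub_subset {E : Type*} [NormedAddCommGroup E]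
    [NormedSpace ℝ E] {ψ : E → ℝ} (hψ : HasCompactSupport ψ) (x₀ : E) {δ : ℝ} (hδ : 0 < δ) :
    ∃ ε : ℝ, 0 < ε ∧ tsupport (fun x => ψ (ε⁻¹ • (x - x₀))) ⊆ Metric.closedBall x₀ δ := by
  obtain ⟨R, hR0, hR⟩ := hψ.isCompact.isBounded.subset_closedBall_lt 0 0
  refine ⟨δ / R, by positivity, closure_minimal (fun x hx => ?_) Metric.isClosed_closedBall⟩
  have h1 := hR (subset_tsupport ψ (Function.mem_support.2 hx))
  rw [mem_closedBall_zero_iff, norm_smul, norm_inv, norm_of_nonneg (by positivity)] at h1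
  rw [mem_closedBall_iff_norm]
  field_simp at h1
  linarith

namespace IterLogDefined

variable {a : ℝ} {k q : ℕ}

/-- Test functions concentrating at the unit sphere violate the inequality with a larger
constant. -/
theorem exists_rayleigh_lt (h : IterLogDefined a k) (hq : 1 ≤ q) {C : ℝ}
    (hC : Xprod a (k + 1) 1 ^ (-(2 * ((q : ℝ) + 1)) / (q + 2)) * sobolevConst (q + 2) < C) :
    ∃ u : EuclideanSpace ℝ (Fin (q + 2)) → ℝ, u ≠ 0 ∧ ContDiff ℝ (⊤ : ℕ∞) u ∧
      HasCompactSupport u ∧ tsupport u ⊆ puncturedBall _ ∧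
      ∫ x, ‖fderiv ℝ u x‖ ^ 2 < C * (∫ x in puncturedBall _,
        Xprod a (k + 1) ‖x‖ ^ (2 * ((q : ℝ) + 1) / q) * |u x| ^ (2 * ((q : ℝ) + 2) / q)) ^
          ((q : ℝ) / (q + 2)) := by
  have hq0 : (0 : ℝ) < q := by exact_mod_cast hq
  have hone : (1 : ℝ) ∈ Set.Ioc (0 : ℝ) 1 := by simp
  have hX := h.Xprod_pos hone le_rfl
  have hS : 0 ≤ sobolevConst (q + 2) := by
    have h1 := bubbleMass_pos (n := q + 2) (by omega)
    rw [sobolevConst_eq (by omega)]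
    push_cast
    have h2 : (0 : ℝ) ≤ q + 2 - 2 := by linarith
    positivity
  have hC0 : 0 < C := (mul_nonneg (rpow_nonneg hX.le _) hS).trans_lt hC
  have he : 0 < 2 * ((q : ℝ) + 1) / (q + 2) := by positivity
  have hlim : Filter.Tendsto (fun s => C * Xprod a (k + 1) s ^ (2 * ((q : ℝ) + 1) / (q + 2)))
      (nhds 1) (nhds (C * Xprod a (k + 1) 1 ^ (2 * ((q : ℝ) + 1) / (q + 2)))) :=
    (((h.contDiffAt_Xprod (m := 1) hone le_rfl).continuousAt.tendsto).rpow_const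
      (Or.inr he.le)).const_mul C
  have hgt : sobolevConst (q + 2) < C * Xprod a (k + 1) 1 ^ (2 * ((q : ℝ) + 1) / (q + 2)) := by
    rw [neg_div, rpow_neg hX.le, inv_mul_lt_iff₀ (by positivity)] at hC
    rwa [mul_comm]
  obtain ⟨η, hη0, hη⟩ := Metric.eventually_nhds_iff.1 (hlim.eventually_const_lt hgt)
  obtain ⟨r, hr1, hr⟩ : ∃ r : ℝ, r ∈ Set.Ioo (0 : ℝ) 1 ∧ 1 - η < r :=
    ⟨max (1 / 2) (1 - η / 2), ⟨by positivity, max_lt (by norm_num) (by linarith)⟩,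
      lt_max_of_lt_right (by linarith)⟩
  set p := Xprod a (k + 1) r with hp
  have hp0 : 0 < p := h.Xprod_pos ⟨hr1.1, hr1.2.le⟩ le_rfl
  have hpC : sobolevConst (q + 2) < C * p ^ (2 * ((q : ℝ) + 1) / (q + 2)) :=
    hη (by rw [dist_eq, abs_sub_lt_iff]; constructor <;> linarith [hr1.2])
  obtain ⟨ψ, hψ, hψc, hlt⟩ := exists_almost_extremal (n := q + 2) (by omega) hpC
  have en : ((q + 2 : ℕ) : ℝ) - 2 = q := by push_cast; ring
  rw [en] at hlt
  push_cast at hlt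
  set e₀ : EuclideanSpace ℝ (Fin (q + 2)) := EuclideanSpace.single 0 1
  have he₀ : ‖e₀‖ = 1 := by simp [e₀]
  set x₀ := ((1 + r) / 2) • e₀ with hx₀
  have hx₀n : ‖x₀‖ = (1 + r) / 2 := by
    have := hr1.1
    rw [hx₀, norm_smul, he₀, mul_one, norm_of_nonneg (by positivity)]
  obtain ⟨ε, hε, hsupp⟩ := exists_tsupport_comp_inv_smul_sub_subset hψc x₀
    (δ := (1 - r) / 4) (by linarith [hr1.2])
  set u := fun x => ψ (ε⁻¹ • (x - x₀)) with hu
  have hshell : ∀ x ∈ tsupport u, r ≤ ‖x‖ ∧ ‖x‖ < 1 := by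
    intro x hx
    have h1 := mem_closedBall_iff_norm.1 (hsupp hx)
    have h2 := (abs_le.1 (abs_norm_sub_norm_le x x₀)).1
    have h3 := (abs_le.1 (abs_norm_sub_norm_le x x₀)).2
    rw [hx₀n] at h2 h3
    constructor <;> linarith [hr1.2]
  have husub : tsupport u ⊆ puncturedBall _ := fun x hx =>
    mem_puncturedBall.2 ⟨hr1.1.trans_le (hshell x hx).1, (hshell x hx).2⟩
  have huC : ContDiff ℝ (⊤ : ℕ∞) u :=
    hψ.comp ((contDiff_id.sub contDiff_const).const_smul _)
  have huc : HasCompactSupport u :=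
    (isCompact_closedBall x₀ _).of_isClosed_subset (isClosed_tsupport u) hsupp
  have hs : 0 < 2 * ((q : ℝ) + 2) / q := by positivity
  have hgrad : ∫ x, ‖fderiv ℝ u x‖ ^ 2 = ε ^ q * ∫ x, ‖fderiv ℝ ψ x‖ ^ 2 := by
    have h1 : ∀ x, ‖fderiv ℝ u x‖ ^ 2 =
        (fun y => ε⁻¹ ^ 2 * ‖fderiv ℝ ψ y‖ ^ 2) (ε⁻¹ • (x - x₀)) := fun x => by
      rw [(hasFDerivAt_comp_inv_smul_sub (hψ.differentiable (by simp)) ε⁻¹ x₀ x).fderiv, norm_smul,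
        mul_pow, norm_of_nonneg (by positivity)]
    simp only [h1]
    rw [integral_comp_inv_smul_sub _ (fun y => ε⁻¹ ^ 2 * ‖fderiv ℝ ψ y‖ ^ 2) hε, integral_const_mul, finrank_euclideanSpace_fin]
    simp only [smul_eq_mul, pow_add]
    field_simp
  have hmass : ∫ x, |u x| ^ (2 * ((q : ℝ) + 2) / q) =
      ε ^ (q + 2) * ∫ x, |ψ x| ^ (2 * ((q : ℝ) + 2) / q) := by
    rw [integral_comp_inv_smul_sub _ (fun y => |ψ y| ^ (2 * ((q : ℝ) + 2) / q)) hε,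
      finrank_euclideanSpace_fin, smul_eq_mul]
  set J := ∫ x, |ψ x| ^ (2 * ((q : ℝ) + 2) / q) with hJ
  have hJ0 : 0 ≤ J := integral_nonneg fun x => by positivity
  have huint : Integrable fun x => |u x| ^ (2 * ((q : ℝ) + 2) / q) :=
    (huC.continuous.abs.rpow_const fun _ => Or.inr hs.le).integrable_of_hasCompactSupport
      (huc.mono fun x hx hc => hx (by simp [hc, zero_rpow hs.ne']))
  have hm : MeasurableSet (puncturedBall (EuclideanSpace ℝ (Fin (q + 2)))) :=
    isOpen_puncturedBall.measurableSet
  have hweighted : p ^ (2 * ((q : ℝ) + 1) / q) * (ε ^ (q + 2) * J) ≤ ∫ x in puncturedBall _,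
      Xprod a (k + 1) ‖x‖ ^ (2 * ((q : ℝ) + 1) / q) * |u x| ^ (2 * ((q : ℝ) + 2) / q) := by
    rw [← hmass, ← integral_const_mul, ← setIntegral_eq_integral_of_forall_compl_eq_zero
      (s := puncturedBall _) fun x hx => by
        rw [image_eq_zero_of_notMem_tsupport fun hc => hx (husub hc), abs_zero, zero_rpow hs.ne',
          mul_zero]]
    refine setIntegral_mono_on (huint.const_mul _).integrableOn ?_ hm fun x hx => ?_
    · refine Integrable.mono' (huint.const_mul (Xprod a (k + 1) 1 ^ (2 * ((q : ℝ) + 1) / q))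
        ).integrableOn ((((measurable_Xprod a (k + 1)).comp measurable_norm).pow_const _).mul
        (huC.continuous.abs.measurable.pow_const _)).aestronglyMeasurable
        ((ae_restrict_iff' hm).2 (Filter.Eventually.of_forall fun x hx => ?_))
      have hr := mem_puncturedBall.1 hx
      have hX := h.Xprod_pos (⟨hr.1, hr.2.le⟩ : ‖x‖ ∈ Set.Ioc (0 : ℝ) 1) le_rfl
      rw [norm_of_nonneg (by positivity)]
      exact h.Xprod_rpow_mul_le hr (by positivity) (by positivity) le_rfl
    · by_cases hxs : x ∈ tsupport u
      · have h1 := hshell x hxs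
        exact mul_le_mul_of_nonneg_right (rpow_le_rpow hp0.le
          (h.Xprod_mono hr1.1 h1.1 h1.2.le le_rfl) (by positivity)) (by positivity)
      · rw [image_eq_zero_of_notMem_tsupport hxs, abs_zero, zero_rpow hs.ne', mul_zero, mul_zero]
  refine ⟨u, ?_, huC, huc, husub, ?_⟩
  · intro hu0
    have hψ0 : ∀ y, ψ y = 0 := fun y => by
      have h1 : u (ε • y + x₀) = 0 := by rw [hu0, Pi.zero_apply]
      simp only [hu] at h1
      rwa [add_sub_cancel_right, inv_smul_smul₀ hε.ne'] at h1
    have h1 : 0 ≤ ∫ x, ‖fderiv ℝ ψ x‖ ^ 2 := integral_nonneg fun x => by positivity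
    rw [hJ] at hlt
    simp only [hψ0, abs_zero, zero_rpow hs.ne', integral_zero] at hlt
    rw [zero_rpow (by positivity), mul_zero] at hlt
    exact hlt.not_ge h1
  · rw [hgrad]
    calc ε ^ q * ∫ x, ‖fderiv ℝ ψ x‖ ^ 2
        < ε ^ q * (C * p ^ (2 * ((q : ℝ) + 1) / (q + 2)) * J ^ ((q : ℝ) / (q + 2))) :=
          mul_lt_mul_of_pos_left hlt (by positivity)
      _ = C * (p ^ (2 * ((q : ℝ) + 1) / q) * (ε ^ (q + 2) * J)) ^ ((q : ℝ) / (q + 2)) := by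
          rw [mul_rpow (by positivity) (by positivity), mul_rpow (by positivity) hJ0,
            ← rpow_mul hp0.le, ← rpow_natCast ε (q + 2), ← rpow_mul hε.le, ← rpow_natCast ε q]
          have e1 : 2 * ((q : ℝ) + 1) / q * (q / (q + 2)) = 2 * (q + 1) / (q + 2) := by field_simp
          have e2 : ((q + 2 : ℕ) : ℝ) * (q / (q + 2)) = q := by
            push_cast
            field_simp
          rw [e1, e2]
          ring
      _ ≤ _ := mul_le_mul_of_nonneg_left (rpow_le_rpow (by positivity) hweighted (by positivity))
          hC0.le

end IterLogDefined

theorem ball_ae_eq_puncturedBall {n : ℕ} (hn : 1 ≤ n) :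
    Metric.ball (0 : EuclideanSpace ℝ (Fin n)) 1 =ᵐ[volume] puncturedBall _ := by
  have : Nonempty (Fin n) := ⟨⟨0, hn⟩⟩
  exact (sdiff_null_ae_eq_self (measure_singleton 0)).symm

theorem setIntegral_ball_norm_gradient_sq {n : ℕ} {u : EuclideanSpace ℝ (Fin n) → ℝ}
    (hus : tsupport u ⊆ Metric.ball 0 1) :
    ∫ x in Metric.ball (0 : EuclideanSpace ℝ (Fin n)) 1, ‖gradient u x‖ ^ 2 =
      ∫ x, ‖fderiv ℝ u x‖ ^ 2 := by
  simp only [norm_gradient_eq_norm_fderiv]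
  refine setIntegral_eq_integral_of_forall_compl_eq_zero fun x hx => ?_
  rw [image_eq_zero_of_notMem_tsupport fun hc => hx (hus (tsupport_fderiv_subset ℝ hc))]
  simp

theorem IterLogDefined.integral_hardyPotential {a : ℝ} {k q : ℕ} (h : IterLogDefined a k)
    (hq : 1 ≤ q) {u : EuclideanSpace ℝ (Fin (q + 2)) → ℝ} (hu : Continuous u)
    (huc : HasCompactSupport u) (hus : tsupport u ⊆ Metric.ball 0 1) :
    ∫ x, hardyPotential a k q ‖x‖ / ‖x‖ ^ 2 * u x ^ 2 = ((q : ℝ) / 2) ^ 2 *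
      (∫ x in Metric.ball (0 : EuclideanSpace ℝ (Fin (q + 2))) 1, u x ^ 2 / ‖x‖ ^ 2) +
      (1 / 4 : ℝ) * ∑ i ∈ Finset.Icc 1 k,
        ∫ x in Metric.ball (0 : EuclideanSpace ℝ (Fin (q + 2))) 1,
          (∏ j ∈ Finset.Icc 1 i, (Xiter a j ‖x‖) ^ 2) / ‖x‖ ^ 2 * u x ^ 2 := by
  have hsq := integrable_sq_div_norm_sq (by omega) hu huc hus
  have hm : MeasurableSet (puncturedBall (EuclideanSpace ℝ (Fin (q + 2)))) :=
    isOpen_puncturedBall.measurableSet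
  have hX : ∀ i ∈ Finset.Icc 1 k, IntegrableOn
      (fun x => (∏ j ∈ Finset.Icc 1 i, (Xiter a j ‖x‖) ^ 2) / ‖x‖ ^ 2 * u x ^ 2)
      (Metric.ball 0 1) := by
    intro i hi
    rw [integrableOn_congr_set_ae (ball_ae_eq_puncturedBall (by omega))]
    simp only [Finset.prod_pow]
    refine Integrable.mono' (hsq.const_mul (Xprod a i 1 ^ 2)).integrableOn
      (((((measurable_Xprod a i).comp measurable_norm).pow_const 2).div
        (measurable_norm.pow_const 2)).mul (hu.measurable.pow_const 2)).aestronglyMeasurable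
      ((ae_restrict_iff' hm).2 (Filter.Eventually.of_forall fun x hx => ?_))
    have hr := mem_puncturedBall.1 hx
    have hi' := (Finset.mem_Icc.1 hi).2
    have h1 := h.Xprod_mono hr.1 hr.2.le le_rfl (i := i) (by omega)
    have h0 := h.Xprod_pos (⟨hr.1, hr.2.le⟩ : ‖x‖ ∈ Set.Ioc (0 : ℝ) 1) (i := i) (by omega)
    rw [norm_of_nonneg (by positivity)]
    calc _ ≤ Xprod a i 1 ^ 2 / ‖x‖ ^ 2 * u x ^ 2 :=
          mul_le_mul_of_nonneg_right (div_le_div_of_nonneg_right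
            (pow_le_pow_left₀ h0.le h1 2) (by positivity)) (by positivity)
      _ = _ := by ring
  rw [← integral_finsetSum _ hX, ← integral_const_mul, ← integral_const_mul,
    ← integral_add (hsq.const_mul _).integrableOn ((integrable_finsetSum _ hX).const_mul _),
    ← setIntegral_eq_integral_of_forall_compl_eq_zero (s := Metric.ball 0 1)]
  · refine setIntegral_congr_fun measurableSet_ball fun x _ => ?_
    simp only [hardyPotential, Xprod, Finset.prod_pow, add_div, add_mul, ← Finset.sum_mul,
      ← Finset.sum_div]
    ring
  · intro x hx
    rw [image_eq_zero_of_notMem_tsupport fun hc => hx (hus hc)]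
    simp

theorem stmt19 (n : ℕ) (hn : 3 ≤ n) (k : ℕ) (hk : 1 ≤ k)
    (a : ℝ) (ha0 : 0 < a)
    (hdef : ∀ s ∈ Set.Ioc (0 : ℝ) 1, ∀ i, 1 ≤ i → i ≤ k → 0 < a - Real.log (Xiter a i s))
    (P : ℝ) (hP : P = ∏ i ∈ Finset.Icc 1 (k + 1), Xiter a i 1)
    (hPgt : P > (n : ℝ) - 2) :
    (∀ u : EuclideanSpace ℝ (Fin n) → ℝ, ContDiff ℝ (⊤ : ℕ∞) u → HasCompactSupport u →
      tsupport u ⊆ Metric.ball (0 : EuclideanSpace ℝ (Fin n)) 1 →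
      (∫ x in Metric.ball (0 : EuclideanSpace ℝ (Fin n)) 1, ‖gradient u x‖ ^ 2)
        ≥ (((n : ℝ) - 2) / 2) ^ 2 *
          (∫ x in Metric.ball (0 : EuclideanSpace ℝ (Fin n)) 1, u x ^ 2 / ‖x‖ ^ 2)
          + (1 / 4 : ℝ) * (∑ i ∈ Finset.Icc 1 k,
          ∫ x in Metric.ball (0 : EuclideanSpace ℝ (Fin n)) 1,
            (∏ j ∈ Finset.Icc 1 i, (Xiter a j ‖x‖) ^ 2) / ‖x‖ ^ 2 * u x ^ 2)
          + P ^ (-(2 * ((n : ℝ) - 1)) / (n : ℝ)) * sobolevConst n *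
          (∫ x in Metric.ball (0 : EuclideanSpace ℝ (Fin n)) 1,
              (∏ i ∈ Finset.Icc 1 (k + 1), Xiter a i ‖x‖)
                  ^ (2 * ((n : ℝ) - 1) / ((n : ℝ) - 2)) *
                |u x| ^ (2 * (n : ℝ) / ((n : ℝ) - 2)))
            ^ (((n : ℝ) - 2) / (n : ℝ)))
    ∧
    (∀ C : ℝ, C > P ^ (-(2 * ((n : ℝ) - 1)) / (n : ℝ)) * sobolevConst n →
      ∃ u : EuclideanSpace ℝ (Fin n) → ℝ, u ≠ 0 ∧ ContDiff ℝ (⊤ : ℕ∞) u ∧ HasCompactSupport u ∧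
        tsupport u ⊆ Metric.ball (0 : EuclideanSpace ℝ (Fin n)) 1 ∧
        ¬ ((∫ x in Metric.ball (0 : EuclideanSpace ℝ (Fin n)) 1, ‖gradient u x‖ ^ 2)
          ≥ (((n : ℝ) - 2) / 2) ^ 2 *
          (∫ x in Metric.ball (0 : EuclideanSpace ℝ (Fin n)) 1, u x ^ 2 / ‖x‖ ^ 2)
            + (1 / 4 : ℝ) * (∑ i ∈ Finset.Icc 1 k,
          ∫ x in Metric.ball (0 : EuclideanSpace ℝ (Fin n)) 1,
            (∏ j ∈ Finset.Icc 1 i, (Xiter a j ‖x‖) ^ 2) / ‖x‖ ^ 2 * u x ^ 2)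
            + C *
          (∫ x in Metric.ball (0 : EuclideanSpace ℝ (Fin n)) 1,
              (∏ i ∈ Finset.Icc 1 (k + 1), Xiter a i ‖x‖)
                  ^ (2 * ((n : ℝ) - 1) / ((n : ℝ) - 2)) *
                |u x| ^ (2 * (n : ℝ) / ((n : ℝ) - 2)))
            ^ (((n : ℝ) - 2) / (n : ℝ)))) := by
  have h : IterLogDefined a k := iterLogDefined_of_pos ha0 hdef
  obtain ⟨q, rfl⟩ := Nat.exists_eq_add_of_le' (show 2 ≤ n by omega)
  have hq : 1 ≤ q := by omega
  have hPX : P = Xprod a (k + 1) 1 := hP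
  have e1 : (q : ℝ) + 2 - 2 = q := by ring
  have e2 : (q : ℝ) + 2 - 1 = q + 1 := by ring
  have e3 : ∀ f : EuclideanSpace ℝ (Fin (q + 2)) → ℝ,
      ∫ x in Metric.ball 0 1, f x = ∫ x in puncturedBall _, f x := fun f =>
    setIntegral_congr_set (ball_ae_eq_puncturedBall (by omega))
  simp only [Nat.cast_add, Nat.cast_ofNat, e1, e2] at hPgt ⊢
  refine ⟨fun u hu huc hus => ?_, fun C hC => ?_⟩
  · rw [setIntegral_ball_norm_gradient_sq hus, ← h.integral_hardyPotential hq hu.continuous huc hus]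
    have h1 := h.hardy_sobolev hq (hPX ▸ hPgt) (hu.of_le (by simp)) huc hus
    rw [← hPX] at h1
    simp only [Xprod] at h1
    rw [e3 fun x => (∏ i ∈ Finset.Icc 1 (k + 1), Xiter a i ‖x‖) ^ _ * _]
    linarith
  · rw [hPX] at hC
    obtain ⟨u, hu0, hu, huc, hus, hlt⟩ := h.exists_rayleigh_lt hq hC
    have hus' : tsupport u ⊆ Metric.ball 0 1 := hus.trans Set.sdiff_subset
    refine ⟨u, hu0, hu, huc, hus', ?_⟩
    rw [setIntegral_ball_norm_gradient_sq hus', ge_iff_le, not_le]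
    rw [e3 fun x => (∏ i ∈ Finset.Icc 1 (k + 1), Xiter a i ‖x‖) ^ _ * _]
    refine hlt.trans_le (le_add_of_nonneg_left ?_)
    rw [← h.integral_hardyPotential hq hu.continuous huc hus']
    exact integral_nonneg fun x => mul_nonneg (div_nonneg
      (IterLogDefined.hardyPotential_nonneg a k q _) (by positivity)) (by positivity)
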